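/- arXiv:2105.05025 — 2 statements merged into one kernel-verified Lean document; each statement's English description precedes it below -/
import Mathlib

section
/- Let n ≥ 2 and let u₀ : S¹ → S^{n−1} satisfy ‖u₀‖_{Ḣ^{1/2}} < ∞. Let u and v be energy-class solutions of the half-harmonic gradient flow with initial datum u₀ which additionally satisfy: (a) for a.e. t ≥ 0, u(t,·) and v(t,·) lie in H¹(S¹), with ∫₀^T ‖u(t,·)‖²_{H¹} dt < ∞ and ∫₀^T ‖v(t,·)‖²_{H¹} dt < ∞ for every T > 0; (b) ‖u(t,·)‖_{Ḣ^{1/2}} ≤ ‖u₀‖_{Ḣ^{1/2}} and ‖v(t,·)‖_{Ḣ^{1/2}} ≤ ‖u₀‖_{Ḣ^{1/2}} for a.e. t ≥ 0. Then u = v almost everywhere on [0,∞)×S¹. -/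
open MeasureTheory Real Filter
open scoped BigOperators ENNReal Real Topology

noncomputable section

/-- Chord distance on `S¹ ≃ ℝ/2πℤ`: `|x-y| = 2|sin((x-y)/2)|`. -/
def cd (x y : ℝ) : ℝ := 2 * |Real.sin ((x - y) / 2)|

/-- Fundamental domain for the circle `S¹ ≃ ℝ/2πℤ`. -/
def circ : Set ℝ := Set.Ioc (-π) π

/-- `k`-th Fourier coefficient of a `2π`-periodic function `ℝ → ℂ`. -/
def fc (f : ℝ → ℂ) (k : ℤ) : ℂ :=
  ((1 / (2 * π) : ℝ) : ℂ) * ∫ x in circ, f x * Complex.exp (-(Complex.I * (k : ℂ) * (x : ℂ)))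

/-- Fourier coefficient of a real-valued function. -/
def fcR (f : ℝ → ℝ) (k : ℤ) : ℂ := fc (fun x => (f x : ℂ)) k

/-- `ℝⁿ` as a Euclidean space. -/
abbrev E (n : ℕ) := EuclideanSpace ℝ (Fin n)

/-- Componentwise Fourier coefficients of a vector-valued map. -/
def fcV {n : ℕ} (u : ℝ → E n) (k : ℤ) (i : Fin n) : ℂ := fcR (fun x => u x i) k

/-- Squared homogeneous `Ḣ^{1/2}` seminorm: `∑_k |k| |û(k)|²` (valued in `[0,∞]`). -/
def hHalf {n : ℕ} (u : ℝ → E n) : ℝ≥0∞ :=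
  ∑' k : ℤ, (k.natAbs : ℝ≥0∞) * ∑ i, (‖fcV u k i‖₊ : ℝ≥0∞) ^ 2

/-- Squared inhomogeneous `H^s` norm: `∑_k (1+k²)^s |û(k)|²` (valued in `[0,∞]`). -/
def hSob {n : ℕ} (s : ℝ) (u : ℝ → E n) : ℝ≥0∞ :=
  ∑' k : ℤ, ENNReal.ofReal ((1 + (k : ℝ) ^ 2) ^ s) * ∑ i, (‖fcV u k i‖₊ : ℝ≥0∞) ^ 2

/-- Squared homogeneous `Ḣ^{1/2}` seminorm of a scalar function. -/
def hHalfR (f : ℝ → ℝ) : ℝ≥0∞ :=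
  ∑' k : ℤ, (k.natAbs : ℝ≥0∞) * (‖fcR f k‖₊ : ℝ≥0∞) ^ 2

/-- Squared inhomogeneous `H^s` norm of a scalar function. -/
def hSobR (s : ℝ) (f : ℝ → ℝ) : ℝ≥0∞ :=
  ∑' k : ℤ, ENNReal.ofReal ((1 + (k : ℝ) ^ 2) ^ s) * (‖fcR f k‖₊ : ℝ≥0∞) ^ 2

/-- `|d_{1/2}u|²(x) = ∫_{S¹} |u(x)-u(y)|²/|x-y|² dy`. -/
def gagl {n : ℕ} (u : ℝ → E n) (x : ℝ) : ℝ :=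
  ∫ y in circ, (∑ i, (u x i - u y i) ^ 2) / cd x y ^ 2

/-- `∫_{S¹}∫_{S¹} d_{1/2}u(x,y)·d_{1/2}φ(x,y) dy dx/|x-y|`. -/
def pairing {n : ℕ} (u φ : ℝ → E n) : ℝ :=
  ∫ x in circ, ∫ y in circ, (∑ i, (u x i - u y i) * (φ x i - φ y i)) / cd x y ^ 2

/-- The product measure on `(0,∞) × S¹`. -/
def STmeasure : Measure (ℝ × ℝ) :=
  (volume.restrict (Set.Ioi (0 : ℝ))).prod (volume.restrict circ)

/-- Smooth test functions on `(0,∞) × S¹`, compactly supported in time. -/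
structure IsSTTest (n : ℕ) (φ : ℝ → ℝ → E n) : Prop where
  smooth : ContDiff ℝ (⊤ : ℕ∞) (fun p : ℝ × ℝ => φ p.1 p.2)
  periodic : ∀ t, Function.Periodic (φ t) (2 * π)
  suppTime : ∃ a b : ℝ, 0 < a ∧ ∀ t, t ∉ Set.Icc a b → ∀ x, φ t x = 0

/-- Energy-class solution of the half-harmonic gradient flow, with explicit
weak time derivative `w`. -/
structure IsEnergySolAux (n : ℕ) (u₀ : ℝ → E n) (u w : ℝ → ℝ → E n) : Prop where
  meas : Measurable (Function.uncurry u)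
  periodic : ∀ t, Function.Periodic (u t) (2 * π)
  sphere : ∀ᵐ p ∂STmeasure, ‖u p.1 p.2‖ = 1
  energyBdd : ∃ M : ℝ≥0∞, M < ⊤ ∧
    ∀ᵐ t ∂(volume.restrict (Set.Ioi (0 : ℝ))), hHalf (u t) ≤ M
  wMeas : Measurable (Function.uncurry w)
  wL2 : (∫⁻ t in Set.Ioi (0 : ℝ), ∫⁻ x in circ, (‖w t x‖₊ : ℝ≥0∞) ^ 2) < ⊤
  weakDeriv : ∀ φ : ℝ → ℝ → E n, IsSTTest n φ →
    (∫ t in Set.Ioi (0 : ℝ), ∫ x in circ, ∑ i, u t x i * deriv (fun s => φ s x i) t)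
      = - ∫ t in Set.Ioi (0 : ℝ), ∫ x in circ, ∑ i, w t x i * φ t x i
  flow : ∀ φ : ℝ → ℝ → E n, IsSTTest n φ →
    (∫ t in Set.Ioi (0 : ℝ), ∫ x in circ, ∑ i, w t x i * φ t x i)
      + (∫ t in Set.Ioi (0 : ℝ), pairing (u t) (φ t))
      = ∫ t in Set.Ioi (0 : ℝ), ∫ x in circ, gagl (u t) x * ∑ i, u t x i * φ t x i
  init : Tendsto (fun t => ∫⁻ x in circ, (‖u t x - u₀ x‖₊ : ℝ≥0∞) ^ 2)
      (nhdsWithin 0 (Set.Ioi 0)) (nhds 0)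

/-- Energy-class solution of the half-harmonic gradient flow. -/
def IsEnergySol (n : ℕ) (u₀ : ℝ → E n) (u : ℝ → ℝ → E n) : Prop :=
  ∃ w, IsEnergySolAux n u₀ u w

/-- Energy decay: `‖u(t,·)‖_{Ḣ^{1/2}} ≤ ‖u₀‖_{Ḣ^{1/2}}` for a.e. `t ≥ 0`. -/
def EnergyDecay {n : ℕ} (u₀ : ℝ → E n) (u : ℝ → ℝ → E n) : Prop :=
  ∀ᵐ t ∂(volume.restrict (Set.Ioi (0 : ℝ))), hHalf (u t) ≤ hHalf u₀

/-- Fractional Laplacian `(-Δ)^s` of a `2π`-periodic function, via Fourier series. -/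
def fracLapC (s : ℝ) (f : ℝ → ℂ) (x : ℝ) : ℂ :=
  ∑' k : ℤ, (((k.natAbs : ℝ) ^ s : ℝ) : ℂ) * fc f k * Complex.exp (Complex.I * (k : ℂ) * (x : ℂ))

/-- Fractional Laplacian of a real-valued function. -/
def fracLapR (s : ℝ) (f : ℝ → ℝ) (x : ℝ) : ℝ := (fracLapC s (fun y => (f y : ℂ)) x).re

/-- Half-Laplacian of a vector-valued map. -/
def halfLap {n : ℕ} (u : ℝ → E n) (x : ℝ) : E n :=
  (EuclideanSpace.equiv (Fin n) ℝ).symm fun i => fracLapR 1 (fun y => u y i) x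

/-- The integral `C(j,k) = ∫_{-π}^{π} (e^{ijh}-1)(e^{ikh}-1)/(4sin²(h/2)) dh`. -/
def Cjk (j k : ℤ) : ℂ :=
  ∫ h in circ, (Complex.exp (Complex.I * (j : ℂ) * (h : ℂ)) - 1)
      * (Complex.exp (Complex.I * (k : ℂ) * (h : ℂ)) - 1)
      / ((4 * Real.sin (h / 2) ^ 2 : ℝ) : ℂ)

/-- A real trigonometric polynomial: the function equals a finite Fourier sum. -/
def IsTrigPoly (u : ℝ → ℝ) : Prop :=
  ∃ s : Finset ℤ, ∀ x : ℝ,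
    (u x : ℂ) = ∑ k ∈ s, fcR u k * Complex.exp (Complex.I * (k : ℂ) * (x : ℂ))

/-- `d_{1/2}u · d_{1/2}v` as a (complex-valued) function on the circle. -/
def d12prod (u v : ℝ → ℝ) (x : ℝ) : ℂ :=
  ((∫ y in circ, (u x - u y) * (v x - v y) / cd x y ^ 2 : ℝ) : ℂ)

/-- Stereographic projection of `S¹ ∖ {-i}`. -/
def stproj (θ : ℝ) : ℝ := Real.cos θ / (1 + Real.sin θ)


/-- The kernel `1 / (4 sin²(h/2))` on the circle. -/
def chordKernel (h : ℝ) : ℝ≥0∞ := ENNReal.ofReal (((2 * |Real.sin (h / 2)|) ^ 2)⁻¹)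

/-- The squared `L²` norm on the circle. -/
def sqNorm {F : Type*} [NormedAddCommGroup F] (f : ℝ → F) : ℝ≥0∞ :=
  ∫⁻ x in circ, ‖f x‖ₑ ^ 2

/-- The squared half fractional gradient `|d_{1/2} f|²(x)` with values in `[0,∞]`. -/
def gradSq {F : Type*} [NormedAddCommGroup F] (f : ℝ → F) (x : ℝ) : ℝ≥0∞ :=
  ∫⁻ h in circ, chordKernel h * ‖f (x + h) - f x‖ₑ ^ 2

/-- The Gagliardo energy of a function on the circle. -/
def gagEnergy {F : Type*} [NormedAddCommGroup F] (f : ℝ → F) : ℝ≥0∞ :=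
  ∫⁻ x in circ, gradSq f x

/-- The weighted energy `∫ |d_{1/2} f|² |w|²`. -/
def weightedEnergy {F G : Type*} [NormedAddCommGroup F] [NormedAddCommGroup G]
    (f : ℝ → F) (w : ℝ → G) : ℝ≥0∞ :=
  ∫⁻ x in circ, gradSq f x * ‖w x‖ₑ ^ 2

/-- The second order Gagliardo energy, built from the increments of `f`. -/
def incrEnergy {F : Type*} [NormedAddCommGroup F] (f : ℝ → F) : ℝ≥0∞ :=
  ∫⁻ h in circ, chordKernel h * gagEnergy (fun x => f (x + h) - f x)

lemma measurable_chordKernel : Measurable chordKernel := by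
  unfold chordKernel
  fun_prop

lemma volume_circ : volume circ = ENNReal.ofReal (2 * π) := by
  simp only [circ, Real.volume_Ioc]
  congr 1
  ring

instance : IsFiniteMeasure (volume.restrict circ) :=
  ⟨by simp [volume_circ, ENNReal.mul_lt_top]⟩

lemma lintegral_circ_add {F : ℝ → ℝ≥0∞} (hF : Function.Periodic F (2 * π)) (h : ℝ) :
    ∫⁻ x in circ, F (x + h) = ∫⁻ x in circ, F x := by
  have h1 : ∫⁻ x in circ, F (x + h) = ∫⁻ x in Set.Ioc (-π + h) (-π + h + 2 * π), F x := by
    have := (measurePreserving_add_right (volume : Measure ℝ) h).setLIntegral_comp_preimage_emb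
      (measurableEmbedding_addRight h) F (Set.Ioc (-π + h) (-π + h + 2 * π))
    rw [← this]
    congr 2
    ext x
    simp only [circ, Set.mem_Ioc, Set.mem_preimage]
    constructor <;> rintro ⟨a, b⟩ <;> constructor <;> linarith
  have h2 : circ = Set.Ioc (-π) (-π + 2 * π) := by
    unfold circ; congr 1; ring
  rw [h1, h2]
  refine (isAddFundamentalDomain_Ioc Real.two_pi_pos (-π + h)).setLIntegral_eq
    (isAddFundamentalDomain_Ioc Real.two_pi_pos (-π)) F ?_
  rintro ⟨g, hg⟩ x
  obtain ⟨k, rfl⟩ := AddSubgroup.mem_zmultiples_iff.1 hg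
  have := hF.zsmul k x
  simpa [AddSubgroup.vadd_def, add_comm] using this

section
variable {F G : Type*} [NormedAddCommGroup F] [NormedAddCommGroup G]

lemma gradSq_shift {f : ℝ → F} {x : ℝ} (hf : Function.Periodic f (2 * π)) :
    gradSq f x = ∫⁻ y in circ, ENNReal.ofReal ((cd x y ^ 2)⁻¹) * ‖f x - f y‖ₑ ^ 2 := by
  rw [← lintegral_circ_add _ x]
  · unfold gradSq
    refine lintegral_congr fun h => ?_
    have : cd x (h + x) = 2 * |Real.sin (h / 2)| := by
      unfold cd
      rw [show (x - (h + x)) / 2 = - (h / 2) by ring, Real.sin_neg, abs_neg]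
    rw [this, add_comm x h, ← enorm_neg]
    simp [chordKernel]
  · intro y
    have : cd x (y + 2 * π) = cd x y := by
      unfold cd
      rw [show (x - (y + 2 * π)) / 2 = (x - y) / 2 - π by ring, Real.sin_sub_pi, abs_neg]
    simp only [this, hf y]

variable [MeasurableSpace F] [BorelSpace F] [SecondCountableTopology F]

lemma measurable_incr {f : ℝ → F} (hf : Measurable f) :
    Measurable (fun p : ℝ × ℝ => chordKernel p.2 * ‖f (p.1 + p.2) - f p.1‖ₑ ^ 2) := by
  have := measurable_chordKernel
  fun_prop

lemma measurable_gradSq {f : ℝ → F} (hf : Measurable f) : Measurable (gradSq f) :=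
  (measurable_incr hf).lintegral_prod_right'

lemma gagEnergy_eq {f : ℝ → F} (hf : Measurable f) :
    gagEnergy f = ∫⁻ h in circ, chordKernel h * sqNorm (fun x => f (x + h) - f x) := by
  unfold gagEnergy gradSq sqNorm
  rw [lintegral_lintegral_swap (measurable_incr hf).aemeasurable]
  refine lintegral_congr fun h => ?_
  rw [lintegral_const_mul]
  fun_prop

lemma weightedEnergy_eq [MeasurableSpace G] [BorelSpace G] {f : ℝ → F} {w : ℝ → G}
    (hf : Measurable f) (hw : Measurable w) :
    weightedEnergy f w = ∫⁻ h in circ, chordKernel h *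
      ∫⁻ x in circ, ‖f (x + h) - f x‖ₑ ^ 2 * ‖w x‖ₑ ^ 2 := by
  have hm : Measurable (fun p : ℝ × ℝ =>
      chordKernel p.2 * (‖f (p.1 + p.2) - f p.1‖ₑ ^ 2 * ‖w p.1‖ₑ ^ 2)) := by
    have := measurable_chordKernel
    fun_prop
  calc weightedEnergy f w = ∫⁻ x in circ, ∫⁻ h in circ,
        chordKernel h * (‖f (x + h) - f x‖ₑ ^ 2 * ‖w x‖ₑ ^ 2) := by
        refine lintegral_congr fun x => ?_
        have hm' : Measurable fun h => chordKernel h * ‖f (x + h) - f x‖ₑ ^ 2 :=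
          measurable_chordKernel.mul (by fun_prop)
        simp only [gradSq, ← lintegral_mul_const _ hm', mul_assoc]
    _ = _ := by
        rw [lintegral_lintegral_swap hm.aemeasurable]
        refine lintegral_congr fun h => ?_
        rw [lintegral_const_mul]
        fun_prop

lemma one_le_sq_mul_chordKernel {r h : ℝ} (h0 : h ≠ 0) (hr : |h| ≤ r) (hπ : r ≤ π) :
    1 ≤ ENNReal.ofReal (r ^ 2) * chordKernel h := by
  have hs : Real.sin (h / 2) ≠ 0 := by
    intro hs
    have := abs_le.1 (hr.trans hπ)
    have := (Real.sin_eq_zero_iff_of_lt_of_lt (x := h / 2)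
      (by linarith [Real.pi_pos]) (by linarith [Real.pi_pos])).1 hs
    exact h0 (by linarith)
  have h2 : 2 * |Real.sin (h / 2)| ≤ r := by
    have := Real.abs_sin_le_abs (x := h / 2)
    rw [abs_div, abs_two] at this
    linarith
  have h3 : 0 < 2 * |Real.sin (h / 2)| := by positivity
  unfold chordKernel
  rw [← ENNReal.ofReal_mul (sq_nonneg r), ENNReal.one_le_ofReal, ← div_eq_mul_inv,
    one_le_div (by positivity)]
  gcongr

lemma sq_le_avg {f : ℝ → F} (hf : Measurable f) (hp : Function.Periodic f (2 * π)) (x : ℝ)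
    {r : ℝ} (hπ : r ≤ π) :
    ENNReal.ofReal (2 * r) * ‖f x‖ₑ ^ 2 ≤
      2 * sqNorm f + 2 * (ENNReal.ofReal (r ^ 2) * gradSq f x) := by
  have hsub : Set.Ioc (-r) r ⊆ circ := Set.Ioc_subset_Ioc (neg_le_neg hπ) hπ
  have hsn : sqNorm f = ∫⁻ h in circ, ‖f (x + h)‖ₑ ^ 2 := by
    unfold sqNorm
    rw [← lintegral_circ_add (F := fun y => ‖f y‖ₑ ^ 2) _ x]
    · simp only [add_comm]
    · intro y; simp only [hp y]
  have hne : ∀ᵐ h : ℝ ∂(volume.restrict (Set.Ioc (-r) r)), h ≠ 0 :=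
    ae_restrict_of_ae (by simp [ae_iff])
  have hk := measurable_chordKernel
  calc ENNReal.ofReal (2 * r) * ‖f x‖ₑ ^ 2 = ∫⁻ h in Set.Ioc (-r) r, ‖f x‖ₑ ^ 2 := by
        rw [setLIntegral_const, Real.volume_Ioc, mul_comm]
        congr 2; ring
    _ ≤ ∫⁻ h in Set.Ioc (-r) r, (2 * ‖f (x + h)‖ₑ ^ 2 +
          2 * (ENNReal.ofReal (r ^ 2) * (chordKernel h * ‖f (x + h) - f x‖ₑ ^ 2))) := by
        refine lintegral_mono_ae ?_
        filter_upwards [hne, ae_restrict_mem measurableSet_Ioc] with h h0 hm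
        have h1 := one_le_sq_mul_chordKernel h0 (abs_le.2 ⟨hm.1.le, hm.2⟩) hπ
        have h2 : ‖f x‖ₑ ≤ ‖f (x + h)‖ₑ + ‖f (x + h) - f x‖ₑ := by
          have := enorm_sub_le (a := f (x + h)) (b := f (x + h) - f x)
          simpa using this
        have h3 : (‖f (x + h)‖ₑ + ‖f (x + h) - f x‖ₑ) ^ 2 ≤
            2 * ‖f (x + h)‖ₑ ^ 2 + 2 * ‖f (x + h) - f x‖ₑ ^ 2 := by
          have := ENNReal.rpow_add_le_mul_rpow_add_rpow (‖f (x + h)‖ₑ) (‖f (x + h) - f x‖ₑ)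
            (p := 2) (by norm_num)
          norm_num at this
          rwa [mul_add] at this
        calc ‖f x‖ₑ ^ 2 ≤ _ := by gcongr
          _ ≤ _ := h3
          _ ≤ _ := by
            gcongr
            rw [← mul_assoc]
            exact le_mul_of_one_le_left' h1
    _ ≤ ∫⁻ h in circ, (2 * ‖f (x + h)‖ₑ ^ 2 +
          2 * (ENNReal.ofReal (r ^ 2) * (chordKernel h * ‖f (x + h) - f x‖ₑ ^ 2))) :=
        lintegral_mono_set hsub
    _ = _ := by
        rw [lintegral_add_left (by fun_prop), lintegral_const_mul _ (by fun_prop),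
          lintegral_const_mul _ (by fun_prop), lintegral_const_mul _ (by fun_prop), hsn]
        rfl

lemma pow_four_le {f : ℝ → F} (hf : Measurable f) (hp : Function.Periodic f (2 * π)) (x : ℝ)
    (hL : sqNorm f ≠ ⊤) (hd : gradSq f x ≠ ⊤) :
    ‖f x‖ₑ ^ 4 ≤ 4 * sqNorm f * (gradSq f x + sqNorm f) := by
  obtain ⟨a, ha⟩ : ∃ a : NNReal, ENNReal.ofNNReal a = sqNorm f := ⟨_, ENNReal.coe_toNNReal hL⟩
  obtain ⟨d, hd'⟩ : ∃ d : NNReal, ENNReal.ofNNReal d = gradSq f x := ⟨_, ENNReal.coe_toNNReal hd⟩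
  have key : ∀ r : ℝ, 0 < r → r ≤ π → r * ‖f x‖ ^ 2 ≤ a + r ^ 2 * d := by
    intro r hr hπ
    have := sq_le_avg hf hp x hπ
    rw [← ha, ← hd'] at this
    have h2 := ENNReal.toReal_mono (by finiteness) this
    rw [ENNReal.toReal_add (by finiteness) (by finiteness)] at h2
    simp only [ENNReal.toReal_mul, ENNReal.toReal_pow, toReal_enorm, ENNReal.coe_toReal,
      ENNReal.toReal_ofNat, ENNReal.toReal_ofReal (sq_nonneg r),
      ENNReal.toReal_ofReal (by positivity : 0 ≤ 2 * r)] at h2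
    nlinarith
  have main : ‖f x‖ ^ 4 ≤ 4 * a * (d + a) := by
    have ha0 : (0 : ℝ) ≤ a := a.coe_nonneg
    have hd0 : (0 : ℝ) ≤ d := d.coe_nonneg
    generalize (a : ℝ) = A at *
    generalize (d : ℝ) = D at *
    have hpi := Real.pi_gt_three
    rcases ha0.eq_or_lt with h0 | h0
    · rw [← h0]
      have hz : ‖f x‖ ^ 2 ≤ 0 := by
        refine le_of_forall_pos_le_add fun ε hε => ?_
        have hr : 0 < min 1 (ε / (D + 1)) := by positivity
        have h1 := key _ hr ((min_le_left _ _).trans (by linarith))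
        have h2 : min 1 (ε / (D + 1)) * D ≤ ε := by
          calc min 1 (ε / (D + 1)) * D ≤ ε / (D + 1) * (D + 1) := by
                gcongr
                · exact min_le_right _ _
                · linarith
            _ = ε := by field_simp
        rw [← h0] at h1
        have h3 : ‖f x‖ ^ 2 ≤ min 1 (ε / (D + 1)) * D := by
          by_contra hc
          push Not at hc
          nlinarith
        linarith
      have : ‖f x‖ ^ 4 = (‖f x‖ ^ 2) ^ 2 := by ring
      rw [this, le_antisymm hz (sq_nonneg _)]
      simp
    · have hr : 0 < √(A / (D + A)) := by positivity
      have hs : √(A / (D + A)) ^ 2 = A / (D + A) := Real.sq_sqrt (by positivity)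
      have hle : √(A / (D + A)) ≤ 1 := by
        rw [Real.sqrt_le_iff, one_pow, div_le_one (by positivity)]
        exact ⟨zero_le_one, by linarith⟩
      have h1 := key _ hr (by linarith)
      set r := √(A / (D + A))
      have h2 : r ^ 2 * (D + A) = A := by rw [hs]; field_simp
      have h3 : r * ‖f x‖ ^ 2 ≤ 2 * A := by nlinarith [sq_nonneg r]
      have h4 : (r * ‖f x‖ ^ 2) ^ 2 ≤ (2 * A) ^ 2 := by gcongr
      have h5 : r ^ 2 * ‖f x‖ ^ 4 ≤ r ^ 2 * (4 * A * (D + A)) := by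
        calc r ^ 2 * ‖f x‖ ^ 4 = (r * ‖f x‖ ^ 2) ^ 2 := by ring
          _ ≤ (2 * A) ^ 2 := h4
          _ = 4 * A * (r ^ 2 * (D + A)) := by rw [h2]; ring
          _ = _ := by ring
      exact le_of_mul_le_mul_left h5 (by positivity)
  rw [← ha, ← hd']
  have h3 : (‖f x‖₊ : ℝ≥0∞) ^ 4 ≤ 4 * a * (d + a) := by
    exact_mod_cast main
  exact h3

/-- A Ladyzhenskaya type inequality on the circle. -/
lemma lintegral_pow_four_le {f : ℝ → F} (hf : Measurable f) (hp : Function.Periodic f (2 * π)) :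
    ∫⁻ x in circ, ‖f x‖ₑ ^ 4 ≤
      4 * sqNorm f * (gagEnergy f + ENNReal.ofReal (2 * π) * sqNorm f) := by
  by_cases h0 : sqNorm f = 0
  · have : ∫⁻ x in circ, ‖f x‖ₑ ^ 4 = 0 := by
      unfold sqNorm at h0
      rw [lintegral_eq_zero_iff (by fun_prop)] at h0 ⊢
      filter_upwards [h0] with x hx
      simpa using hx
    rw [this]
    exact zero_le
  have hpi : ENNReal.ofReal (2 * π) ≠ 0 := by simp [Real.pi_pos]
  by_cases hL : sqNorm f = ⊤
  · rw [hL, ENNReal.mul_top hpi]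
    simp
  by_cases hP : gagEnergy f = ⊤
  · rw [hP, top_add, ENNReal.mul_top (by simp [h0])]
    exact le_top
  have hgm := measurable_gradSq hf
  have hae : ∀ᵐ x ∂(volume.restrict circ), gradSq f x < ⊤ := ae_lt_top hgm hP
  calc ∫⁻ x in circ, ‖f x‖ₑ ^ 4
      ≤ ∫⁻ x in circ, 4 * sqNorm f * (gradSq f x + sqNorm f) := by
        refine lintegral_mono_ae ?_
        filter_upwards [hae] with x hx
        exact pow_four_le hf hp x hL hx.ne
    _ = _ := by
        rw [lintegral_const_mul _ (by fun_prop), lintegral_add_left hgm, setLIntegral_const,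
          volume_circ, mul_comm (sqNorm f) (ENNReal.ofReal _)]
        rfl

end

lemma sq_lintegral_mul_le {α : Type*} [MeasurableSpace α] {μ : Measure α} {f g : α → ℝ≥0∞}
    (hf : AEMeasurable f μ) (hg : AEMeasurable g μ) :
    (∫⁻ x, f x * g x ∂μ) ^ 2 ≤ (∫⁻ x, f x ^ 2 ∂μ) * ∫⁻ x, g x ^ 2 ∂μ := by
  have h := ENNReal.lintegral_mul_le_Lp_mul_Lq μ Real.HolderConjugate.two_two hf hg
  calc (∫⁻ x, f x * g x ∂μ) ^ 2 ≤
        ((∫⁻ x, f x ^ (2 : ℝ) ∂μ) ^ (1 / 2 : ℝ) * (∫⁻ x, g x ^ (2 : ℝ) ∂μ) ^ (1 / 2 : ℝ)) ^ 2 := by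
        gcongr
        exact h
    _ = _ := by
      rw [mul_pow, ← ENNReal.rpow_natCast, ← ENNReal.rpow_natCast, ← ENNReal.rpow_mul,
        ← ENNReal.rpow_mul]
      norm_num

lemma sq_lintegral_le_of_sq_le {α : Type*} [MeasurableSpace α] {μ : Measure α}
    {q a b : α → ℝ≥0∞} (ha : AEMeasurable a μ) (hb : AEMeasurable b μ)
    (h : ∀ x, q x ^ 2 ≤ a x * b x) :
    (∫⁻ x, q x ∂μ) ^ 2 ≤ (∫⁻ x, a x ∂μ) * ∫⁻ x, b x ∂μ := by
  have hsq : ∀ y : ℝ≥0∞, (y ^ (1 / 2 : ℝ)) ^ 2 = y := by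
    intro y
    rw [← ENNReal.rpow_natCast, ← ENNReal.rpow_mul]
    norm_num
  have h1 : ∀ x, q x ≤ a x ^ (1 / 2 : ℝ) * b x ^ (1 / 2 : ℝ) := by
    intro x
    rw [← ENNReal.mul_rpow_of_nonneg _ _ (by norm_num)]
    calc q x = (q x ^ 2) ^ (1 / 2 : ℝ) := by
          rw [← ENNReal.rpow_natCast, ← ENNReal.rpow_mul]; norm_num
      _ ≤ _ := by gcongr; exact h x
  calc (∫⁻ x, q x ∂μ) ^ 2 ≤ (∫⁻ x, a x ^ (1 / 2 : ℝ) * b x ^ (1 / 2 : ℝ) ∂μ) ^ 2 := by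
        gcongr; exact h1 _
    _ ≤ _ := sq_lintegral_mul_le (by fun_prop) (by fun_prop)
    _ = _ := by simp only [hsq]

lemma weightedEnergy_sq_le {F G : Type*} [NormedAddCommGroup F] [NormedAddCommGroup G]
    [MeasurableSpace F] [BorelSpace F] [SecondCountableTopology F]
    [MeasurableSpace G] [BorelSpace G] [SecondCountableTopology G]
    {f : ℝ → F} {w : ℝ → G}
    (hf : Measurable f) (hw : Measurable w) (hfp : Function.Periodic f (2 * π))
    (hwp : Function.Periodic w (2 * π)) :
    weightedEnergy f w ^ 2 ≤
      (16 * gagEnergy f * (incrEnergy f + ENNReal.ofReal (2 * π) * gagEnergy f)) *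
      (sqNorm w * (gagEnergy w + ENNReal.ofReal (2 * π) * sqNorm w)) := by
  have hk := measurable_chordKernel
  set W := ∫⁻ x in circ, ‖w x‖ₑ ^ 4
  have hW : W ≤ 4 * sqNorm w * (gagEnergy w + ENNReal.ofReal (2 * π) * sqNorm w) :=
    lintegral_pow_four_le hw hwp
  have hms : Measurable fun h => sqNorm (fun x => f (x + h) - f x) := by
    unfold sqNorm
    exact Measurable.lintegral_prod_right' (f := fun p : ℝ × ℝ => ‖f (p.2 + p.1) - f p.2‖ₑ ^ 2)
      (by fun_prop)
  have hmg : Measurable fun h => gagEnergy (fun x => f (x + h) - f x) := by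
    unfold gagEnergy gradSq
    refine Measurable.lintegral_prod_right' (f := fun p : ℝ × ℝ => ∫⁻ k in circ, chordKernel k *
      ‖(f (p.2 + k + p.1) - f (p.2 + k)) - (f (p.2 + p.1) - f p.2)‖ₑ ^ 2) ?_
    refine Measurable.lintegral_prod_right' (f := fun p : (ℝ × ℝ) × ℝ => chordKernel p.2 *
      ‖(f (p.1.2 + p.2 + p.1.1) - f (p.1.2 + p.2)) - (f (p.1.2 + p.1.1) - f p.1.2)‖ₑ ^ 2) ?_
    fun_prop
  rw [weightedEnergy_eq hf hw]
  set S := fun h => sqNorm (fun x => f (x + h) - f x)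
  set T := fun h => gagEnergy (fun x => f (x + h) - f x)
  have h1 : (∫⁻ h in circ, chordKernel h *
      ∫⁻ x in circ, ‖f (x + h) - f x‖ₑ ^ 2 * ‖w x‖ₑ ^ 2) ^ 2 ≤
      (∫⁻ h in circ, 4 * W * (chordKernel h * S h)) *
      ∫⁻ h in circ, (chordKernel h * T h + ENNReal.ofReal (2 * π) * (chordKernel h * S h)) := by
    refine sq_lintegral_le_of_sq_le (by fun_prop) (by fun_prop) fun h => ?_
    have h2 : (∫⁻ x in circ, ‖f (x + h) - f x‖ₑ ^ 2 * ‖w x‖ₑ ^ 2) ^ 2 ≤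
        (∫⁻ x in circ, ‖f (x + h) - f x‖ₑ ^ 4) * W := by
      refine (sq_lintegral_mul_le (by fun_prop) (by fun_prop)).trans_eq ?_
      simp only [← pow_mul]
      rfl
    have h3 : ∫⁻ x in circ, ‖f (x + h) - f x‖ₑ ^ 4 ≤
        4 * S h * (T h + ENNReal.ofReal (2 * π) * S h) := by
      refine lintegral_pow_four_le (f := fun x => f (x + h) - f x) (by fun_prop) ?_
      intro x
      have h4 := hfp (x + h)
      have h5 := hfp x
      beta_reduce
      rw [show x + 2 * π + h = x + h + 2 * π by ring, h4, h5]
    calc _ = chordKernel h ^ 2 *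
          (∫⁻ x in circ, ‖f (x + h) - f x‖ₑ ^ 2 * ‖w x‖ₑ ^ 2) ^ 2 := by rw [mul_pow]
      _ ≤ chordKernel h ^ 2 * ((4 * S h * (T h + ENNReal.ofReal (2 * π) * S h)) * W) := by
          gcongr
          exact h2.trans (by gcongr)
      _ = _ := by ring
  refine h1.trans ?_
  rw [lintegral_const_mul _ (by fun_prop), lintegral_add_left (by fun_prop),
    lintegral_const_mul _ (by fun_prop), ← gagEnergy_eq hf]
  calc _ ≤ 4 * (4 * sqNorm w * (gagEnergy w + ENNReal.ofReal (2 * π) * sqNorm w)) * gagEnergy f *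
      (incrEnergy f + ENNReal.ofReal (2 * π) * gagEnergy f) := by
        gcongr
        exact le_rfl
    _ = _ := by ring

/-- The character `x ↦ e^{ikx}`. -/
def trig (k : ℤ) (x : ℝ) : ℂ := Complex.exp (Complex.I * (k : ℂ) * (x : ℂ))

lemma continuous_trig (k : ℤ) : Continuous (trig k) := by
  unfold trig
  fun_prop

lemma trig_add (k : ℤ) (x h : ℝ) : trig k (x + h) = trig k x * trig k h := by
  unfold trig
  rw [← Complex.exp_add]
  congr 1
  push_cast
  ring

lemma trig_periodic (k : ℤ) : Function.Periodic (trig k) (2 * π) := by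
  intro x
  rw [trig_add]
  have : trig k (2 * π) = 1 := by
    unfold trig
    rw [Complex.exp_eq_one_iff]
    exact ⟨k, by push_cast; ring⟩
  rw [this, mul_one]

lemma norm_trig (k : ℤ) (x : ℝ) : ‖trig k x‖ = 1 := by
  unfold trig
  rw [show Complex.I * (k : ℂ) * (x : ℂ) = ((k * x : ℝ) : ℂ) * Complex.I by push_cast; ring]
  exact Complex.norm_exp_ofReal_mul_I _

lemma fc_eq_trig (f : ℝ → ℂ) (k : ℤ) :
    fc f k = ((1 / (2 * π) : ℝ) : ℂ) * ∫ x in circ, f x * trig (-k) x := by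
  unfold fc trig
  congr 3
  ext x
  congr 2
  push_cast
  ring

lemma fc_eq_fourierCoeffOn (f : ℝ → ℂ) (k : ℤ) :
    fc f k = fourierCoeffOn (neg_lt_self Real.pi_pos) f k := by
  rw [fourierCoeffOn_eq_integral, intervalIntegral.integral_of_le (neg_le_self Real.pi_pos.le),
    fc_eq_trig, Complex.real_smul]
  congr 1
  · congr 2; ring
  · refine integral_congr_ae (ae_of_all _ fun x => ?_)
    simp only [smul_eq_mul]
    rw [mul_comm, fourier_coe_apply]
    congr 1
    unfold trig
    congr 1
    have : (π : ℂ) ≠ 0 := by exact_mod_cast Real.pi_ne_zero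
    push_cast
    rw [sub_neg_eq_add, ← two_mul]
    field_simp

lemma enorm_sq_eq_ofReal {F : Type*} [NormedAddCommGroup F] (a : F) :
    ‖a‖ₑ ^ 2 = ENNReal.ofReal (‖a‖ ^ 2) := by
  rw [ENNReal.ofReal_pow (norm_nonneg _), ofReal_norm]

lemma memLp_two_of_sqNorm {F : Type*} [NormedAddCommGroup F] {f : ℝ → F}
    (hf : AEStronglyMeasurable f (volume.restrict circ)) (h : sqNorm f < ⊤) :
    MemLp f 2 (volume.restrict circ) := by
  refine ⟨hf, ?_⟩
  rw [eLpNorm_lt_top_iff_lintegral_rpow_enorm_lt_top (by norm_num) (by norm_num)]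
  simpa [sqNorm] using h

lemma parseval {f : ℝ → ℂ} (hf : MemLp f 2 (volume.restrict circ)) :
    sqNorm f = ENNReal.ofReal (2 * π) * ∑' k : ℤ, ‖fc f k‖ₑ ^ 2 := by
  have h := hasSum_sq_fourierCoeffOn (neg_lt_self Real.pi_pos) hf
  rw [intervalIntegral.integral_of_le (neg_le_self Real.pi_pos.le)] at h
  have hi : Integrable (fun x => ‖f x‖ ^ 2) (volume.restrict circ) :=
    (memLp_two_iff_integrable_sq_norm hf.1).1 hf
  have h1 : sqNorm f = ENNReal.ofReal (∫ x in circ, ‖f x‖ ^ 2) := by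
    rw [ofReal_integral_eq_lintegral_ofReal hi (ae_of_all _ fun x => sq_nonneg _)]
    simp only [sqNorm, enorm_sq_eq_ofReal]
  have h2 : ∑' k : ℤ, ‖fc f k‖ₑ ^ 2 =
      ENNReal.ofReal ((π - -π)⁻¹ • ∫ x in circ, ‖f x‖ ^ 2) := by
    unfold circ
    rw [← h.tsum_eq, ENNReal.ofReal_tsum_of_nonneg (fun _ => sq_nonneg _) h.summable]
    simp only [enorm_sq_eq_ofReal, fc_eq_fourierCoeffOn]
  rw [h1, h2, ← ENNReal.ofReal_mul (by positivity), smul_eq_mul, ← mul_assoc]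
  congr 1
  have := Real.pi_ne_zero
  field_simp
  ring

lemma integral_circ_add {f : ℝ → ℂ} (hf : Function.Periodic f (2 * π)) (h : ℝ) :
    ∫ x in circ, f (x + h) = ∫ x in circ, f x := by
  unfold circ
  rw [← intervalIntegral.integral_of_le (by linarith [Real.pi_pos]),
    ← intervalIntegral.integral_of_le (by linarith [Real.pi_pos]),
    intervalIntegral.integral_comp_add_right]
  have := hf.intervalIntegral_add_eq (-π + h) (-π)
  rw [show -π + h + 2 * π = π + h by ring, show -π + 2 * π = π by ring] at this
  exact this

lemma fc_shift {f : ℝ → ℂ} (hf : Function.Periodic f (2 * π)) (h : ℝ) (k : ℤ) :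
    fc (fun x => f (x + h)) k = trig k h * fc f k := by
  have h1 : ∀ x, f (x + h) * trig (-k) x = trig k h * (f (x + h) * trig (-k) (x + h)) := by
    intro x
    have : trig k h * trig (-k) h = 1 := by
      unfold trig
      rw [← Complex.exp_add, Complex.exp_eq_one_iff]
      exact ⟨0, by push_cast; ring⟩
    rw [trig_add]
    linear_combination - (f (x + h) * trig (-k) x) * this
  rw [fc_eq_trig, fc_eq_trig]
  simp only [h1]
  rw [integral_const_mul, integral_circ_add (f := fun x => f x * trig (-k) x)
    (hf.mul (trig_periodic _))]
  ring

lemma integrable_mul_trig {f : ℝ → ℂ} (hf : Integrable f (volume.restrict circ)) (k : ℤ) :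
    Integrable (fun x => f x * trig k x) (volume.restrict circ) :=
  hf.mul_bdd (c := 1) (continuous_trig k).aestronglyMeasurable
    (ae_of_all _ fun x => (norm_trig k x).le)

lemma fc_sub {f g : ℝ → ℂ} (hf : Integrable f (volume.restrict circ))
    (hg : Integrable g (volume.restrict circ)) (k : ℤ) :
    fc (fun x => f x - g x) k = fc f k - fc g k := by
  simp only [fc_eq_trig, sub_mul]
  rw [integral_sub (integrable_mul_trig hf _) (integrable_mul_trig hg _), mul_sub]

lemma fc_trig (j k : ℤ) : fc (trig j) k = if j = k then 1 else 0 := by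
  have h0 : (2 * π : ℂ) ≠ 0 := by exact_mod_cast Real.two_pi_pos.ne'
  have hmul : ∀ x, trig j x * trig (-k) x = trig (j - k) x := by
    intro x
    unfold trig
    rw [← Complex.exp_add]
    congr 1
    push_cast
    ring
  rw [fc_eq_trig]
  simp only [hmul]
  split_ifs with h
  · subst h
    have : ∀ x, trig (j - j) x = 1 := by intro x; simp [trig]
    simp only [this]
    rw [setIntegral_const, Measure.real, volume_circ, ENNReal.toReal_ofReal (by positivity)]
    push_cast
    simp only [Complex.real_smul]
    push_cast
    field_simp
  · unfold circ
    rw [← intervalIntegral.integral_of_le (by linarith [Real.pi_pos])]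
    unfold trig
    have hc : Complex.I * ((j - k : ℤ) : ℂ) ≠ 0 := by
      refine mul_ne_zero Complex.I_ne_zero ?_
      exact_mod_cast sub_ne_zero.2 h
    rw [integral_exp_mul_complex hc]
    have h2 := trig_periodic (j - k) (-π)
    rw [show -π + 2 * π = π by ring] at h2
    unfold trig at h2
    rw [h2, sub_self]
    simp

lemma fc_sum_trig (s : Finset ℤ) (c : ℤ → ℂ) (k : ℤ) :
    fc (fun x => ∑ j ∈ s, c j * trig j x) k = if k ∈ s then c k else 0 := by
  have h1 : ∀ j, fc (fun x => c j * trig j x) k = if j = k then c j else 0 := by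
    intro j
    have := fc_trig j k
    rw [fc_eq_trig] at this ⊢
    simp only [mul_assoc, integral_const_mul]
    rw [← mul_assoc, mul_comm _ (c j), mul_assoc, this]
    simp
  have h2 : fc (fun x => ∑ j ∈ s, c j * trig j x) k = ∑ j ∈ s, fc (fun x => c j * trig j x) k := by
    simp only [fc_eq_trig, Finset.sum_mul]
    rw [integral_finsetSum, Finset.mul_sum]
    intro j _
    exact integrable_mul_trig (Continuous.integrableOn_Ioc
      (by have := continuous_trig j; fun_prop)) _
  rw [h2, Finset.sum_congr rfl fun j _ => h1 j, Finset.sum_ite_eq' s k c]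

lemma memLp_sum_trig (s : Finset ℤ) (c : ℤ → ℂ) :
    MemLp (fun x => ∑ j ∈ s, c j * trig j x) 2 (volume.restrict circ) := by
  refine MemLp.of_bound (C := ∑ j ∈ s, ‖c j‖) ?_ (ae_of_all _ fun x => ?_)
  · have := continuous_trig
    exact Continuous.aestronglyMeasurable (by fun_prop)
  · refine (norm_sum_le _ _).trans (Finset.sum_le_sum fun j _ => ?_)
    rw [norm_mul, norm_trig, mul_one]

lemma norm_trig_one_sub_one (h : ℝ) : ‖trig 1 h - 1‖ = 2 * |Real.sin (h / 2)| := by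
  have h1 : trig 1 h - 1 = trig 1 (h / 2) * (2 * Complex.I * Complex.sin ((h / 2 : ℝ) : ℂ)) := by
    rw [Complex.sin]
    have e1 : trig 1 h = trig 1 (h / 2) * trig 1 (h / 2) := by
      rw [← trig_add]; congr 1; ring
    have e2 : Complex.exp (-((h / 2 : ℝ) : ℂ) * Complex.I) * trig 1 (h / 2) = 1 := by
      unfold trig
      rw [← Complex.exp_add, Complex.exp_eq_one_iff]
      exact ⟨0, by push_cast; ring⟩
    have e3 : Complex.exp (((h / 2 : ℝ) : ℂ) * Complex.I) = trig 1 (h / 2) := by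
      unfold trig
      congr 1
      push_cast
      ring
    rw [e1, e3]
    linear_combination e2 - (trig 1 (h / 2) * (Complex.exp (-((h / 2 : ℝ) : ℂ) * Complex.I) -
      trig 1 (h / 2))) * Complex.I_sq
  rw [h1, norm_mul, norm_trig, one_mul, norm_mul, norm_mul, Complex.norm_I, ← Complex.ofReal_sin,
    Complex.norm_real]
  simp

lemma norm_trig_neg_sub_one (k : ℤ) (h : ℝ) : ‖trig (-k) h - 1‖ = ‖trig k h - 1‖ := by
  have h1 : trig k h * trig (-k) h = 1 := by
    unfold trig
    rw [← Complex.exp_add, Complex.exp_eq_one_iff]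
    exact ⟨0, by push_cast; ring⟩
  have h2 : trig (-k) h - 1 = - trig (-k) h * (trig k h - 1) := by linear_combination h1
  rw [h2, norm_mul, norm_neg, norm_trig, one_mul]

lemma lintegral_chordKernel_nat (m : ℕ) :
    ∫⁻ h in circ, chordKernel h * ‖trig m h - 1‖ₑ ^ 2 ≤ ENNReal.ofReal (2 * π) * m := by
  have hgeom : ∀ h, trig m h - 1 = (trig 1 h - 1) *
      ∑ j ∈ (Finset.range m).map Nat.castEmbedding, (1 : ℂ) * trig j h := by
    intro h
    have hp : ∀ j : ℕ, trig (j : ℤ) h = trig 1 h ^ j := by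
      intro j
      unfold trig
      rw [← Complex.exp_nat_mul]
      congr 1
      push_cast
      ring
    rw [Finset.sum_map, hp, ← mul_geom_sum]
    congr 1
    refine Finset.sum_congr rfl fun j _ => ?_
    rw [one_mul, ← hp]
    rfl
  set D : ℝ → ℂ := fun h => ∑ j ∈ (Finset.range m).map Nat.castEmbedding, (1 : ℂ) * trig j h
  have hD : sqNorm D = ENNReal.ofReal (2 * π) * m := by
    rw [parseval (f := D) (memLp_sum_trig _ fun _ => 1)]
    congr 1
    have : ∀ k : ℤ, ‖fc D k‖ₑ ^ 2 =
        if k ∈ (Finset.range m).map Nat.castEmbedding then 1 else 0 := by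
      intro k
      rw [fc_sum_trig _ fun _ => 1]
      split_ifs <;> simp
    simp only [this]
    rw [tsum_eq_sum (s := (Finset.range m).map Nat.castEmbedding)
      (fun k hk => if_neg hk), Finset.sum_ite_mem]
    simp
  rw [← hD]
  refine lintegral_mono fun h => ?_
  simp only [hgeom h, enorm_mul, mul_pow, ← mul_assoc]
  refine mul_le_of_le_one_left' ?_
  rw [enorm_sq_eq_ofReal, norm_trig_one_sub_one, chordKernel,
    ← ENNReal.ofReal_mul (by positivity), ENNReal.ofReal_le_one]
  exact inv_mul_le_one

lemma lintegral_chordKernel_trig (k : ℤ) :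
    ∫⁻ h in circ, chordKernel h * ‖trig k h - 1‖ₑ ^ 2 ≤ ENNReal.ofReal (2 * π) * k.natAbs := by
  rcases Int.natAbs_eq k with h | h
  · conv_lhs => rw [h]
    exact lintegral_chordKernel_nat _
  · refine le_trans (le_of_eq ?_) (lintegral_chordKernel_nat _)
    conv_lhs => rw [h]
    refine lintegral_congr fun x => ?_
    rw [enorm_sq_eq_ofReal, enorm_sq_eq_ofReal, norm_trig_neg_sub_one]

section
variable {g : ℝ → ℂ}

lemma memLp_shift (hm : Measurable g) (hp : Function.Periodic g (2 * π))
    (hL : sqNorm g < ⊤) (h : ℝ) : MemLp (fun x => g (x + h)) 2 (volume.restrict circ) := by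
  refine memLp_two_of_sqNorm (by fun_prop : Measurable _).aestronglyMeasurable ?_
  unfold sqNorm
  rw [lintegral_circ_add (F := fun x => ‖g x‖ₑ ^ 2)]
  · exact hL
  · intro y
    simp only [hp y]

lemma memLp_incr (hm : Measurable g) (hp : Function.Periodic g (2 * π))
    (hL : sqNorm g < ⊤) (h : ℝ) : MemLp (fun x => g (x + h) - g x) 2 (volume.restrict circ) :=
  (memLp_shift hm hp hL h).sub (memLp_two_of_sqNorm hm.aestronglyMeasurable hL)

lemma fc_incr (hm : Measurable g) (hp : Function.Periodic g (2 * π))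
    (hL : sqNorm g < ⊤) (h : ℝ) (k : ℤ) :
    fc (fun x => g (x + h) - g x) k = (trig k h - 1) * fc g k := by
  rw [fc_sub ((memLp_shift hm hp hL h).integrable (by norm_num))
    ((memLp_two_of_sqNorm hm.aestronglyMeasurable hL).integrable (by norm_num)), fc_shift hp]
  ring

lemma gagEnergy_le (hm : Measurable g) (hp : Function.Periodic g (2 * π)) (hL : sqNorm g < ⊤) :
    gagEnergy g ≤ ENNReal.ofReal (2 * π) ^ 2 * ∑' k : ℤ, (k.natAbs : ℝ≥0∞) * ‖fc g k‖ₑ ^ 2 := by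
  have hk := measurable_chordKernel
  have ht := continuous_trig
  rw [gagEnergy_eq hm]
  calc _ = ∫⁻ h in circ, ∑' k : ℤ, ENNReal.ofReal (2 * π) * ‖fc g k‖ₑ ^ 2 *
        (chordKernel h * ‖trig k h - 1‖ₑ ^ 2) := by
        refine lintegral_congr fun h => ?_
        rw [parseval (memLp_incr hm hp hL h), ← ENNReal.tsum_mul_left, ← ENNReal.tsum_mul_left]
        refine tsum_congr fun k => ?_
        rw [fc_incr hm hp hL, enorm_mul]
        ring
    _ = ∑' k : ℤ, ENNReal.ofReal (2 * π) * ‖fc g k‖ₑ ^ 2 *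
        ∫⁻ h in circ, (chordKernel h * ‖trig k h - 1‖ₑ ^ 2) := by
        rw [lintegral_tsum]
        · refine tsum_congr fun k => ?_
          rw [lintegral_const_mul]
          have := ht k
          fun_prop
        · intro k
          have := ht k
          fun_prop
    _ ≤ ∑' k : ℤ, ENNReal.ofReal (2 * π) * ‖fc g k‖ₑ ^ 2 *
        (ENNReal.ofReal (2 * π) * k.natAbs) := by
        gcongr with k
        exact lintegral_chordKernel_trig k
    _ = _ := by
        rw [← ENNReal.tsum_mul_left]
        refine tsum_congr fun k => ?_
        ring

lemma incrEnergy_le (hm : Measurable g) (hp : Function.Periodic g (2 * π)) (hL : sqNorm g < ⊤) :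
    incrEnergy g ≤ ENNReal.ofReal (2 * π) ^ 3 *
      ∑' k : ℤ, (k.natAbs : ℝ≥0∞) ^ 2 * ‖fc g k‖ₑ ^ 2 := by
  have hk := measurable_chordKernel
  have ht := continuous_trig
  calc incrEnergy g ≤ ∫⁻ h in circ, ∑' k : ℤ, ENNReal.ofReal (2 * π) ^ 2 *
        (k.natAbs * ‖fc g k‖ₑ ^ 2) * (chordKernel h * ‖trig k h - 1‖ₑ ^ 2) := by
        refine lintegral_mono fun h => ?_
        have hLh : sqNorm (fun x => g (x + h) - g x) < ⊤ := by
          have := (memLp_incr hm hp hL h).2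
          rw [eLpNorm_lt_top_iff_lintegral_rpow_enorm_lt_top (by norm_num) (by norm_num)] at this
          simpa [sqNorm] using this
        have := gagEnergy_le (g := fun x => g (x + h) - g x) (by fun_prop)
          (by
            intro x
            have h1 := hp (x + h)
            have h2 := hp x
            beta_reduce
            rw [show x + 2 * π + h = x + h + 2 * π by ring, h1, h2]) hLh
        calc _ ≤ _ := mul_le_mul_right this (chordKernel h)
          _ = _ := by
            rw [← ENNReal.tsum_mul_left, ← ENNReal.tsum_mul_left]
            refine tsum_congr fun k => ?_
            rw [fc_incr hm hp hL, enorm_mul]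
            ring
    _ = ∑' k : ℤ, ENNReal.ofReal (2 * π) ^ 2 *
        (k.natAbs * ‖fc g k‖ₑ ^ 2) * ∫⁻ h in circ, (chordKernel h * ‖trig k h - 1‖ₑ ^ 2) := by
        rw [lintegral_tsum]
        · refine tsum_congr fun k => ?_
          rw [lintegral_const_mul]
          have := ht k
          fun_prop
        · intro k
          have := ht k
          fun_prop
    _ ≤ ∑' k : ℤ, ENNReal.ofReal (2 * π) ^ 2 *
        (k.natAbs * ‖fc g k‖ₑ ^ 2) * (ENNReal.ofReal (2 * π) * k.natAbs) := by
        gcongr with k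
        exact lintegral_chordKernel_trig k
    _ = _ := by
        rw [← ENNReal.tsum_mul_left]
        refine tsum_congr fun k => ?_
        ring

end

section
variable {n : ℕ}

lemma enorm_sq_eq_sum (a : E n) : ‖a‖ₑ ^ 2 = ∑ i, ‖(a i : ℂ)‖ₑ ^ 2 := by
  simp only [enorm_sq_eq_ofReal]
  rw [EuclideanSpace.norm_sq_eq, ENNReal.ofReal_sum_of_nonneg fun i _ => sq_nonneg _]
  simp

lemma measurable_coord {f : ℝ → E n} (hf : Measurable f) (i : Fin n) :
    Measurable fun x => (f x i : ℂ) := by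
  fun_prop

lemma sqNorm_eq_sum {f : ℝ → E n} (hf : Measurable f) :
    sqNorm f = ∑ i, sqNorm fun x => (f x i : ℂ) := by
  unfold sqNorm
  rw [← lintegral_finsetSum]
  · simp only [enorm_sq_eq_sum]
  · intro i _
    fun_prop

lemma sqNorm_coord_lt_top {f : ℝ → E n} (hf : Measurable f) (hL : sqNorm f < ⊤) (i : Fin n) :
    sqNorm (fun x => (f x i : ℂ)) < ⊤ := by
  rw [sqNorm_eq_sum hf] at hL
  exact (ENNReal.sum_lt_top.1 hL) i (Finset.mem_univ i)

lemma gagEnergy_eq_sum {f : ℝ → E n} (hf : Measurable f) :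
    gagEnergy f = ∑ i, gagEnergy fun x => (f x i : ℂ) := by
  have hk := measurable_chordKernel
  have hms : ∀ i, Measurable fun h => sqNorm (fun x => (f (x + h) i : ℂ) - (f x i : ℂ)) := by
    intro i
    unfold sqNorm
    exact Measurable.lintegral_prod_right'
      (f := fun p : ℝ × ℝ => ‖(f (p.2 + p.1) i : ℂ) - (f p.2 i : ℂ)‖ₑ ^ 2) (by fun_prop)
  rw [gagEnergy_eq hf]
  simp only [gagEnergy_eq (measurable_coord hf _)]
  rw [← lintegral_finsetSum]
  · refine lintegral_congr fun h => ?_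
    rw [sqNorm_eq_sum (by fun_prop), Finset.mul_sum]
    simp
  · intro i _
    have := hms i
    fun_prop

lemma incrEnergy_eq_sum {f : ℝ → E n} (hf : Measurable f) :
    incrEnergy f = ∑ i, incrEnergy fun x => (f x i : ℂ) := by
  have hk := measurable_chordKernel
  have hmg : ∀ i, Measurable fun h =>
      gagEnergy (fun x => (f (x + h) i : ℂ) - (f x i : ℂ)) := by
    intro i
    unfold gagEnergy gradSq
    refine Measurable.lintegral_prod_right' (f := fun p : ℝ × ℝ => ∫⁻ k in circ, chordKernel k *
      ‖((f (p.2 + k + p.1) i : ℂ) - (f (p.2 + k) i : ℂ)) -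
        ((f (p.2 + p.1) i : ℂ) - (f p.2 i : ℂ))‖ₑ ^ 2) ?_
    refine Measurable.lintegral_prod_right' (f := fun p : (ℝ × ℝ) × ℝ => chordKernel p.2 *
      ‖((f (p.1.2 + p.2 + p.1.1) i : ℂ) - (f (p.1.2 + p.2) i : ℂ)) -
        ((f (p.1.2 + p.1.1) i : ℂ) - (f p.1.2 i : ℂ))‖ₑ ^ 2) ?_
    fun_prop
  unfold incrEnergy
  rw [← lintegral_finsetSum]
  · refine lintegral_congr fun h => ?_
    rw [gagEnergy_eq_sum (by fun_prop), Finset.mul_sum]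
    simp
  · intro i _
    have := hmg i
    fun_prop

lemma periodic_coord {f : ℝ → E n} (hp : Function.Periodic f (2 * π)) (i : Fin n) :
    Function.Periodic (fun x => (f x i : ℂ)) (2 * π) := by
  intro x
  simp only [hp x]

lemma gagEnergy_le_hHalf {f : ℝ → E n} (hf : Measurable f) (hp : Function.Periodic f (2 * π))
    (hL : sqNorm f < ⊤) : gagEnergy f ≤ ENNReal.ofReal (2 * π) ^ 2 * hHalf f := by
  rw [gagEnergy_eq_sum hf]
  calc _ ≤ ∑ i, ENNReal.ofReal (2 * π) ^ 2 *
        ∑' k : ℤ, (k.natAbs : ℝ≥0∞) * ‖fc (fun x => (f x i : ℂ)) k‖ₑ ^ 2 :=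
        Finset.sum_le_sum fun i _ => gagEnergy_le (measurable_coord hf i) (periodic_coord hp i)
          (sqNorm_coord_lt_top hf hL i)
    _ = _ := by
      rw [← Finset.mul_sum, ← Summable.tsum_finsetSum fun _ _ => ENNReal.summable]
      simp only [← Finset.mul_sum]
      rfl

lemma incrEnergy_le_hSob {f : ℝ → E n} (hf : Measurable f) (hp : Function.Periodic f (2 * π))
    (hL : sqNorm f < ⊤) : incrEnergy f ≤ ENNReal.ofReal (2 * π) ^ 3 * hSob 1 f := by
  rw [incrEnergy_eq_sum hf]
  calc _ ≤ ∑ i, ENNReal.ofReal (2 * π) ^ 3 *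
        ∑' k : ℤ, (k.natAbs : ℝ≥0∞) ^ 2 * ‖fc (fun x => (f x i : ℂ)) k‖ₑ ^ 2 :=
        Finset.sum_le_sum fun i _ => incrEnergy_le (measurable_coord hf i) (periodic_coord hp i)
          (sqNorm_coord_lt_top hf hL i)
    _ = ENNReal.ofReal (2 * π) ^ 3 * ∑' k : ℤ, (k.natAbs : ℝ≥0∞) ^ 2 *
        ∑ i, ‖fc (fun x => (f x i : ℂ)) k‖ₑ ^ 2 := by
      rw [← Finset.mul_sum, ← Summable.tsum_finsetSum fun _ _ => ENNReal.summable]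
      simp only [← Finset.mul_sum]
    _ ≤ _ := by
      unfold hSob
      gcongr with k i
      · rw [Real.rpow_one, ← ENNReal.ofReal_natCast, ← ENNReal.ofReal_pow (by positivity)]
        refine ENNReal.ofReal_le_ofReal ?_
        have : ((k.natAbs : ℝ)) ^ 2 = (k : ℝ) ^ 2 := by
          rw [Nat.cast_natAbs, Int.cast_abs, sq_abs]
        linarith
      · exact le_rfl

/-- The real part of a partial Fourier sum, componentwise. -/
def partialSum (f : ℝ → E n) (s : Finset ℤ) (x : ℝ) : E n :=
  WithLp.toLp 2 fun i => (∑ k ∈ s, fcV f k i * trig k x).re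

lemma continuous_partialSum (f : ℝ → E n) (s : Finset ℤ) : Continuous (partialSum f s) := by
  have := continuous_trig
  unfold partialSum
  fun_prop

/-- The complex remainder of a partial Fourier sum of a component. -/
def fourierTail (f : ℝ → E n) (s : Finset ℤ) (i : Fin n) (x : ℝ) : ℂ :=
  (f x i : ℂ) - ∑ k ∈ s, fcV f k i * trig k x

lemma sub_partialSum_apply (f : ℝ → E n) (s : Finset ℤ) (i : Fin n) (x : ℝ) :
    (f x - partialSum f s x) i = (fourierTail f s i x).re := by
  simp [partialSum, fourierTail]

lemma fc_fourierTail {f : ℝ → E n} (hf : Measurable f) (hL : sqNorm f < ⊤) (s : Finset ℤ)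
    (i : Fin n) (k : ℤ) : fc (fourierTail f s i) k = if k ∈ s then 0 else fcV f k i := by
  have h := fc_sub (f := fun x => (f x i : ℂ)) (g := fun x => ∑ k ∈ s, fcV f k i * trig k x)
    ((memLp_two_of_sqNorm (measurable_coord hf i).aestronglyMeasurable
      (sqNorm_coord_lt_top hf hL i)).integrable (by norm_num))
    ((memLp_sum_trig s fun k => fcV f k i).integrable (by norm_num)) k
  rw [fc_sum_trig s fun k => fcV f k i] at h
  refine h.trans ?_
  split_ifs
  · exact sub_self _
  · exact sub_zero _

lemma measurable_fourierTail {f : ℝ → E n} (hf : Measurable f) (s : Finset ℤ) (i : Fin n) :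
    Measurable (fourierTail f s i) := by
  have : Continuous fun x => ∑ k ∈ s, fcV f k i * trig k x := by
    have := continuous_trig
    fun_prop
  exact (measurable_coord hf i).sub this.measurable

lemma periodic_fourierTail {f : ℝ → E n} (hp : Function.Periodic f (2 * π)) (s : Finset ℤ)
    (i : Fin n) : Function.Periodic (fourierTail f s i) (2 * π) := by
  intro x
  simp only [fourierTail, trig_periodic _ x, hp x]

lemma memLp_fourierTail {f : ℝ → E n} (hf : Measurable f) (hL : sqNorm f < ⊤) (s : Finset ℤ)
    (i : Fin n) : MemLp (fourierTail f s i) 2 (volume.restrict circ) :=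
  (memLp_two_of_sqNorm (measurable_coord hf i).aestronglyMeasurable
    (sqNorm_coord_lt_top hf hL i)).sub (memLp_sum_trig s fun k => fcV f k i)

lemma sqNorm_lt_top_of_memLp {F : Type*} [NormedAddCommGroup F] {f : ℝ → F}
    (hf : MemLp f 2 (volume.restrict circ)) : sqNorm f < ⊤ := by
  have := hf.2
  rw [eLpNorm_lt_top_iff_lintegral_rpow_enorm_lt_top (by norm_num) (by norm_num)] at this
  simpa [sqNorm] using this

lemma enorm_ofReal_re_le (z : ℂ) : ‖((z.re : ℝ) : ℂ)‖ₑ ≤ ‖z‖ₑ := by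
  rw [enorm_le_iff_norm_le, Complex.norm_real]
  exact Complex.abs_re_le_norm z

lemma tendsto_sum_tail {c : ℤ → Fin n → ℝ≥0∞} (h : ∑' k, ∑ i, c k i ≠ ⊤) :
    Tendsto (fun s : Finset ℤ => ∑ i, ∑' k, if k ∈ s then 0 else c k i) atTop (𝓝 0) := by
  have h1 := ENNReal.tendsto_tsum_compl_atTop_zero h
  refine h1.congr fun s => ?_
  have h2 := tsum_subtype {k | k ∉ s} (fun k => ∑ i, c k i)
  refine h2.trans ?_
  rw [← Summable.tsum_finsetSum fun _ _ => ENNReal.summable]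
  refine tsum_congr fun k => ?_
  by_cases hk : k ∈ s <;> simp [hk]

lemma tendsto_sqNorm_sub_partialSum {f : ℝ → E n} (hf : Measurable f) (hL : sqNorm f < ⊤) :
    Tendsto (fun s => sqNorm fun x => f x - partialSum f s x) atTop (𝓝 0) := by
  have hsum : ∑' k, ∑ i, ‖fcV f k i‖ₑ ^ 2 ≠ ⊤ := by
    have h1 : sqNorm f = ENNReal.ofReal (2 * π) * ∑' k, ∑ i, ‖fcV f k i‖ₑ ^ 2 := by
      rw [sqNorm_eq_sum hf, Summable.tsum_finsetSum fun _ _ => ENNReal.summable, Finset.mul_sum]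
      exact Finset.sum_congr rfl fun i _ =>
        parseval (memLp_two_of_sqNorm (measurable_coord hf i).aestronglyMeasurable
          (sqNorm_coord_lt_top hf hL i))
    intro h
    rw [h, ENNReal.mul_top (by simp [Real.pi_pos])] at h1
    exact hL.ne h1
  have h2 := ENNReal.Tendsto.const_mul (a := ENNReal.ofReal (2 * π)) (tendsto_sum_tail hsum)
    (Or.inr ENNReal.ofReal_ne_top)
  rw [mul_zero] at h2
  refine tendsto_of_tendsto_of_tendsto_of_le_of_le tendsto_const_nhds h2 (fun _ => zero_le)
    fun s => ?_
  have hm := (continuous_partialSum f s).measurable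
  beta_reduce
  rw [sqNorm_eq_sum (by fun_prop), Finset.mul_sum]
  refine Finset.sum_le_sum fun i _ => ?_
  calc _ ≤ sqNorm (fourierTail f s i) := by
        unfold sqNorm
        simp only [sub_partialSum_apply]
        gcongr
        exact enorm_ofReal_re_le _
    _ = _ := by
        rw [parseval (memLp_fourierTail hf hL s i)]
        congr 1
        refine tsum_congr fun k => ?_
        rw [fc_fourierTail hf hL]
        split_ifs <;> simp

lemma tendsto_gagEnergy_sub_partialSum {f : ℝ → E n} (hf : Measurable f)
    (hp : Function.Periodic f (2 * π)) (hL : sqNorm f < ⊤) (hH : hHalf f < ⊤) :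
    Tendsto (fun s => gagEnergy fun x => f x - partialSum f s x) atTop (𝓝 0) := by
  have hsum : ∑' k : ℤ, ∑ i, (k.natAbs : ℝ≥0∞) * ‖fcV f k i‖ₑ ^ 2 ≠ ⊤ := by
    simp only [← Finset.mul_sum]
    exact hH.ne
  have h2 := ENNReal.Tendsto.const_mul (a := ENNReal.ofReal (2 * π) ^ 2) (tendsto_sum_tail hsum)
    (Or.inr (by finiteness))
  rw [mul_zero] at h2
  refine tendsto_of_tendsto_of_tendsto_of_le_of_le tendsto_const_nhds h2 (fun _ => zero_le)
    fun s => ?_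
  have hm := (continuous_partialSum f s).measurable
  beta_reduce
  rw [gagEnergy_eq_sum (by fun_prop), Finset.mul_sum]
  refine Finset.sum_le_sum fun i _ => ?_
  calc _ ≤ gagEnergy (fourierTail f s i) := by
        unfold gagEnergy gradSq
        simp only [sub_partialSum_apply, ← Complex.ofReal_sub, ← Complex.sub_re]
        gcongr
        exact enorm_ofReal_re_le _
    _ ≤ _ := gagEnergy_le (measurable_fourierTail hf s i) (periodic_fourierTail hp s i)
        (sqNorm_lt_top_of_memLp (memLp_fourierTail hf hL s i))
    _ = _ := by
        congr 1
        refine tsum_congr fun k => ?_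
        rw [fc_fourierTail hf hL]
        split_ifs <;> simp

end

section
variable {n : ℕ}

/-- The measure on pairs of points of the circle. -/
abbrev circPair : Measure (ℝ × ℝ) := (volume.restrict circ).prod (volume.restrict circ)

/-- The integrand of `pairing`. -/
def gagForm (u η : ℝ → E n) (p : ℝ × ℝ) : ℝ :=
  inner ℝ (u p.1 - u p.2) (η p.1 - η p.2) / cd p.1 p.2 ^ 2

/-- The integrand of the Lagrange multiplier term. -/
def forceForm (u η : ℝ → E n) (p : ℝ × ℝ) : ℝ :=
  ‖u p.1 - u p.2‖ ^ 2 / cd p.1 p.2 ^ 2 * inner ℝ (u p.1) (η p.1)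

/-- The squared Gagliardo quotient. -/
def gagQuot (u : ℝ → E n) (p : ℝ × ℝ) : ℝ≥0∞ :=
  ENNReal.ofReal ((cd p.1 p.2 ^ 2)⁻¹) * ‖u p.1 - u p.2‖ₑ ^ 2

@[fun_prop]
lemma measurable_cd : Measurable fun p : ℝ × ℝ => cd p.1 p.2 := by
  unfold cd
  fun_prop

lemma measurable_gagForm {u η : ℝ → E n} (hu : Measurable u) (hη : Measurable η) :
    Measurable (gagForm u η) := by
  unfold gagForm
  fun_prop

lemma measurable_forceForm {u η : ℝ → E n} (hu : Measurable u) (hη : Measurable η) :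
    Measurable (forceForm u η) := by
  unfold forceForm
  fun_prop

lemma measurable_gagQuot {u : ℝ → E n} (hu : Measurable u) : Measurable (gagQuot u) := by
  unfold gagQuot
  fun_prop

lemma lintegral_gagQuot {u : ℝ → E n} (hu : Measurable u) (hp : Function.Periodic u (2 * π)) :
    ∫⁻ p, gagQuot u p ∂circPair = gagEnergy u := by
  rw [lintegral_prod _ (measurable_gagQuot hu).aemeasurable]
  unfold gagEnergy
  simp only [gradSq_shift hp]
  rfl

lemma lintegral_gagQuot_mul {u η : ℝ → E n} (hu : Measurable u)
    (hp : Function.Periodic u (2 * π)) (hη : Measurable η) :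
    ∫⁻ p, gagQuot u p * ‖η p.1‖ₑ ^ 2 ∂circPair = weightedEnergy u η := by
  have hm := measurable_gagQuot hu
  rw [lintegral_prod _ (by fun_prop)]
  unfold weightedEnergy
  refine lintegral_congr fun x => ?_
  refine (lintegral_mul_const (‖η x‖ₑ ^ 2)
    (by fun_prop : Measurable fun y => gagQuot u (x, y))).trans ?_
  rw [gradSq_shift hp]
  rfl

lemma sq_lintegral_gagForm_le {u η : ℝ → E n} (hu : Measurable u)
    (hup : Function.Periodic u (2 * π)) (hη : Measurable η)
    (hηp : Function.Periodic η (2 * π)) :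
    (∫⁻ p, ‖gagForm u η p‖ₑ ∂circPair) ^ 2 ≤ gagEnergy u * gagEnergy η := by
  rw [← lintegral_gagQuot hu hup, ← lintegral_gagQuot hη hηp]
  refine sq_lintegral_le_of_sq_le (measurable_gagQuot hu).aemeasurable
    (measurable_gagQuot hη).aemeasurable fun p => ?_
  have h0 : (0 : ℝ) ≤ (cd p.1 p.2 ^ 2)⁻¹ := by positivity
  unfold gagForm gagQuot
  simp only [enorm_sq_eq_ofReal]
  rw [← ENNReal.ofReal_mul h0, ← ENNReal.ofReal_mul h0, ← ENNReal.ofReal_mul (by positivity)]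
  refine ENNReal.ofReal_le_ofReal ?_
  rw [Real.norm_eq_abs, sq_abs, div_eq_mul_inv, mul_pow]
  have h1 := abs_real_inner_le_norm (u p.1 - u p.2) (η p.1 - η p.2)
  have h2 : inner ℝ (u p.1 - u p.2) (η p.1 - η p.2) ^ 2 ≤
      (‖u p.1 - u p.2‖ * ‖η p.1 - η p.2‖) ^ 2 := sq_le_sq' (by linarith [abs_le.1 h1]) (abs_le.1 h1).2
  calc _ ≤ (‖u p.1 - u p.2‖ * ‖η p.1 - η p.2‖) ^ 2 * ((cd p.1 p.2 ^ 2)⁻¹) ^ 2 := by gcongr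
    _ = _ := by ring

lemma sq_lintegral_forceForm_le {u η : ℝ → E n} (hu : Measurable u)
    (hup : Function.Periodic u (2 * π)) (hη : Measurable η)
    (h1 : ∀ᵐ x ∂volume.restrict circ, ‖u x‖ = 1) :
    (∫⁻ p, ‖forceForm u η p‖ₑ ∂circPair) ^ 2 ≤ gagEnergy u * weightedEnergy u η := by
  have hm := measurable_gagQuot hu
  have h2 : ∫⁻ p, ‖forceForm u η p‖ₑ ∂circPair ≤
      ∫⁻ p, gagQuot u p * ‖η p.1‖ₑ ∂circPair := by
    refine lintegral_mono_ae ?_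
    filter_upwards [Measure.quasiMeasurePreserving_fst.ae h1] with p hp
    unfold forceForm gagQuot
    rw [enorm_mul]
    have h3 : ‖inner ℝ (u p.1) (η p.1)‖ₑ ≤ ‖η p.1‖ₑ := by
      rw [enorm_le_iff_norm_le]
      have := norm_inner_le_norm (𝕜 := ℝ) (u p.1) (η p.1)
      rwa [hp, one_mul] at this
    refine mul_le_mul' (le_of_eq ?_) h3
    rw [Real.enorm_eq_ofReal (by positivity), enorm_sq_eq_ofReal, mul_comm,
      ← ENNReal.ofReal_mul (by positivity), div_eq_mul_inv]
  refine (pow_le_pow_left' h2 2).trans ?_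
  rw [← lintegral_gagQuot hu hup, ← lintegral_gagQuot_mul hu hup hη]
  refine sq_lintegral_le_of_sq_le hm.aemeasurable (by fun_prop) fun p => le_of_eq (by ring)

lemma integral_gagl_mul {u η : ℝ → E n} (h : Integrable (forceForm u η) circPair) :
    ∫ x in circ, gagl u x * ∑ i, u x i * η x i = ∫ p, forceForm u η p ∂circPair := by
  rw [integral_prod _ h]
  refine integral_congr_ae (ae_of_all _ fun x => ?_)
  unfold gagl forceForm
  beta_reduce
  rw [← integral_mul_const]
  refine integral_congr_ae (ae_of_all _ fun y => ?_)
  simp only [EuclideanSpace.real_norm_sq_eq, PiLp.inner_apply]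
  simp [mul_comm]

lemma pairing_eq {u η : ℝ → E n} (h : Integrable (gagForm u η) circPair) :
    pairing u η = ∫ p, gagForm u η p ∂circPair := by
  rw [integral_prod _ h]
  unfold pairing gagForm
  simp [PiLp.inner_apply, mul_comm]

end

section
variable {n : ℕ}

/-- Regularity of a time slice of a solution, `p` being the time derivative. -/
structure SliceData (u p : ℝ → E n) : Prop where
  meas : Measurable u
  periodic : Function.Periodic u (2 * π)
  unit : ∀ᵐ x ∂volume.restrict circ, ‖u x‖ = 1
  gag : gagEnergy u < ⊤
  incr : incrEnergy u < ⊤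
  measDeriv : Measurable p
  sqNormDeriv : sqNorm p < ⊤

/-- Admissible directions on the circle. -/
structure Admissible (η : ℝ → E n) : Prop where
  meas : Measurable η
  periodic : Function.Periodic η (2 * π)
  sq : sqNorm η < ⊤
  gag : gagEnergy η < ⊤

/-- The residual of the half-harmonic flow equation tested against `η`. -/
def flowResidual (u p η : ℝ → E n) : ℝ :=
  (∫ x in circ, inner ℝ (p x) (η x)) + (∫ q, gagForm u η q ∂circPair)
    - ∫ q, forceForm u η q ∂circPair

lemma ENNReal.lt_top_of_sq_le {a b : ℝ≥0∞} (h : a ^ 2 ≤ b) (hb : b < ⊤) : a < ⊤ := by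
  by_contra h'
  rw [not_lt_top_iff.1 h'] at h
  exact absurd (h.trans_lt hb) (by simp)

lemma ENNReal.tendsto_zero_of_sq_le {α : Type*} {l : Filter α} {a b : α → ℝ≥0∞}
    (h : ∀ x, a x ^ 2 ≤ b x) (hb : Tendsto b l (𝓝 0)) : Tendsto a l (𝓝 0) := by
  have h2 := (ENNReal.continuous_rpow_const (y := (1 / 2 : ℝ))).tendsto 0 |>.comp hb
  rw [ENNReal.zero_rpow_of_pos (by norm_num)] at h2
  refine tendsto_of_tendsto_of_tendsto_of_le_of_le tendsto_const_nhds h2 (fun _ => zero_le)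
    fun x => ?_
  calc a x = (a x ^ 2) ^ (1 / 2 : ℝ) := by
        rw [← ENNReal.rpow_natCast, ← ENNReal.rpow_mul]; norm_num
    _ ≤ _ := ENNReal.rpow_le_rpow (h x) (by norm_num)

lemma sq_lintegral_inner_le {p η : ℝ → E n} (hp : Measurable p) (hη : Measurable η) :
    (∫⁻ x in circ, ‖inner ℝ (p x) (η x)‖ₑ) ^ 2 ≤ sqNorm p * sqNorm η := by
  refine sq_lintegral_le_of_sq_le (by fun_prop) (by fun_prop) fun x => ?_
  rw [← mul_pow]
  gcongr
  rw [← ofReal_norm, ← ofReal_norm, ← ofReal_norm, ← ENNReal.ofReal_mul (norm_nonneg _)]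
  exact ENNReal.ofReal_le_ofReal (norm_inner_le_norm _ _)

variable {u p η : ℝ → E n}

lemma SliceData.weighted_lt_top (h : SliceData u p) (hη : Admissible η) :
    weightedEnergy u η < ⊤ := by
  have := h.gag
  have := h.incr
  have := hη.sq
  have := hη.gag
  exact ENNReal.lt_top_of_sq_le (weightedEnergy_sq_le h.meas hη.meas h.periodic hη.periodic)
    (by finiteness)

lemma SliceData.integrable_inner (h : SliceData u p) (hη : Admissible η) :
    Integrable (fun x => inner ℝ (p x) (η x)) (volume.restrict circ) := by
  have := h.sqNormDeriv
  have := hη.sq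
  have h1 := h.measDeriv
  have h2 := hη.meas
  exact ⟨(by fun_prop : Measurable _).aestronglyMeasurable,
    ENNReal.lt_top_of_sq_le (sq_lintegral_inner_le h1 h2) (by finiteness)⟩

lemma SliceData.integrable_gagForm (h : SliceData u p) (hη : Admissible η) :
    Integrable (gagForm u η) circPair := by
  have := h.gag
  have := hη.gag
  exact ⟨(measurable_gagForm h.meas hη.meas).aestronglyMeasurable,
    ENNReal.lt_top_of_sq_le (sq_lintegral_gagForm_le h.meas h.periodic hη.meas hη.periodic)
      (by finiteness)⟩

lemma SliceData.integrable_forceForm (h : SliceData u p) (hη : Admissible η) :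
    Integrable (forceForm u η) circPair := by
  have := h.gag
  have := h.weighted_lt_top hη
  exact ⟨(measurable_forceForm h.meas hη.meas).aestronglyMeasurable,
    ENNReal.lt_top_of_sq_le (sq_lintegral_forceForm_le h.meas h.periodic hη.meas h.unit)
      (by finiteness)⟩

lemma enorm_add_sq_le {F : Type*} [NormedAddCommGroup F] (a b : F) :
    ‖a + b‖ₑ ^ 2 ≤ 2 * ‖a‖ₑ ^ 2 + 2 * ‖b‖ₑ ^ 2 := by
  simp only [enorm_sq_eq_ofReal]
  rw [show (2 : ℝ≥0∞) = ENNReal.ofReal 2 by simp, ← ENNReal.ofReal_mul (by norm_num),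
    ← ENNReal.ofReal_mul (by norm_num), ← ENNReal.ofReal_add (by positivity) (by positivity)]
  refine ENNReal.ofReal_le_ofReal ?_
  have := norm_add_le a b
  nlinarith [norm_nonneg (a + b), sq_nonneg (‖a‖ - ‖b‖)]

lemma measurable_incr_left {f : ℝ → E n} (hf : Measurable f) (x : ℝ) :
    Measurable fun h => chordKernel h * ‖f (x + h) - f x‖ₑ ^ 2 :=
  measurable_chordKernel.mul (by fun_prop)

lemma gagEnergy_add_le {f g : ℝ → E n} (hf : Measurable f) (hg : Measurable g) :
    gagEnergy (f + g) ≤ 2 * gagEnergy f + 2 * gagEnergy g := by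
  have h1 := measurable_gradSq hf
  unfold gagEnergy
  rw [← lintegral_const_mul _ h1, ← lintegral_const_mul _ (measurable_gradSq hg),
    ← lintegral_add_left (by fun_prop)]
  refine lintegral_mono fun x => ?_
  unfold gradSq
  rw [← lintegral_const_mul _ (measurable_incr_left hf x),
    ← lintegral_const_mul _ (measurable_incr_left hg x),
    ← lintegral_add_left ((measurable_incr_left hf x).const_mul _)]
  refine lintegral_mono fun y => ?_
  calc _ ≤ chordKernel y * (2 * ‖f (x + y) - f x‖ₑ ^ 2 + 2 * ‖g (x + y) - g x‖ₑ ^ 2) := by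
        gcongr
        refine le_trans (le_of_eq ?_) (enorm_add_sq_le _ _)
        simp only [Pi.add_apply]
        congr 2
        abel
    _ = _ := by ring

lemma gagEnergy_smul (c : ℝ) (f : ℝ → E n) (hf : Measurable f) :
    gagEnergy (c • f) = ‖c‖ₑ ^ 2 * gagEnergy f := by
  have h1 := measurable_gradSq hf
  unfold gagEnergy
  rw [← lintegral_const_mul _ h1]
  refine lintegral_congr fun x => ?_
  unfold gradSq
  rw [← lintegral_const_mul _ (measurable_incr_left hf x)]
  refine lintegral_congr fun y => ?_
  simp only [Pi.smul_apply, ← smul_sub, enorm_smul]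
  ring

lemma Admissible.memLp (hη : Admissible η) : MemLp η 2 (volume.restrict circ) :=
  memLp_two_of_sqNorm hη.meas.aestronglyMeasurable hη.sq

lemma Admissible.add {η' : ℝ → E n} (hη : Admissible η) (hη' : Admissible η') :
    Admissible (η + η') where
  meas := hη.meas.add hη'.meas
  periodic := hη.periodic.add hη'.periodic
  sq := sqNorm_lt_top_of_memLp (hη.memLp.add hη'.memLp)
  gag := by
    have := hη.gag
    have := hη'.gag
    exact (gagEnergy_add_le hη.meas hη'.meas).trans_lt (by finiteness)

lemma Admissible.smul (hη : Admissible η) (c : ℝ) : Admissible (c • η) where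
  meas := hη.meas.const_smul c
  periodic := hη.periodic.smul c
  sq := sqNorm_lt_top_of_memLp (hη.memLp.const_smul c)
  gag := by
    have := hη.gag
    rw [gagEnergy_smul _ _ hη.meas]
    finiteness

lemma SliceData.flowResidual_add (h : SliceData u p) {η' : ℝ → E n} (hη : Admissible η)
    (hη' : Admissible η') : flowResidual u p (η + η') = flowResidual u p η + flowResidual u p η' := by
  unfold flowResidual
  have h1 : gagForm u (η + η') = fun q => gagForm u η q + gagForm u η' q := by
    ext q
    simp only [gagForm, Pi.add_apply, add_sub_add_comm, inner_add_right, add_div]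
  have h2 : forceForm u (η + η') = fun q => forceForm u η q + forceForm u η' q := by
    ext q
    simp only [forceForm, Pi.add_apply, inner_add_right, mul_add]
  simp only [Pi.add_apply, inner_add_right]
  rw [h1, h2, integral_add (h.integrable_gagForm hη) (h.integrable_gagForm hη'),
    integral_add (h.integrable_forceForm hη) (h.integrable_forceForm hη'),
    integral_add (h.integrable_inner hη) (h.integrable_inner hη')]
  ring

lemma gagForm_smul (c : ℝ) : gagForm u (c • η) = fun q => c * gagForm u η q := by
  ext q
  simp only [gagForm, Pi.smul_apply, ← smul_sub, inner_smul_right]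
  ring

lemma forceForm_smul (c : ℝ) : forceForm u (c • η) = fun q => c * forceForm u η q := by
  ext q
  simp only [forceForm, Pi.smul_apply, inner_smul_right]
  ring

lemma flowResidual_smul (c : ℝ) : flowResidual u p (c • η) = c * flowResidual u p η := by
  unfold flowResidual
  simp only [Pi.smul_apply, inner_smul_right]
  rw [gagForm_smul, forceForm_smul, integral_const_mul, integral_const_mul, integral_const_mul]
  ring

/-- Admissible directions along which the residual vanishes. -/
def SliceData.nullSpace (h : SliceData u p) : Submodule ℝ (ℝ → E n) where
  carrier := {η | Admissible η ∧ flowResidual u p η = 0}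
  add_mem' := fun ⟨ha, ha'⟩ ⟨hb, hb'⟩ =>
    ⟨ha.add hb, by rw [h.flowResidual_add ha hb, ha', hb', add_zero]⟩
  zero_mem' := by
    refine ⟨⟨measurable_const, fun _ => rfl, ?_, ?_⟩, ?_⟩
    · simp [sqNorm]
    · simp [gagEnergy, gradSq]
    · simpa using flowResidual_smul (u := u) (p := p) (η := 0) 0
  smul_mem' := fun c _ ⟨ha, ha'⟩ => ⟨ha.smul c, by rw [flowResidual_smul, ha', mul_zero]⟩

/-- The real part of `z e^{ikx}` in the `i`-th component. -/
def trigVec (z : ℂ) (k : ℤ) (i : Fin n) (x : ℝ) : E n :=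
  EuclideanSpace.single i (z * trig k x).re

lemma trigVec_periodic (z : ℂ) (k : ℤ) (i : Fin n) :
    Function.Periodic (trigVec z k i) (2 * π) := by
  intro x
  simp only [trigVec, trig_periodic k x]

lemma continuous_trigVec (z : ℂ) (k : ℤ) (i : Fin n) : Continuous (trigVec z k i) := by
  have := continuous_trig k
  unfold trigVec
  have h : ∀ a : ℝ, EuclideanSpace.single i a = a • EuclideanSpace.single i (1 : ℝ) := by
    intro a
    ext j
    simp
  rw [funext fun x => h _]
  fun_prop

lemma norm_trigVec_le (z : ℂ) (k : ℤ) (i : Fin n) (x : ℝ) : ‖trigVec z k i x‖ ≤ ‖z‖ := by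
  unfold trigVec
  rw [PiLp.norm_single]
  refine (Complex.abs_re_le_norm _).trans ?_
  rw [norm_mul, norm_trig, mul_one]

lemma admissible_trigVec (z : ℂ) (k : ℤ) (i : Fin n) : Admissible (trigVec z k i) where
  meas := (continuous_trigVec z k i).measurable
  periodic := trigVec_periodic z k i
  sq := sqNorm_lt_top_of_memLp (MemLp.of_bound
    (continuous_trigVec z k i).aestronglyMeasurable ‖z‖ (ae_of_all _ (norm_trigVec_le z k i)))
  gag := by
    have h1 : ∀ x, gradSq (trigVec z k i) x ≤ ‖z‖ₑ ^ 2 * (ENNReal.ofReal (2 * π) * k.natAbs) := by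
      intro x
      have ht := continuous_trig k
      refine le_trans ?_ (mul_le_mul_right (lintegral_chordKernel_trig k) _)
      have hm : Measurable fun h => chordKernel h * ‖trig k h - 1‖ₑ ^ 2 :=
        measurable_chordKernel.mul (by fun_prop)
      rw [← lintegral_const_mul _ hm]
      refine lintegral_mono fun h => ?_
      rw [mul_left_comm, ← mul_pow]
      gcongr
      rw [← enorm_mul, enorm_le_iff_norm_le]
      have : trigVec z k i (x + h) - trigVec z k i x =
          EuclideanSpace.single i (z * trig k x * (trig k h - 1)).re := by
        unfold trigVec
        rw [← PiLp.single_sub, ← Complex.sub_re, trig_add]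
        congr 2
        ring
      rw [this, PiLp.norm_single]
      refine (Complex.abs_re_le_norm _).trans (le_of_eq ?_)
      simp [norm_trig]
    refine (lintegral_mono h1).trans_lt ?_
    rw [lintegral_const, Measure.restrict_apply_univ, volume_circ]
    finiteness

lemma partialSum_eq (f : ℝ → E n) (s : Finset ℤ) :
    partialSum f s = ∑ k ∈ s, ∑ i, ((fcV f k i).re • trigVec 1 k i +
      (fcV f k i).im • trigVec Complex.I k i) := by
  ext x j
  simp only [partialSum, Finset.sum_apply, Pi.add_apply, Pi.smul_apply, trigVec,
    WithLp.ofLp_sum, WithLp.ofLp_add, WithLp.ofLp_smul, Complex.re_sum]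
  refine Finset.sum_congr rfl fun k _ => ?_
  simp [Finset.sum_add_distrib]
  ring

lemma enorm_flowResidual_le (u p η : ℝ → E n) :
    ‖flowResidual u p η‖ₑ ≤ (∫⁻ x in circ, ‖inner ℝ (p x) (η x)‖ₑ) +
      (∫⁻ q, ‖gagForm u η q‖ₑ ∂circPair) + ∫⁻ q, ‖forceForm u η q‖ₑ ∂circPair := by
  unfold flowResidual
  refine (enorm_sub_le).trans ?_
  gcongr
  · refine (enorm_add_le _ _).trans ?_
    gcongr <;> exact enorm_integral_le_lintegral_enorm _
  · exact enorm_integral_le_lintegral_enorm _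

lemma SliceData.flowResidual_eq_zero (h : SliceData u p)
    (h1 : ∀ k i, flowResidual u p (trigVec 1 k i) = 0)
    (h2 : ∀ k i, flowResidual u p (trigVec Complex.I k i) = 0)
    {f : ℝ → E n} (hf : Admissible f) (hH : hHalf f < ⊤) : flowResidual u p f = 0 := by
  have hps : ∀ s, partialSum f s ∈ h.nullSpace := by
    intro s
    rw [partialSum_eq]
    refine Submodule.sum_mem _ fun k _ => Submodule.sum_mem _ fun i _ => Submodule.add_mem _ ?_ ?_
    · exact Submodule.smul_mem _ _ ⟨admissible_trigVec _ _ _, h1 k i⟩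
    · exact Submodule.smul_mem _ _ ⟨admissible_trigVec _ _ _, h2 k i⟩
  have hsub : ∀ s, (fun x => f x - partialSum f s x) = f + (-1 : ℝ) • partialSum f s := by
    intro s
    ext1 x
    simp [sub_eq_add_neg]
  have hadm : ∀ s, Admissible fun x => f x - partialSum f s x := by
    intro s
    rw [hsub]
    exact hf.add ((hps s).1.smul _)
  have hres : ∀ s, flowResidual u p (fun x => f x - partialSum f s x) = flowResidual u p f := by
    intro s
    rw [hsub, h.flowResidual_add hf ((hps s).1.smul _), flowResidual_smul, (hps s).2]
    simp
  have t1 := tendsto_sqNorm_sub_partialSum hf.meas hf.sq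
  have t2 := tendsto_gagEnergy_sub_partialSum hf.meas hf.periodic hf.sq hH
  have hg := h.gag
  have hi := h.incr
  have hs := h.sqNormDeriv
  have s1 := ENNReal.tendsto_zero_of_sq_le
    (fun s => sq_lintegral_inner_le h.measDeriv (hadm s).meas)
    (by simpa using ENNReal.Tendsto.const_mul (a := sqNorm p) t1 (Or.inr hs.ne))
  have s2 := ENNReal.tendsto_zero_of_sq_le
    (fun s => sq_lintegral_gagForm_le h.meas h.periodic (hadm s).meas (hadm s).periodic)
    (by simpa using ENNReal.Tendsto.const_mul (a := gagEnergy u) t2 (Or.inr hg.ne))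
  have t3 := ENNReal.tendsto_zero_of_sq_le
    (fun s => weightedEnergy_sq_le h.meas (hadm s).meas h.periodic (hadm s).periodic) (by
      have t4 := t2.add (ENNReal.Tendsto.const_mul (a := ENNReal.ofReal (2 * π)) t1
        (Or.inr ENNReal.ofReal_ne_top))
      have t5 := ENNReal.Tendsto.mul t1 (Or.inr (by simp)) t4 (Or.inr (by simp))
      have t6 := ENNReal.Tendsto.const_mul (a := 16 * gagEnergy u * (incrEnergy u +
        ENNReal.ofReal (2 * π) * gagEnergy u)) t5 (Or.inr (by finiteness))
      simpa using t6)
  have s3 := ENNReal.tendsto_zero_of_sq_le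
    (fun s => sq_lintegral_forceForm_le h.meas h.periodic (hadm s).meas h.unit)
    (by simpa using ENNReal.Tendsto.const_mul (a := gagEnergy u) t3 (Or.inr hg.ne))
  have key := le_of_tendsto_of_tendsto' (b := atTop) (f := fun _ : Finset ℤ => ‖flowResidual u p f‖ₑ)
    tendsto_const_nhds ((s1.add s2).add s3) (fun s => by
      rw [← hres s]
      exact enorm_flowResidual_le _ _ _)
  simpa using key

end

section
variable {n : ℕ}

lemma SliceData.admissible {u p : ℝ → E n} (h : SliceData u p) : Admissible u where
  meas := h.meas
  periodic := h.periodic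
  sq := sqNorm_lt_top_of_memLp (MemLp.of_bound h.meas.aestronglyMeasurable 1
    (h.unit.mono fun _ hx => hx.le))
  gag := h.gag

lemma Admissible.sub {f g : ℝ → E n} (hf : Admissible f) (hg : Admissible g) :
    Admissible fun x => f x - g x := by
  have : (fun x => f x - g x) = f + (-1 : ℝ) • g := by
    ext1 x
    simp [sub_eq_add_neg]
  rw [this]
  exact hf.add (hg.smul _)

lemma fcV_sub {f g : ℝ → E n} (hf : Admissible f) (hg : Admissible g) (k : ℤ) (i : Fin n) :
    fcV (fun x => f x - g x) k i = fcV f k i - fcV g k i := by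
  have h : ∀ {a : ℝ → E n}, Admissible a →
      Integrable (fun x => (a x i : ℂ)) (volume.restrict circ) := fun ha =>
    (memLp_two_of_sqNorm (measurable_coord ha.meas i).aestronglyMeasurable
      (sqNorm_coord_lt_top ha.meas ha.sq i)).integrable (by norm_num)
  unfold fcV fcR
  rw [← fc_sub (h hf) (h hg)]
  simp

lemma hHalf_sub_lt_top {f g : ℝ → E n} (hf : Admissible f) (hg : Admissible g)
    (hf' : hHalf f < ⊤) (hg' : hHalf g < ⊤) : hHalf (fun x => f x - g x) < ⊤ := by
  have : hHalf (fun x => f x - g x) ≤ 2 * hHalf f + 2 * hHalf g := by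
    unfold hHalf
    rw [← ENNReal.tsum_mul_left, ← ENNReal.tsum_mul_left, ← ENNReal.tsum_add]
    refine ENNReal.tsum_le_tsum fun k => ?_
    rw [mul_left_comm, mul_left_comm 2, ← mul_add, Finset.mul_sum (a := 2),
      Finset.mul_sum (a := 2), ← Finset.sum_add_distrib]
    gcongr with i
    rw [fcV_sub hf hg, sub_eq_add_neg]
    exact (enorm_add_sq_le _ _).trans (by rw [enorm_neg]; rfl)
  exact this.trans_lt (by finiteness)

/-- The Grönwall coefficient of a time slice. -/
def sliceCoeff (u : ℝ → E n) : ℝ≥0∞ :=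
  16 * gagEnergy u * (incrEnergy u + ENNReal.ofReal (2 * π) * gagEnergy u)

lemma gagQuot_lt_top (u : ℝ → E n) (q : ℝ × ℝ) : gagQuot u q < ⊤ := by
  unfold gagQuot
  finiteness

lemma gagForm_self (w : ℝ → E n) (q : ℝ × ℝ) : gagForm w w q = (gagQuot w q).toReal := by
  unfold gagForm gagQuot
  rw [ENNReal.toReal_mul, ENNReal.toReal_ofReal (by positivity), ENNReal.toReal_pow,
    toReal_enorm, real_inner_self_eq_norm_sq, div_eq_inv_mul]

lemma gagQuot_toReal (u : ℝ → E n) (q : ℝ × ℝ) :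
    (gagQuot u q).toReal = ‖u q.1 - u q.2‖ ^ 2 / cd q.1 q.2 ^ 2 := by
  rw [← gagForm_self, gagForm, real_inner_self_eq_norm_sq]

lemma inner_unit_sub {a b : E n} (ha : ‖a‖ = 1) (hb : ‖b‖ = 1) :
    inner ℝ a (a - b) = ‖a - b‖ ^ 2 / 2 := by
  rw [@norm_sub_sq_real, inner_sub_right, real_inner_self_eq_norm_sq, ha, hb]
  ring

lemma le_of_sq_le_mul {Q a b : ℝ} (ha : 0 ≤ a) (hb : 0 ≤ b) (h : Q ^ 2 ≤ a * b) :
    Q ≤ (a + b) / 2 := by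
  refine abs_le_of_sq_le_sq' ?_ (by positivity) |>.2
  nlinarith [sq_nonneg (a - b)]

variable {u v p q : ℝ → E n}

lemma SliceData.weighted_toReal_le (h : SliceData u p) {w : ℝ → E n} (hw : Admissible w) :
    (weightedEnergy u w).toReal ≤ ((sliceCoeff u).toReal * (sqNorm w).toReal +
      ((gagEnergy w).toReal + 2 * π * (sqNorm w).toReal)) / 2 := by
  have hg := h.gag
  have hi := h.incr
  have hP := hw.gag
  have hY := hw.sq
  refine le_of_sq_le_mul (by positivity) (by positivity) ?_
  have := weightedEnergy_sq_le h.meas hw.meas h.periodic hw.periodic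
  have h2 := ENNReal.toReal_mono (by finiteness) this
  change _ ≤ ENNReal.toReal (sliceCoeff u * _) at h2
  rw [ENNReal.toReal_pow, ENNReal.toReal_mul, ENNReal.toReal_mul,
    ENNReal.toReal_add (by finiteness) (by finiteness), ENNReal.toReal_mul,
    ENNReal.toReal_ofReal (by positivity)] at h2
  rw [mul_assoc]
  exact h2

lemma slice_inequality (hu : SliceData u p) (hv : SliceData v q)
    (hru : ∀ f : ℝ → E n, Admissible f → hHalf f < ⊤ → flowResidual u p f = 0)
    (hrv : ∀ f : ℝ → E n, Admissible f → hHalf f < ⊤ → flowResidual v q f = 0)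
    (hHu : hHalf u < ⊤) (hHv : hHalf v < ⊤) :
    ENNReal.ofReal (∫ x in circ, inner ℝ (p x - q x) (u x - v x)) ≤
      (sliceCoeff u + sliceCoeff v + ENNReal.ofReal (2 * π)) * sqNorm fun x => u x - v x := by
  set w : ℝ → E n := fun x => u x - v x with hwdef
  have hw : Admissible w := hu.admissible.sub hv.admissible
  have hHw : hHalf w < ⊤ := hHalf_sub_lt_top hu.admissible hv.admissible hHu hHv
  have e1 := hru w hw hHw
  have e2 := hrv w hw hHw
  unfold flowResidual at e1 e2
  have i1 : ∫ x in circ, inner ℝ (p x - q x) (w x) =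
      (∫ x in circ, inner ℝ (p x) (w x)) - ∫ x in circ, inner ℝ (q x) (w x) := by
    rw [← integral_sub (hu.integrable_inner hw) (hv.integrable_inner hw)]
    simp only [inner_sub_left]
  have hP := hw.gag
  have hY := hw.sq
  have hg1 := hu.gag
  have hg2 := hv.gag
  have hi1 := hu.incr
  have hi2 := hv.incr
  have i2 : (gagEnergy w).toReal =
      (∫ x, gagForm u w x ∂circPair) - ∫ x, gagForm v w x ∂circPair := by
    rw [← integral_sub (hu.integrable_gagForm hw) (hv.integrable_gagForm hw),
      ← lintegral_gagQuot hw.meas hw.periodic, ← integral_toReal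
        (measurable_gagQuot hw.meas).aemeasurable (ae_of_all _ (gagQuot_lt_top w))]
    refine integral_congr_ae (ae_of_all _ fun x => ?_)
    beta_reduce
    rw [← gagForm_self, gagForm, gagForm, gagForm, ← sub_div, ← inner_sub_left]
    congr 2
    simp only [hwdef]
    abel
  have hm1 := measurable_gagQuot hu.meas
  have hm2 := measurable_gagQuot hv.meas
  have hmw := hw.meas
  have hwt : ∀ {a r : ℝ → E n}, SliceData a r →
      Integrable (fun x => (gagQuot a x * ‖w x.1‖ₑ ^ 2).toReal) circPair ∧
      (weightedEnergy a w).toReal = ∫ x, (gagQuot a x * ‖w x.1‖ₑ ^ 2).toReal ∂circPair := by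
    intro a r ha
    have hm := measurable_gagQuot ha.meas
    have hlt := ha.weighted_lt_top hw
    rw [← lintegral_gagQuot_mul ha.meas ha.periodic hw.meas] at hlt ⊢
    refine ⟨integrable_toReal_of_lintegral_ne_top (by fun_prop) hlt.ne, ?_⟩
    rw [integral_toReal (by fun_prop) (ae_of_all _ fun x => ?_)]
    have := gagQuot_lt_top a x
    finiteness
  obtain ⟨j1, k1⟩ := hwt hu
  obtain ⟨j2, k2⟩ := hwt hv
  have i3 : (∫ x, forceForm u w x ∂circPair) - ∫ x, forceForm v w x ∂circPair =
      ((weightedEnergy u w).toReal + (weightedEnergy v w).toReal) / 2 := by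
    rw [← integral_sub (hu.integrable_forceForm hw) (hv.integrable_forceForm hw), k1, k2,
      ← integral_add j1 j2, ← integral_div]
    refine integral_congr_ae ?_
    filter_upwards [Measure.quasiMeasurePreserving_fst.ae hu.unit,
      Measure.quasiMeasurePreserving_fst.ae hv.unit] with x h1 h2
    have h3 : inner ℝ (v x.1) (w x.1) = - (‖w x.1‖ ^ 2 / 2) := by
      have h5 : w x.1 = -(v x.1 - u x.1) := by simp [hwdef]
      rw [h5, inner_neg_right, inner_unit_sub h2 h1, norm_neg]
    have h4 : inner ℝ (u x.1) (w x.1) = ‖w x.1‖ ^ 2 / 2 := inner_unit_sub h1 h2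
    simp only [ENNReal.toReal_mul, gagQuot_toReal, forceForm, h3, h4, ENNReal.toReal_pow,
      toReal_enorm]
    ring
  have b1 := hu.weighted_toReal_le hw
  have b2 := hv.weighted_toReal_le hw
  have c1 : sliceCoeff u < ⊤ := by unfold sliceCoeff; finiteness
  have c2 : sliceCoeff v < ⊤ := by unfold sliceCoeff; finiteness
  have hP0 : 0 ≤ (gagEnergy w).toReal := ENNReal.toReal_nonneg
  have hs1 : 0 ≤ (sliceCoeff u).toReal * (sqNorm w).toReal := by positivity
  have hs2 : 0 ≤ (sliceCoeff v).toReal * (sqNorm w).toReal := by positivity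
  have hs3 : 0 ≤ π * (sqNorm w).toReal := by positivity
  refine ENNReal.ofReal_le_of_le_toReal ?_
  rw [ENNReal.toReal_mul, ENNReal.toReal_add (by finiteness) (by finiteness),
    ENNReal.toReal_add (by finiteness) (by finiteness), ENNReal.toReal_ofReal (by positivity)]
  nlinarith

end

/-- Smooth functions with compact support in `(0,∞)`. -/
structure IsTimeTest (ψ : ℝ → ℝ) : Prop where
  smooth : ContDiff ℝ (⊤ : ℕ∞) ψ
  supp : ∃ a b : ℝ, 0 < a ∧ ∀ t, t ∉ Set.Icc a b → ψ t = 0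

/-- Integrability on bounded intervals of the form `(0,T]`. -/
def LocIntegrable (f : ℝ → ℝ) : Prop := ∀ T : ℝ, IntegrableOn f (Set.Ioc 0 T)

namespace LocIntegrable

variable {f g : ℝ → ℝ}

lemma add (hf : LocIntegrable f) (hg : LocIntegrable g) : LocIntegrable fun t => f t + g t :=
  fun T => (hf T).add (hg T)

lemma sub (hf : LocIntegrable f) (hg : LocIntegrable g) : LocIntegrable fun t => f t - g t :=
  fun T => (hf T).sub (hg T)

lemma intervalIntegrable (hf : LocIntegrable f) {T : ℝ} (hT : 0 ≤ T) :
    IntervalIntegrable f volume 0 T := by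
  rw [intervalIntegrable_iff_integrableOn_Ioc_of_le hT]; exact hf T

lemma of_continuous (hf : Continuous f) : LocIntegrable f := fun T =>
  (hf.integrableOn_Icc (a := 0) (b := T)).mono_set Set.Ioc_subset_Icc_self

lemma locallyIntegrableOn (hf : LocIntegrable f) : LocallyIntegrableOn f (Set.Ioi 0) := by
  intro t ht
  refine ⟨Set.Ioc 0 (t + 1), ?_, hf _⟩
  refine mem_nhdsWithin.2 ⟨Set.Iio (t + 1), isOpen_Iio, by simp, fun s hs => ⟨hs.2, le_of_lt hs.1⟩⟩

lemma absolutelyContinuous (hf : LocIntegrable f) {T : ℝ} (hT : 0 ≤ T) :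
    AbsolutelyContinuousOnInterval (fun t => ∫ s in (0 : ℝ)..t, f s) 0 T :=
  (hf.intervalIntegrable hT).absolutelyContinuousOnInterval_intervalIntegral (by simp)

lemma ae_deriv_primitive (hf : LocIntegrable f) {T : ℝ} (hT : 0 ≤ T) :
    ∀ᵐ t, t ∈ Set.Ioc 0 T → deriv (fun t => ∫ s in (0 : ℝ)..t, f s) t = f t := by
  filter_upwards [(hf.intervalIntegrable hT).ae_hasDerivAt_integral] with t ht h
  exact (ht (by rw [Set.uIcc_of_le hT]; exact Set.Ioc_subset_Icc_self h) 0 (by simp)).deriv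

lemma primitive (hf : LocIntegrable f) : LocIntegrable fun t => ∫ s in (0 : ℝ)..t, f s := by
  intro T
  rcases le_total 0 T with hT | hT
  · have h := (hf.absolutelyContinuous hT).continuousOn
    rw [Set.uIcc_of_le hT] at h
    exact (h.integrableOn_Icc).mono_set Set.Ioc_subset_Icc_self
  · simp [Set.Ioc_eq_empty (not_lt.2 hT)]

end LocIntegrable

namespace IsTimeTest

variable {f ψ : ℝ → ℝ}

lemma deriv (h : IsTimeTest ψ) : IsTimeTest (deriv ψ) := by
  obtain ⟨a, b, ha, hab⟩ := h.supp
  refine ⟨h.smooth.iterate_deriv 1, a, b, ha, fun t ht => ?_⟩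
  have : ψ =ᶠ[𝓝 t] fun _ => 0 := by
    filter_upwards [isClosed_Icc.isOpen_compl.mem_nhds ht] with s hs using hab s hs
  rw [this.deriv_eq]; simp

lemma integrableOn_Ioc_mul (h : IsTimeTest ψ) (hf : LocIntegrable f) (T : ℝ) :
    IntegrableOn (fun t => f t * ψ t) (Set.Ioc 0 T) := by
  obtain ⟨a, b, ha, hab⟩ := h.supp
  obtain ⟨C, hC⟩ : ∃ C, ∀ t, ‖ψ t‖ ≤ C := h.smooth.continuous.bounded_above_of_compact_support
    (HasCompactSupport.intro (isCompact_Icc (a := a) (b := b)) hab)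
  exact (hf T).mul_bdd h.smooth.continuous.aestronglyMeasurable (Eventually.of_forall hC)

lemma integrableOn_mul (h : IsTimeTest ψ) (hf : LocIntegrable f) :
    IntegrableOn (fun t => f t * ψ t) (Set.Ioi 0) := by
  obtain ⟨a, b, ha, hab⟩ := h.supp
  refine (h.integrableOn_Ioc_mul hf b).of_forall_sdiff_eq_zero measurableSet_Ioi fun t ht => ?_
  rw [hab t fun h' => ht.2 ⟨ht.1, h'.2⟩, mul_zero]

lemma exists_integral_eq (h : IsTimeTest ψ) : ∃ b, 0 < b ∧ ∀ T, b ≤ T → ψ T = 0 ∧ ∀ f : ℝ → ℝ,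
    ∫ t in Set.Ioi 0, f t * ψ t = ∫ t in (0 : ℝ)..T, f t * ψ t := by
  obtain ⟨a, b, ha, hab⟩ := h.supp
  refine ⟨max (b + 1) 1, by positivity, fun T hT => ⟨hab T fun h' => ?_, fun f => ?_⟩⟩
  · have := le_max_left (b + 1) 1
    linarith [h'.2]
  · have h1 := le_max_left (b + 1) 1
    have h2 := le_max_right (b + 1) 1
    rw [intervalIntegral.integral_of_le (by linarith)]
    refine (setIntegral_eq_of_subset_of_forall_sdiff_eq_zero measurableSet_Ioi
      (fun t ht => ht.1) fun t ht => ?_)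
    rw [hab t fun h' => ht.2 ⟨ht.1, by linarith [h'.2]⟩, mul_zero]

end IsTimeTest

lemma LocIntegrable.ae_eq_zero {f : ℝ → ℝ} (hf : LocIntegrable f)
    (h : ∀ ψ, IsTimeTest ψ → ∫ t in Set.Ioi 0, f t * ψ t = 0) :
    ∀ᵐ t ∂volume.restrict (Set.Ioi 0), f t = 0 := by
  rw [ae_restrict_iff' measurableSet_Ioi]
  refine isOpen_Ioi.ae_eq_zero_of_integral_contDiff_smul_eq_zero hf.locallyIntegrableOn
    fun g hg hgc hgs => ?_
  have hout : ∀ t, t ∉ Set.Ioi (0 : ℝ) → g t = 0 := fun t ht =>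
    image_eq_zero_of_notMem_tsupport fun h' => ht (hgs h')
  have htest : IsTimeTest g := by
    refine ⟨hg, ?_⟩
    rcases (tsupport g).eq_empty_or_nonempty with he | hne
    · exact ⟨1, 1, one_pos, fun t _ => image_eq_zero_of_notMem_tsupport (by simp [he])⟩
    · obtain ⟨a, ha⟩ := hgc.isCompact.exists_isLeast hne
      obtain ⟨b, hb⟩ := hgc.isCompact.exists_isGreatest hne
      exact ⟨a, b, hgs ha.1, fun t ht => image_eq_zero_of_notMem_tsupport fun h' =>
        ht ⟨ha.2 h', hb.2 h'⟩⟩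
  rw [← h g htest, ← setIntegral_eq_integral_of_forall_compl_eq_zero (s := Set.Ioi 0)]
  · simp [mul_comm]
  · intro t ht
    simp [hout t ht]

/-- A function with vanishing weak derivative is constant. -/
lemma LocIntegrable.exists_ae_eq_const {h : ℝ → ℝ} (hh : LocIntegrable h)
    (h0 : ∀ ψ, IsTimeTest ψ → ∫ t in Set.Ioi 0, h t * deriv ψ t = 0) :
    ∃ K, ∀ᵐ t ∂volume.restrict (Set.Ioi 0), h t = K := by
  let bmp : ContDiffBump (2 : ℝ) := ⟨1 / 2, 1, by norm_num, by norm_num⟩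
  have hb : IsTimeTest (bmp.normed volume) := by
    refine ⟨bmp.contDiff_normed, 1, 3, one_pos, fun t ht => image_eq_zero_of_notMem_tsupport ?_⟩
    rw [bmp.tsupport_normed_eq, Real.closedBall_eq_Icc]
    norm_num
    intro h1
    by_contra h2
    exact ht ⟨h1, by linarith⟩
  set ψ₀ := bmp.normed volume with hψ₀
  have hb1 : ∫ t in Set.Ioi 0, ψ₀ t = 1 := by
    obtain ⟨a, b, ha, hab⟩ := hb.supp
    rw [setIntegral_eq_integral_of_forall_compl_eq_zero, bmp.integral_normed]
    intro t ht
    exact hab t fun h' => ht (lt_of_lt_of_le ha h'.1)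
  refine ⟨∫ t in Set.Ioi 0, h t * ψ₀ t, ?_⟩
  set K := ∫ t in Set.Ioi 0, h t * ψ₀ t
  have hK : LocIntegrable fun _ => K := .of_continuous continuous_const
  suffices ∀ᵐ t ∂volume.restrict (Set.Ioi 0), h t - K = 0 by
    filter_upwards [this] with t ht using sub_eq_zero.1 ht
  refine (hh.sub hK).ae_eq_zero fun g hg => ?_
  set c := ∫ t in Set.Ioi 0, g t
  have hgc : Continuous g := hg.smooth.continuous
  have hbc : Continuous ψ₀ := hb.smooth.continuous
  have hcont : Continuous fun t => g t - c * ψ₀ t := by fun_prop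
  have hd : ∀ t, HasDerivAt (fun t => ∫ s in (0 : ℝ)..t, (g s - c * ψ₀ s)) (g t - c * ψ₀ t) t :=
    fun t => intervalIntegral.integral_hasDerivAt_right (hcont.intervalIntegrable _ _)
      (hcont.stronglyMeasurableAtFilter _ _) hcont.continuousAt
  have hderiv : deriv (fun t => ∫ s in (0 : ℝ)..t, (g s - c * ψ₀ s)) =
      fun t => g t - c * ψ₀ t := funext fun t => (hd t).deriv
  have h1 : LocIntegrable fun _ => 1 := .of_continuous continuous_const
  have hgi : IntegrableOn g (Set.Ioi 0) := by simpa using hg.integrableOn_mul h1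
  have hbi : IntegrableOn ψ₀ (Set.Ioi 0) := by simpa using hb.integrableOn_mul h1
  have hΨ : IsTimeTest fun t => ∫ s in (0 : ℝ)..t, (g s - c * ψ₀ s) := by
    constructor
    · refine contDiff_infty_iff_deriv.2 ⟨fun t => (hd t).differentiableAt, ?_⟩
      rw [hderiv]
      exact hg.smooth.sub (contDiff_const.mul hb.smooth)
    · obtain ⟨a, b, ha, hab⟩ := hg.supp
      obtain ⟨a', b', ha', hab'⟩ := hb.supp
      refine ⟨min a a', max b b', lt_min ha ha', fun t ht => ?_⟩
      rcases lt_or_ge t (min a a') with hta | hta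
      · have : ∀ s ∈ Set.uIcc 0 t, g s - c * ψ₀ s = 0 := by
          intro s hs
          have hs' : s < min a a' := by
            rcases Set.mem_uIcc.1 hs with hs | hs
            · exact lt_of_le_of_lt hs.2 hta
            · exact lt_of_le_of_lt hs.2 (lt_min ha ha')
          rw [hab s fun h' => absurd (lt_of_lt_of_le hs' (min_le_left _ _)) (not_lt.2 h'.1),
            hab' s fun h' => absurd (lt_of_lt_of_le hs' (min_le_right _ _)) (not_lt.2 h'.1)]
          simp
        rw [intervalIntegral.integral_congr (g := fun _ => 0) this]
        simp
      · have htb : max b b' < t := by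
          by_contra h'
          exact ht ⟨hta, not_lt.1 h'⟩
        have ht0 : 0 < t := lt_of_lt_of_le (lt_min ha ha') hta
        rw [intervalIntegral.integral_of_le ht0.le,
          ← setIntegral_eq_of_subset_of_forall_sdiff_eq_zero (t := Set.Ioi 0) measurableSet_Ioi
            (fun t ht => ht.1) (fun s hs => ?_), integral_sub hgi (hbi.const_mul c),
          integral_const_mul, hb1]
        · simp [c]
        · have hst : t < s := by
            by_contra h'
            exact hs.2 ⟨hs.1, not_lt.1 h'⟩
          rw [hab s fun h' => ?_, hab' s fun h' => ?_]
          · simp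
          · linarith [h'.2, le_max_right b b']
          · linarith [h'.2, le_max_left b b']
  have key := h0 _ hΨ
  rw [hderiv] at key
  have e1 : ∫ t in Set.Ioi 0, h t * (g t - c * ψ₀ t) = (∫ t in Set.Ioi 0, h t * g t) - c * K := by
    rw [← integral_const_mul, ← integral_sub (hg.integrableOn_mul hh)
      ((hb.integrableOn_mul hh).const_mul c)]
    congr 1; ext t; ring
  have e2 : ∫ t in Set.Ioi 0, (h t - K) * g t = (∫ t in Set.Ioi 0, h t * g t) - K * c := by
    rw [← integral_const_mul, ← integral_sub (hg.integrableOn_mul hh) (hgi.const_mul K)]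
    congr 1; ext t; ring
  rw [e2]; rw [e1] at key; linarith

/-- A function with locally integrable weak derivative which vanishes at `0⁺` is the
primitive of its weak derivative. -/
lemma LocIntegrable.ae_eq_primitive {α β : ℝ → ℝ} (hα : LocIntegrable α) (hβ : LocIntegrable β)
    (h : ∀ ψ, IsTimeTest ψ →
      ∫ t in Set.Ioi 0, α t * deriv ψ t = - ∫ t in Set.Ioi 0, β t * ψ t)
    (h0 : Tendsto α (𝓝[>] 0) (𝓝 0)) :
    ∀ᵐ t ∂volume.restrict (Set.Ioi 0), α t = ∫ s in (0 : ℝ)..t, β s := by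
  obtain ⟨K, hK⟩ := (hα.sub hβ.primitive).exists_ae_eq_const fun ψ hψ => by
    obtain ⟨b, hb0, hb⟩ := hψ.exists_integral_eq
    have hψ' := hψ.deriv
    simp_rw [sub_mul]
    rw [integral_sub (hψ'.integrableOn_mul hα) (hψ'.integrableOn_mul hβ.primitive), h ψ hψ]
    obtain ⟨b', hb0', hb'⟩ := hψ'.exists_integral_eq
    have hT0 : (0 : ℝ) ≤ max b b' := hb0.le.trans (le_max_left _ _)
    obtain ⟨hT, hT'⟩ := hb _ (le_max_left b b')
    rw [(hb' _ (le_max_right b b')).2, hT',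
      (hβ.absolutelyContinuous hT0).integral_mul_deriv_eq_deriv_mul
        ((hψ.smooth.of_le (by simp)).contDiffOn.absolutelyContinuousOnInterval), hT]
    have e : ∫ t in (0 : ℝ)..max b b', deriv (fun t => ∫ s in (0 : ℝ)..t, β s) t * ψ t =
        ∫ t in (0 : ℝ)..max b b', β t * ψ t := intervalIntegral.integral_congr_ae (by
      filter_upwards [hβ.ae_deriv_primitive hT0] with t ht h'
      rw [Set.uIoc_of_le hT0] at h'
      rw [ht h'])
    rw [e]
    simp
  have hF : Tendsto (fun t => ∫ s in (0 : ℝ)..t, β s) (𝓝[>] 0) (𝓝 0) := by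
    have := (hβ.absolutelyContinuous zero_le_one).continuousOn 0 (by simp)
    rw [ContinuousWithinAt, intervalIntegral.integral_same, Set.uIcc_of_le zero_le_one] at this
    refine this.mono_left ?_
    rw [← nhdsWithin_Ioc_eq_nhdsGT one_pos]
    exact nhdsWithin_mono _ Set.Ioc_subset_Icc_self
  have hK0 : K = 0 := by
    by_contra hne
    have hlim : Tendsto (fun t => α t - ∫ s in (0 : ℝ)..t, β s) (𝓝[>] 0) (𝓝 0) := by
      simpa using h0.sub hF
    obtain ⟨ε, hε, hs⟩ := mem_nhdsGT_iff_exists_Ioo_subset.1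
      (hlim.eventually_ne (Ne.symm hne))
    have hae : ∀ᵐ t ∂volume.restrict (Set.Ioo 0 ε), False := by
      filter_upwards [ae_restrict_of_ae_restrict_of_subset Set.Ioo_subset_Ioi_self hK,
        ae_restrict_mem measurableSet_Ioo] with t ht1 ht2
      exact hs ht2 ht1
    rw [ae_iff] at hae
    simp at hae
    exact absurd hae (not_le.2 hε)
  filter_upwards [hK] with t ht
  linarith

/-- The square of a primitive. -/
lemma sq_integral_eq {f : ℝ → ℝ} {T : ℝ} (hT : 0 ≤ T) (hf : IntegrableOn f (Set.Ioc 0 T)) :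
    (∫ s in (0 : ℝ)..T, f s) ^ 2 = 2 * ∫ s in (0 : ℝ)..T, (∫ r in (0 : ℝ)..s, f r) * f s := by
  have hi : IntervalIntegrable f volume 0 T := by
    rwa [intervalIntegrable_iff_integrableOn_Ioc_of_le hT]
  have hac : AbsolutelyContinuousOnInterval (fun t => ∫ s in (0 : ℝ)..t, f s) 0 T :=
    hi.absolutelyContinuousOnInterval_intervalIntegral (by simp)
  have hd : ∀ᵐ t, t ∈ Set.uIoc 0 T → deriv (fun t => ∫ s in (0 : ℝ)..t, f s) t = f t := by
    filter_upwards [hi.ae_hasDerivAt_integral] with t ht h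
    exact (ht (Set.uIoc_subset_uIcc h) 0 (by simp)).deriv
  have key := hac.integral_mul_deriv_eq_deriv_mul hac
  have e1 : ∫ s in (0 : ℝ)..T, (∫ r in (0 : ℝ)..s, f r) * deriv (fun t => ∫ s in (0 : ℝ)..t, f s) s
      = ∫ s in (0 : ℝ)..T, (∫ r in (0 : ℝ)..s, f r) * f s :=
    intervalIntegral.integral_congr_ae (by
      filter_upwards [hd] with t ht h; rw [ht h])
  have e2 : ∫ s in (0 : ℝ)..T, deriv (fun t => ∫ s in (0 : ℝ)..t, f s) s * (∫ r in (0 : ℝ)..s, f r)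
      = ∫ s in (0 : ℝ)..T, (∫ r in (0 : ℝ)..s, f r) * f s :=
    intervalIntegral.integral_congr_ae (by
      filter_upwards [hd] with t ht h; rw [ht h, mul_comm])
  rw [e1, e2, intervalIntegral.integral_same] at key
  linarith

section
variable {n : ℕ} {u₀ : ℝ → E n} {u w : ℝ → ℝ → E n}

lemma sqNorm_of_unit {f : ℝ → E n} (hf : ∀ᵐ x ∂volume.restrict circ, ‖f x‖ = 1) :
    sqNorm f = ENNReal.ofReal (2 * π) := by
  unfold sqNorm
  rw [lintegral_congr_ae (g := fun _ => 1)]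
  · simp [volume_circ]
  · filter_upwards [hf] with x hx
    simp [← ofReal_norm, hx]

lemma measurable_hSob (s : ℝ) (hu : Measurable (Function.uncurry u)) :
    Measurable fun t => hSob s (u t) := by
  unfold hSob fcV fcR fc
  refine Measurable.tsum fun k => ?_
  refine Measurable.const_mul (Finset.measurable_sum _ fun i _ => ?_) _
  have h1 : Measurable fun p : ℝ × ℝ =>
      ((u p.1 p.2 i : ℝ) : ℂ) * Complex.exp (-(Complex.I * (k : ℂ) * (p.2 : ℂ))) := by
    have : Measurable fun p : ℝ × ℝ => u p.1 p.2 := hu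
    have h2 : Measurable fun p : ℝ × ℝ => u p.1 p.2 i := by fun_prop
    fun_prop
  have h3 := (h1.stronglyMeasurable.integral_prod_right' (ν := volume.restrict circ)).measurable
  exact ((h3.const_mul _).nnnorm.coe_nnreal_ennreal).pow_const 2

namespace IsEnergySolAux

lemma ae_unit (h : IsEnergySolAux n u₀ u w) :
    ∀ᵐ t ∂volume.restrict (Set.Ioi 0), ∀ᵐ x ∂volume.restrict circ, ‖u t x‖ = 1 :=
  Measure.ae_ae_of_ae_prod h.sphere

lemma measurable_slice (h : IsEnergySolAux n u₀ u w) (t : ℝ) : Measurable (u t) :=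
  h.meas.comp measurable_prodMk_left

lemma ae_gagEnergy_le (h : IsEnergySolAux n u₀ u w) :
    ∃ M : ℝ≥0∞, M < ⊤ ∧ ∀ᵐ t ∂volume.restrict (Set.Ioi 0), gagEnergy (u t) ≤ M := by
  obtain ⟨M, hM, hae⟩ := h.energyBdd
  refine ⟨ENNReal.ofReal (2 * π) ^ 2 * M, by finiteness, ?_⟩
  filter_upwards [hae, h.ae_unit] with t ht h1
  refine (gagEnergy_le_hHalf (h.measurable_slice t) (h.periodic t)
    (by rw [sqNorm_of_unit h1]; finiteness)).trans ?_
  gcongr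

lemma measurable_sqNorm (hw : Measurable (Function.uncurry w)) :
    Measurable fun t => sqNorm (w t) := by
  have : Measurable fun p : ℝ × ℝ => w p.1 p.2 := hw
  have h2 : Measurable fun p : ℝ × ℝ => ‖w p.1 p.2‖ₑ ^ 2 := by fun_prop
  exact h2.lintegral_prod_right'

lemma lintegral_sqNorm_lt_top (h : IsEnergySolAux n u₀ u w) :
    ∫⁻ t in Set.Ioi 0, sqNorm (w t) < ⊤ := h.wL2

lemma ae_sliceData (h : IsEnergySolAux n u₀ u w)
    (hH : ∀ᵐ t ∂volume.restrict (Set.Ioi 0), hSob 1 (u t) < ⊤) :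
    ∀ᵐ t ∂volume.restrict (Set.Ioi 0), SliceData (u t) (w t) := by
  obtain ⟨M, hM, hae⟩ := h.ae_gagEnergy_le
  filter_upwards [hae, h.ae_unit, hH,
    ae_lt_top (measurable_sqNorm h.wMeas) h.lintegral_sqNorm_lt_top.ne] with t h1 h2 h3 h4
  have hs : sqNorm (u t) < ⊤ := by rw [sqNorm_of_unit h2]; finiteness
  refine ⟨h.measurable_slice t, h.periodic t, h2, h1.trans_lt hM, ?_,
    h.wMeas.comp measurable_prodMk_left, h4⟩
  exact (incrEnergy_le_hSob (h.measurable_slice t) (h.periodic t) hs).trans_lt (by finiteness)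

lemma ae_hHalf_lt_top (h : IsEnergySolAux n u₀ u w) :
    ∀ᵐ t ∂volume.restrict (Set.Ioi 0), hHalf (u t) < ⊤ := by
  obtain ⟨M, hM, hae⟩ := h.energyBdd
  filter_upwards [hae] with t ht using ht.trans_lt hM

end IsEnergySolAux

lemma LocIntegrable.of_sq_le {R : ℝ → ℝ} {g : ℝ → ℝ≥0∞}
    (hm : AEStronglyMeasurable R (volume.restrict (Set.Ioi 0)))
    (hR : ∀ᵐ t ∂volume.restrict (Set.Ioi 0), ‖R t‖ₑ ^ 2 ≤ g t)
    (hg : ∀ T : ℝ, ∫⁻ t in Set.Ioc 0 T, g t < ⊤) : LocIntegrable R := by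
  intro T
  refine ⟨hm.mono_measure (Measure.restrict_mono Set.Ioc_subset_Ioi_self le_rfl), ?_⟩
  have h1 : ∫⁻ t in Set.Ioc 0 T, ‖R t‖ₑ ≤ ∫⁻ t in Set.Ioc 0 T, (1 + g t) := by
    refine lintegral_mono_ae ?_
    filter_upwards [ae_restrict_of_ae_restrict_of_subset Set.Ioc_subset_Ioi_self hR] with t ht
    refine le_trans ?_ (add_le_add_right ht 1)
    rcases le_total ‖R t‖ₑ 1 with h | h
    · exact h.trans le_self_add
    · exact (le_self_pow h (by norm_num)).trans le_add_self
  refine h1.trans_lt ?_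
  rw [lintegral_add_left measurable_const]
  have := hg T
  simp only [lintegral_const, one_mul, Measure.restrict_apply_univ, Real.volume_Ioc]
  finiteness

lemma contDiff_trigVec (z : ℂ) (k : ℤ) (i : Fin n) : ContDiff ℝ (⊤ : ℕ∞) (trigVec z k i) := by
  have h : ∀ a : ℝ, (EuclideanSpace.single i a : E n) = a • EuclideanSpace.single i (1 : ℝ) := by
    intro a
    ext j
    simp
  have h' : (trigVec z k i : ℝ → E n) =
      fun x => (z * trig k x).re • EuclideanSpace.single i (1 : ℝ) := funext fun x => h _
  rw [h']
  refine ContDiff.smul (f := fun x => (z * trig k x).re) ?_ contDiff_const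
  have h2 : ContDiff ℝ (⊤ : ℕ∞) (trig k) := by
    unfold trig
    have h3 : ContDiff ℝ (⊤ : ℕ∞) fun x : ℝ => (x : ℂ) := Complex.ofRealCLM.contDiff
    exact (contDiff_const.mul h3).cexp
  exact Complex.reCLM.contDiff.comp (contDiff_const.mul h2)

lemma isSTTest_smul_trigVec {ψ : ℝ → ℝ} (hψ : IsTimeTest ψ) (z : ℂ) (k : ℤ) (i : Fin n) :
    IsSTTest n fun t => ψ t • trigVec z k i where
  smooth := (hψ.smooth.comp contDiff_fst).smul ((contDiff_trigVec z k i).comp contDiff_snd)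
  periodic t := (trigVec_periodic z k i).smul (ψ t)
  suppTime := by
    obtain ⟨a, b, ha, hab⟩ := hψ.supp
    exact ⟨a, b, ha, fun t ht x => by simp [hab t ht]⟩

lemma sum_mul_eq_inner (a b : E n) : ∑ i, a i * b i = inner ℝ a b := by
  simp [PiLp.inner_apply, mul_comm]

variable {η : ℝ → E n}

lemma measurable_integral_inner (hw : Measurable (Function.uncurry w)) (hη : Measurable η) :
    Measurable fun t => ∫ x in circ, inner ℝ (w t x) (η x) := by
  have : Measurable fun p : ℝ × ℝ => w p.1 p.2 := hw
  have h1 : Measurable fun p : ℝ × ℝ => (inner ℝ (w p.1 p.2) (η p.2) : ℝ) := by fun_prop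
  exact (h1.stronglyMeasurable.integral_prod_right (ν := volume.restrict circ)).measurable

lemma measurable_integral_gagForm (hu : Measurable (Function.uncurry u)) (hη : Measurable η) :
    Measurable fun t => ∫ q, gagForm (u t) η q ∂circPair := by
  have h1 : Measurable fun p : ℝ × ℝ × ℝ => u p.1 p.2.1 :=
    hu.comp (g := Function.uncurry u) (f := fun p : ℝ × ℝ × ℝ => (p.1, p.2.1)) (by fun_prop)
  have h2 : Measurable fun p : ℝ × ℝ × ℝ => u p.1 p.2.2 :=
    hu.comp (g := Function.uncurry u) (f := fun p : ℝ × ℝ × ℝ => (p.1, p.2.2)) (by fun_prop)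
  have h3 : Measurable fun p : ℝ × ℝ × ℝ => gagForm (u p.1) η p.2 := by
    have : Measurable fun p : ℝ × ℝ × ℝ => cd p.2.1 p.2.2 := measurable_cd.comp measurable_snd
    unfold gagForm
    fun_prop
  exact (h3.stronglyMeasurable.integral_prod_right (ν := circPair)).measurable

lemma measurable_integral_forceForm (hu : Measurable (Function.uncurry u)) (hη : Measurable η) :
    Measurable fun t => ∫ q, forceForm (u t) η q ∂circPair := by
  have h1 : Measurable fun p : ℝ × ℝ × ℝ => u p.1 p.2.1 :=
    hu.comp (g := Function.uncurry u) (f := fun p : ℝ × ℝ × ℝ => (p.1, p.2.1)) (by fun_prop)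
  have h2 : Measurable fun p : ℝ × ℝ × ℝ => u p.1 p.2.2 :=
    hu.comp (g := Function.uncurry u) (f := fun p : ℝ × ℝ × ℝ => (p.1, p.2.2)) (by fun_prop)
  have h3 : Measurable fun p : ℝ × ℝ × ℝ => forceForm (u p.1) η p.2 := by
    have : Measurable fun p : ℝ × ℝ × ℝ => cd p.2.1 p.2.2 := measurable_cd.comp measurable_snd
    unfold forceForm
    fun_prop
  exact (h3.stronglyMeasurable.integral_prod_right (ν := circPair)).measurable

lemma enorm_integral_sq_le {α : Type*} [MeasurableSpace α] {μ : Measure α} {f : α → ℝ} {b : ℝ≥0∞}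
    (h : (∫⁻ x, ‖f x‖ₑ ∂μ) ^ 2 ≤ b) : ‖∫ x, f x ∂μ‖ₑ ^ 2 ≤ b :=
  (pow_le_pow_left' (enorm_integral_le_lintegral_enorm f) 2).trans h

lemma lintegral_Ioc_const_lt_top {c : ℝ≥0∞} (hc : c < ⊤) (T : ℝ) :
    ∫⁻ _ in Set.Ioc 0 T, c < ⊤ := by
  simp only [lintegral_const, Measure.restrict_apply_univ, Real.volume_Ioc]
  finiteness

namespace IsEnergySolAux

lemma locIntegrable_inner_deriv (h : IsEnergySolAux n u₀ u w) (hη : Admissible η) :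
    LocIntegrable fun t => ∫ x in circ, inner ℝ (w t x) (η x) := by
  have hm := h.wMeas
  refine .of_sq_le (measurable_integral_inner hm hη.meas).aestronglyMeasurable
    (g := fun t => sqNorm (w t) * sqNorm η) (ae_of_all _ fun t => enorm_integral_sq_le
    (sq_lintegral_inner_le (hm.comp measurable_prodMk_left) hη.meas)) fun T => ?_
  rw [lintegral_mul_const _ (measurable_sqNorm hm)]
  have h1 := hη.sq
  have h2 := (lintegral_mono_set (f := fun t => sqNorm (w t))
    (Set.Ioc_subset_Ioi_self : Set.Ioc 0 T ⊆ Set.Ioi 0)).trans_lt h.lintegral_sqNorm_lt_top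
  finiteness

lemma locIntegrable_inner (h : IsEnergySolAux n u₀ u w) (hη : Admissible η) :
    LocIntegrable fun t => ∫ x in circ, inner ℝ (u t x) (η x) := by
  refine .of_sq_le (measurable_integral_inner h.meas hη.meas).aestronglyMeasurable
    (g := fun _ => ENNReal.ofReal (2 * π) * sqNorm η) ?_
    (lintegral_Ioc_const_lt_top (by have := hη.sq; finiteness))
  filter_upwards [h.ae_unit] with t ht
  rw [← sqNorm_of_unit ht]
  exact enorm_integral_sq_le (sq_lintegral_inner_le (h.measurable_slice t) hη.meas)

lemma locIntegrable_gagForm (h : IsEnergySolAux n u₀ u w) (hη : Admissible η) :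
    LocIntegrable fun t => ∫ q, gagForm (u t) η q ∂circPair := by
  obtain ⟨M, hM, hae⟩ := h.ae_gagEnergy_le
  refine .of_sq_le (measurable_integral_gagForm h.meas hη.meas).aestronglyMeasurable
    (g := fun _ => M * gagEnergy η) ?_
    (lintegral_Ioc_const_lt_top (by have := hη.gag; finiteness))
  filter_upwards [hae] with t ht
  refine (enorm_integral_sq_le (sq_lintegral_gagForm_le (h.measurable_slice t) (h.periodic t)
    hη.meas hη.periodic)).trans ?_
  gcongr

lemma locIntegrable_forceForm (h : IsEnergySolAux n u₀ u w) (hη : Admissible η) {C : ℝ}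
    (hC : ∀ x, ‖η x‖ ≤ C) :
    LocIntegrable fun t => ∫ q, forceForm (u t) η q ∂circPair := by
  obtain ⟨M, hM, hae⟩ := h.ae_gagEnergy_le
  refine .of_sq_le (measurable_integral_forceForm h.meas hη.meas).aestronglyMeasurable
    (g := fun _ => M * (M * ENNReal.ofReal C ^ 2)) ?_
    (lintegral_Ioc_const_lt_top (by finiteness))
  filter_upwards [hae, h.ae_unit] with t ht h1
  refine (enorm_integral_sq_le (sq_lintegral_forceForm_le (h.measurable_slice t) (h.periodic t)
    hη.meas h1)).trans ?_
  gcongr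
  refine le_trans ?_ (mul_le_mul_left ht _)
  unfold weightedEnergy gagEnergy
  rw [← lintegral_mul_const _ (measurable_gradSq (h.measurable_slice t))]
  refine lintegral_mono fun x => ?_
  gcongr
  rw [← ofReal_norm]
  exact ENNReal.ofReal_le_ofReal (hC x)

/-- The flow equation tested against a trigonometric direction, on almost every time slice. -/
lemma ae_flowResidual_trigVec (h : IsEnergySolAux n u₀ u w)
    (hs : ∀ᵐ t ∂volume.restrict (Set.Ioi 0), SliceData (u t) (w t)) (z : ℂ) (k : ℤ) (i : Fin n) :
    ∀ᵐ t ∂volume.restrict (Set.Ioi 0), flowResidual (u t) (w t) (trigVec z k i) = 0 := by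
  have hη := admissible_trigVec z k i
  have l1 := h.locIntegrable_inner_deriv hη
  have l2 := h.locIntegrable_gagForm hη
  have l3 := h.locIntegrable_forceForm hη (norm_trigVec_le z k i)
  refine ((l1.add l2).sub l3).ae_eq_zero fun ψ hψ => ?_
  have key := h.flow _ (isSTTest_smul_trigVec hψ z k i)
  have e1 : ∀ t, ∫ x in circ, ∑ j, w t x j * (ψ t • trigVec z k i) x j =
      (∫ x in circ, inner ℝ (w t x) (trigVec z k i x)) * ψ t := by
    intro t
    simp only [sum_mul_eq_inner, Pi.smul_apply, inner_smul_right]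
    rw [integral_const_mul, mul_comm]
  have e2 : ∀ᵐ t ∂volume.restrict (Set.Ioi 0), pairing (u t) (ψ t • trigVec z k i) =
      (∫ q, gagForm (u t) (trigVec z k i) q ∂circPair) * ψ t := by
    filter_upwards [hs] with t ht
    rw [pairing_eq (ht.integrable_gagForm (hη.smul _)), gagForm_smul, integral_const_mul, mul_comm]
  have e3 : ∀ᵐ t ∂volume.restrict (Set.Ioi 0),
      ∫ x in circ, gagl (u t) x * ∑ j, u t x j * (ψ t • trigVec z k i) x j =
      (∫ q, forceForm (u t) (trigVec z k i) q ∂circPair) * ψ t := by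
    filter_upwards [hs] with t ht
    rw [integral_gagl_mul (ht.integrable_forceForm (hη.smul _)), forceForm_smul,
      integral_const_mul, mul_comm]
  rw [integral_congr_ae e2, integral_congr_ae e3] at key
  simp only [e1] at key
  simp only [sub_mul, add_mul]
  have i1 := hψ.integrableOn_mul l1
  have i2 := hψ.integrableOn_mul l2
  rw [integral_sub (by exact i1.add i2) (hψ.integrableOn_mul l3), integral_add i1 i2, key, sub_self]

lemma ae_flowResidual (h : IsEnergySolAux n u₀ u w)
    (hs : ∀ᵐ t ∂volume.restrict (Set.Ioi 0), SliceData (u t) (w t)) :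
    ∀ᵐ t ∂volume.restrict (Set.Ioi 0), ∀ f, Admissible f → hHalf f < ⊤ →
      flowResidual (u t) (w t) f = 0 := by
  filter_upwards [hs, ae_all_iff.2 fun k => ae_all_iff.2 fun i => h.ae_flowResidual_trigVec hs 1 k i,
    ae_all_iff.2 fun k => ae_all_iff.2 fun i => h.ae_flowResidual_trigVec hs Complex.I k i]
    with t h1 h2 h3 f hf hH
  exact h1.flowResidual_eq_zero h2 h3 hf hH

lemma weakDeriv_inner (h : IsEnergySolAux n u₀ u w) (z : ℂ) (k : ℤ) (i : Fin n) {ψ : ℝ → ℝ}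
    (hψ : IsTimeTest ψ) :
    ∫ t in Set.Ioi 0, (∫ x in circ, inner ℝ (u t x) (trigVec z k i x)) * deriv ψ t =
      - ∫ t in Set.Ioi 0, (∫ x in circ, inner ℝ (w t x) (trigVec z k i x)) * ψ t := by
  have key := h.weakDeriv _ (isSTTest_smul_trigVec hψ z k i)
  have e1 : ∀ t, ∫ x in circ, ∑ j, w t x j * (ψ t • trigVec z k i) x j =
      (∫ x in circ, inner ℝ (w t x) (trigVec z k i x)) * ψ t := by
    intro t
    simp only [sum_mul_eq_inner, Pi.smul_apply, inner_smul_right]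
    rw [integral_const_mul, mul_comm]
  have e2 : ∀ t x (j : Fin n), deriv (fun s => (ψ s • trigVec z k i) x j) t =
      (deriv ψ t • trigVec z k i) x j := by
    intro t x j
    have := (hψ.smooth.differentiable (by simp)) t
    simp [deriv_mul_const this]
  have e3 : ∀ t, ∫ x in circ, ∑ j, u t x j * (deriv ψ t • trigVec z k i) x j =
      (∫ x in circ, inner ℝ (u t x) (trigVec z k i x)) * deriv ψ t := by
    intro t
    simp only [sum_mul_eq_inner, Pi.smul_apply, inner_smul_right]
    rw [integral_const_mul, mul_comm]
  simpa only [e1, e2, e3] using key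

end IsEnergySolAux

end

section
variable {n : ℕ} {d : ℝ → ℝ → E n}

/-- The primitive in time of a space-time function. -/
def timePrimitive (d : ℝ → ℝ → E n) (t x : ℝ) : E n := ∫ s in Set.Ioc 0 t, d s x

lemma measurable_timePrimitive (hd : Measurable (Function.uncurry d)) :
    Measurable fun p : ℝ × ℝ => timePrimitive d p.1 p.2 := by
  have h1 : Measurable fun p : (ℝ × ℝ) × ℝ => d p.2 p.1.2 :=
    hd.comp (g := Function.uncurry d) (f := fun p : (ℝ × ℝ) × ℝ => (p.2, p.1.2)) (by fun_prop)
  have h2 : MeasurableSet {p : (ℝ × ℝ) × ℝ | 0 < p.2 ∧ p.2 ≤ p.1.1} :=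
    (measurableSet_lt measurable_const measurable_snd).inter
      (measurableSet_le measurable_snd (by fun_prop))
  have h3 := (h1.indicator h2).stronglyMeasurable.integral_prod_right' (ν := volume)
  convert h3.measurable using 1
  ext1 p
  unfold timePrimitive
  rw [← integral_indicator measurableSet_Ioc]
  rfl

/-- The primitive in time of the pointwise norm. -/
def normPrimitive (d : ℝ → ℝ → E n) (T x : ℝ) : ℝ≥0∞ := ∫⁻ s in Set.Ioc 0 T, ‖d s x‖ₑ

lemma measurable_normPrimitive (hd : Measurable (Function.uncurry d)) (T : ℝ) :
    Measurable (normPrimitive d T) := by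
  have h1 : Measurable fun p : ℝ × ℝ => d p.1 p.2 := hd
  have h2 : Measurable fun p : ℝ × ℝ => ‖d p.1 p.2‖ₑ := by fun_prop
  exact h2.lintegral_prod_left' (μ := volume.restrict (Set.Ioc 0 T))

lemma enorm_timePrimitive_le {t T : ℝ} (h : t ≤ T) (x : ℝ) :
    ‖timePrimitive d t x‖ₑ ≤ normPrimitive d T x :=
  (enorm_integral_le_lintegral_enorm _).trans
    (lintegral_mono_set (Set.Ioc_subset_Ioc_right h))

lemma lintegral_normPrimitive_sq_lt_top (hd : Measurable (Function.uncurry d))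
    (hL : ∫⁻ t in Set.Ioi 0, sqNorm (d t) < ⊤) (T : ℝ) :
    ∫⁻ x in circ, normPrimitive d T x ^ 2 < ⊤ := by
  have h1 : Measurable fun p : ℝ × ℝ => d p.1 p.2 := hd
  have h2 : Measurable fun p : ℝ × ℝ => ‖d p.2 p.1‖ₑ ^ 2 := by fun_prop
  have h3 : Measurable fun p : ℝ × ℝ => ‖d p.1 p.2‖ₑ ^ 2 := by fun_prop
  have h4 : ∀ x, Measurable fun s => d s x := fun x => h1.comp measurable_prodMk_right
  calc ∫⁻ x in circ, normPrimitive d T x ^ 2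
      ≤ ∫⁻ x in circ, ENNReal.ofReal T * ∫⁻ s in Set.Ioc 0 T, ‖d s x‖ₑ ^ 2 := by
        refine lintegral_mono fun x => ?_
        have := h4 x
        have h := sq_lintegral_mul_le (μ := volume.restrict (Set.Ioc 0 T)) (f := fun _ => 1)
          (g := fun s => ‖d s x‖ₑ) (by fun_prop) (by fun_prop)
        simpa [normPrimitive] using h
    _ = ENNReal.ofReal T * ∫⁻ s in Set.Ioc 0 T, sqNorm (d s) := by
        rw [lintegral_const_mul _ (h2.lintegral_prod_right' (ν := volume.restrict (Set.Ioc 0 T))),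
          lintegral_lintegral_swap (by exact h2.aemeasurable)]
        rfl
    _ < ⊤ := by
        have := (lintegral_mono_set (f := fun t => sqNorm (d t))
          (Set.Ioc_subset_Ioi_self : Set.Ioc 0 T ⊆ Set.Ioi 0)).trans_lt hL
        finiteness

lemma ae_normPrimitive_lt_top (hd : Measurable (Function.uncurry d))
    (hL : ∫⁻ t in Set.Ioi 0, sqNorm (d t) < ⊤) (T : ℝ) :
    ∀ᵐ x ∂volume.restrict circ, normPrimitive d T x < ⊤ := by
  filter_upwards [ae_lt_top ((measurable_normPrimitive hd T).pow_const 2)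
    (lintegral_normPrimitive_sq_lt_top hd hL T).ne] with x hx
  exact ENNReal.lt_top_of_sq_le le_rfl hx

lemma integrableOn_of_normPrimitive (hd : Measurable (Function.uncurry d)) {T x : ℝ}
    (h : normPrimitive d T x < ⊤) : IntegrableOn (fun s => d s x) (Set.Ioc 0 T) :=
  ⟨(hd.comp (measurable_prodMk_right (y := x))).aestronglyMeasurable, h⟩

lemma sqNorm_timePrimitive_lt_top (hd : Measurable (Function.uncurry d))
    (hL : ∫⁻ t in Set.Ioi 0, sqNorm (d t) < ⊤) (T : ℝ) : sqNorm (timePrimitive d T) < ⊤ := by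
  refine lt_of_le_of_lt (lintegral_mono fun x => ?_) (lintegral_normPrimitive_sq_lt_top hd hL T)
  gcongr
  exact enorm_timePrimitive_le le_rfl x

/-- Products dominated by `normPrimitive d T x * ‖d s x‖` are integrable on space-time. -/
lemma integrable_inner_of_le (hd : Measurable (Function.uncurry d))
    {a : ℝ → ℝ → E n} (ha : Measurable (Function.uncurry a)) {T : ℝ} {b : ℝ → ℝ≥0∞}
    (hab : ∀ s ∈ Set.Ioc 0 T, ∀ x, ‖a s x‖ₑ ≤ b x)
    (hfin : ∫⁻ x in circ, b x * normPrimitive d T x < ⊤) :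
    Integrable (fun p : ℝ × ℝ => (inner ℝ (a p.1 p.2) (d p.1 p.2) : ℝ))
      ((volume.restrict (Set.Ioc 0 T)).prod (volume.restrict circ)) := by
  have h1 : Measurable fun p : ℝ × ℝ => d p.1 p.2 := hd
  have h2 : Measurable fun p : ℝ × ℝ => a p.1 p.2 := ha
  have h3 : Measurable fun p : ℝ × ℝ => (inner ℝ (a p.1 p.2) (d p.1 p.2) : ℝ) := by fun_prop
  have h4 : ∀ x, Measurable fun s => d s x := fun x => h1.comp measurable_prodMk_right
  refine ⟨h3.aestronglyMeasurable, ?_⟩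
  unfold HasFiniteIntegral
  rw [lintegral_prod_symm _ (by fun_prop)]
  refine lt_of_le_of_lt (lintegral_mono fun x => ?_) hfin
  have := h4 x
  unfold normPrimitive
  rw [← lintegral_const_mul _ (by fun_prop)]
  refine setLIntegral_mono (by fun_prop) fun s hs => ?_
  refine le_trans ?_ (mul_le_mul_left (hab s hs x) _)
  rw [← ofReal_norm, ← ofReal_norm, ← ofReal_norm, ← ENNReal.ofReal_mul (norm_nonneg _)]
  exact ENNReal.ofReal_le_ofReal (norm_inner_le_norm _ _)

lemma integral_inner_timePrimitive (hd : Measurable (Function.uncurry d))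
    (hL : ∫⁻ t in Set.Ioi 0, sqNorm (d t) < ⊤) {η : ℝ → E n} (hη : Admissible η) (T : ℝ) :
    ∫ x in circ, inner ℝ (timePrimitive d T x) (η x) =
      ∫ s in Set.Ioc 0 T, ∫ x in circ, inner ℝ (d s x) (η x) := by
  have hm := measurable_normPrimitive hd T
  have h1 := hη.meas
  have hint := integrable_inner_of_le hd (a := fun _ x => η x) (b := fun x => ‖η x‖ₑ) (T := T)
    (h1.comp measurable_snd) (fun _ _ _ => le_rfl)
    (ENNReal.lt_top_of_sq_le (sq_lintegral_mul_le (by fun_prop) (by fun_prop)) (by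
      have h2 := hη.sq
      have h3 := lintegral_normPrimitive_sq_lt_top hd hL T
      unfold sqNorm at h2
      finiteness))
  rw [integral_integral_swap (f := fun s x => (inner ℝ (d s x) (η x) : ℝ))
    (hint.congr (ae_of_all _ fun p => real_inner_comm _ _))]
  refine integral_congr_ae ?_
  filter_upwards [ae_normPrimitive_lt_top hd hL T] with x hx
  unfold timePrimitive
  rw [real_inner_comm, ← integral_inner (integrableOn_of_normPrimitive hd hx)]
  exact integral_congr_ae (ae_of_all _ fun s => real_inner_comm _ _)

lemma norm_sq_timePrimitive (hd : Measurable (Function.uncurry d)) {T x : ℝ} (hT : 0 ≤ T)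
    (h : normPrimitive d T x < ⊤) :
    ‖timePrimitive d T x‖ ^ 2 =
      2 * ∫ s in Set.Ioc 0 T, inner ℝ (timePrimitive d s x) (d s x) := by
  have hi := integrableOn_of_normPrimitive hd h
  have hic : ∀ i, IntegrableOn (fun s => d s x i) (Set.Ioc 0 T) := fun i =>
    hi.eval_piLp i
  have hA : ∀ t ≤ T, ∀ i, timePrimitive d t x i = ∫ s in Set.Ioc 0 t, d s x i := fun t ht i =>
    eval_integral_piLp (fun j => (hic j).mono_set (Set.Ioc_subset_Ioc_right ht)) i
  have hm : Measurable fun s => timePrimitive d s x :=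
    (measurable_timePrimitive hd).comp measurable_prodMk_right
  have hprod : ∀ i, IntegrableOn (fun s => timePrimitive d s x i * d s x i) (Set.Ioc 0 T) := by
    intro i
    refine (hic i).bdd_mul (c := (normPrimitive d T x).toReal)
      (by fun_prop : Measurable _).aestronglyMeasurable ?_
    filter_upwards [ae_restrict_mem measurableSet_Ioc] with s hs
    refine (PiLp.norm_apply_le _ i).trans ?_
    rw [← toReal_enorm]
    exact ENNReal.toReal_mono h.ne (enorm_timePrimitive_le hs.2 x)
  rw [EuclideanSpace.norm_sq_eq]
  simp only [← sum_mul_eq_inner]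
  rw [integral_finsetSum _ fun i _ => hprod i, Finset.mul_sum]
  refine Finset.sum_congr rfl fun i _ => ?_
  rw [Real.norm_eq_abs, sq_abs, hA T le_rfl, ← intervalIntegral.integral_of_le hT,
    sq_integral_eq hT (hic i), intervalIntegral.integral_of_le hT]
  congr 1
  refine setIntegral_congr_fun measurableSet_Ioc fun s hs => ?_
  simp only
  rw [hA s hs.2, intervalIntegral.integral_of_le hs.1.le]

lemma ofReal_integral_le_lintegral {α : Type*} [MeasurableSpace α] {μ : Measure α} (f : α → ℝ) :
    ENNReal.ofReal (∫ x, f x ∂μ) ≤ ∫⁻ x, ENNReal.ofReal (f x) ∂μ := by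
  by_cases hf : Integrable f μ
  · rw [integral_eq_lintegral_pos_part_sub_lintegral_neg_part hf]
    refine (ENNReal.ofReal_le_ofReal (sub_le_self _ ENNReal.toReal_nonneg)).trans ?_
    exact ENNReal.ofReal_toReal_le
  · simp [integral_undef hf]

lemma sqNorm_timePrimitive_le (hd : Measurable (Function.uncurry d))
    (hL : ∫⁻ t in Set.Ioi 0, sqNorm (d t) < ⊤) {T : ℝ} (hT : 0 ≤ T) :
    sqNorm (timePrimitive d T) ≤ 2 * ∫⁻ s in Set.Ioc 0 T,
      ENNReal.ofReal (∫ x in circ, inner ℝ (timePrimitive d s x) (d s x)) := by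
  have hm := measurable_normPrimitive hd T
  have hint := integrable_inner_of_le hd (a := timePrimitive d) (measurable_timePrimitive hd) (T := T)
    (fun s hs x => enorm_timePrimitive_le hs.2 x)
    (by simpa only [sq] using lintegral_normPrimitive_sq_lt_top hd hL T)
  have hA : Measurable (timePrimitive d T) :=
    (measurable_timePrimitive hd).comp measurable_prodMk_left
  have hAi : Integrable (fun x => ‖timePrimitive d T x‖ ^ 2) (volume.restrict circ) :=
    (memLp_two_iff_integrable_sq_norm hA.aestronglyMeasurable).1
      (memLp_two_of_sqNorm hA.aestronglyMeasurable (sqNorm_timePrimitive_lt_top hd hL T))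
  have e1 : sqNorm (timePrimitive d T) =
      ENNReal.ofReal (∫ x in circ, ‖timePrimitive d T x‖ ^ 2) := by
    rw [ofReal_integral_eq_lintegral_ofReal hAi (ae_of_all _ fun _ => sq_nonneg _)]
    simp only [sqNorm, enorm_sq_eq_ofReal]
  have e2 : ∫ x in circ, ‖timePrimitive d T x‖ ^ 2 =
      2 * ∫ s in Set.Ioc 0 T, ∫ x in circ, inner ℝ (timePrimitive d s x) (d s x) := by
    rw [integral_integral_swap hint, ← integral_const_mul]
    refine integral_congr_ae ?_
    filter_upwards [ae_normPrimitive_lt_top hd hL T] with x hx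
    exact norm_sq_timePrimitive hd hT hx
  rw [e1, e2, ENNReal.ofReal_mul (by norm_num)]
  simp only [ENNReal.ofReal_ofNat]
  gcongr
  exact ofReal_integral_le_lintegral _

lemma inner_trigVec (a : E n) (z : ℂ) (k : ℤ) (i : Fin n) (x : ℝ) :
    inner ℝ a (trigVec z k i x) = a i * (z * trig k x).re := by
  unfold trigVec
  rw [EuclideanSpace.inner_single_right]
  simp [mul_comm]

/-- A square-integrable map orthogonal to all trigonometric directions vanishes. -/
lemma ae_eq_zero_of_inner_trigVec {f : ℝ → E n} (hf : Measurable f) (hs : sqNorm f < ⊤)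
    (h1 : ∀ k i, ∫ x in circ, inner ℝ (f x) (trigVec 1 k i x) = 0)
    (h2 : ∀ k i, ∫ x in circ, inner ℝ (f x) (trigVec Complex.I k i x) = 0) :
    ∀ᵐ x ∂volume.restrict circ, f x = 0 := by
  have key : sqNorm f = 0 := by
    rw [sqNorm_eq_sum hf]
    refine Finset.sum_eq_zero fun i _ => ?_
    have hL : MemLp (fun x => (f x i : ℂ)) 2 (volume.restrict circ) :=
      memLp_two_of_sqNorm (measurable_coord hf i).aestronglyMeasurable (sqNorm_coord_lt_top hf hs i)
    rw [parseval hL]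
    have hz : ∀ k, fc (fun x => (f x i : ℂ)) k = 0 := by
      intro k
      rw [fc_eq_trig]
      have hint : Integrable (fun x => (f x i : ℂ) * trig (-k) x) (volume.restrict circ) :=
        (hL.integrable (by norm_num)).mul_bdd (c := 1)
          (continuous_trig _).aestronglyMeasurable (ae_of_all _ fun x => (norm_trig _ x).le)
      have hre := h1 (-k) i
      have him := h2 (-k) i
      simp only [inner_trigVec] at hre him
      rw [← integral_re_add_im hint]
      have e1 : ∀ x, RCLike.re ((f x i : ℂ) * trig (-k) x) = f x i * (1 * trig (-k) x).re := by
        intro x; simp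
      have e2 : ∀ x, RCLike.im ((f x i : ℂ) * trig (-k) x) =
          -(f x i * (Complex.I * trig (-k) x).re) := by
        intro x; simp
      simp only [e1, e2, integral_neg, hre, him]
      simp
    simp [hz]
  unfold sqNorm at key
  rw [lintegral_eq_zero_iff (by fun_prop)] at key
  filter_upwards [key] with x hx
  simpa using hx

end

section
variable {n : ℕ}

/-- An integral Grönwall lemma for functions with values in `[0,∞]`. -/
lemma ae_eq_zero_of_le_lintegral {G Y : ℝ → ℝ≥0∞} {C : ℝ≥0∞} (hGm : Measurable G)
    (hG : ∀ T : ℝ, ∫⁻ s in Set.Ioc 0 T, G s < ⊤) (hC : C < ⊤)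
    (hB : ∀ᵐ t ∂volume.restrict (Set.Ioi 0), Y t ≤ C)
    (hY : ∀ᵐ t ∂volume.restrict (Set.Ioi 0), Y t ≤ ∫⁻ s in Set.Ioc 0 t, G s * Y s) :
    ∀ᵐ t ∂volume.restrict (Set.Ioi 0), Y t = 0 := by
  set g : ℝ → ℝ≥0∞ := fun t => ∫⁻ s in Set.Ioc 0 t, G s with hg
  set Z : ℝ → ℝ≥0∞ := fun t => ∫⁻ s in Set.Ioc 0 t, G s * Y s with hZ
  have hZg : ∀ t, Z t ≤ g t * C := by
    intro t
    rw [hg, hZ]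
    beta_reduce
    rw [← lintegral_mul_const _ hGm]
    refine lintegral_mono_ae ?_
    filter_upwards [ae_restrict_of_ae_restrict_of_subset Set.Ioc_subset_Ioi_self hB] with s hs
    gcongr
  have hZt : ∀ t, Z t < ⊤ := fun t => (hZg t).trans_lt (by have := hG t; finiteness)
  have hsplit : ∀ (f : ℝ → ℝ≥0∞) (a b : ℝ), 0 ≤ a → a ≤ b →
      ∫⁻ s in Set.Ioc 0 b, f s = (∫⁻ s in Set.Ioc 0 a, f s) + ∫⁻ s in Set.Ioc a b, f s := by
    intro f a b ha hab
    rw [← lintegral_union measurableSet_Ioc (Set.Ioc_disjoint_Ioc_of_le le_rfl),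
      Set.Ioc_union_Ioc_eq_Ioc ha hab]
  have hcont : ∀ T, ContinuousOn (fun t => (g t).toReal) (Set.Icc 0 T) := by
    intro T
    rcases lt_or_ge T 0 with hT | hT
    · simp [Set.Icc_eq_empty (not_le.2 hT)]
    have hi : IntegrableOn (fun s => (G s).toReal) (Set.Icc 0 T) := by
      rw [integrableOn_Icc_iff_integrableOn_Ioc]
      exact integrable_toReal_of_lintegral_ne_top hGm.aemeasurable (hG T).ne
    refine (intervalIntegral.continuousOn_primitive hi).congr fun t _ => ?_
    beta_reduce
    rw [integral_toReal hGm.aemeasurable (ae_lt_top hGm (hG t).ne)]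
  have hclaim : ∀ k : ℕ, ∀ t, 0 ≤ t → (g t).toReal ≤ k / 2 → Z t = 0 := by
    intro k
    induction k with
    | zero =>
      intro t _ h
      have h0 : g t = 0 := by
        have : (g t).toReal = 0 := le_antisymm (by simpa using h) ENNReal.toReal_nonneg
        exact ((ENNReal.toReal_eq_zero_iff _).1 this).resolve_right (hG t).ne
      simpa [h0] using hZg t
    | succ k ih =>
      intro t ht h
      rcases le_total (g t).toReal (k / 2) with hk | hk
      · exact ih t ht hk
      obtain ⟨a, ha, hga⟩ := intermediate_value_Icc ht (hcont t)
        (show ((k : ℝ) / 2) ∈ Set.Icc (g 0).toReal (g t).toReal from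
          ⟨by simp only [hg, Set.Ioc_self]; simp; positivity, hk⟩)
      beta_reduce at hga
      have hZa : Z a = 0 := ih a ha.1 hga.le
      have hhalf : ∫⁻ s in Set.Ioc a t, G s ≤ 2⁻¹ := by
        have h1 := hsplit G a t ha.1 ha.2
        have h2 : ∫⁻ s in Set.Ioc a t, G s < ⊤ :=
          (lintegral_mono_set (Set.Ioc_subset_Ioc_left ha.1)).trans_lt (hG t)
        have h3 : (g t).toReal = (g a).toReal + (∫⁻ s in Set.Ioc a t, G s).toReal := by
          rw [← ENNReal.toReal_add (hG a).ne h2.ne, ← h1]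
        rw [← ENNReal.toReal_le_toReal h2.ne (by simp)]
        rw [hga] at h3
        push_cast at h
        simp only [ENNReal.toReal_inv, ENNReal.toReal_ofNat]
        linarith
      have hle : Z t ≤ 2⁻¹ * Z t := by
        calc Z t = Z a + ∫⁻ s in Set.Ioc a t, G s * Y s := hsplit _ a t ha.1 ha.2
          _ = ∫⁻ s in Set.Ioc a t, G s * Y s := by rw [hZa, zero_add]
          _ ≤ ∫⁻ s in Set.Ioc a t, G s * Z t := by
            refine lintegral_mono_ae ?_
            filter_upwards [ae_restrict_of_ae_restrict_of_subset
              (Set.Ioc_subset_Ioi_self.trans (Set.Ioi_subset_Ioi ha.1)) hY,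
              ae_restrict_mem measurableSet_Ioc] with s hs hst
            gcongr
            exact hs.trans (lintegral_mono_set (Set.Ioc_subset_Ioc_right hst.2))
          _ = (∫⁻ s in Set.Ioc a t, G s) * Z t := lintegral_mul_const _ hGm
          _ ≤ 2⁻¹ * Z t := by gcongr
      by_contra hne
      have hlt : 2⁻¹ * Z t < Z t := by
        rw [mul_comm, ← div_eq_mul_inv]
        exact ENNReal.half_lt_self hne (hZt t).ne
      exact absurd hle (not_le.2 hlt)
  filter_upwards [hY, ae_restrict_mem measurableSet_Ioi] with t ht ht0
  obtain ⟨k, hk⟩ := exists_nat_ge (2 * (g t).toReal)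
  have := hclaim k t (le_of_lt ht0) (by linarith)
  exact le_antisymm (ht.trans this.le) zero_le

lemma integrable_inner_of_sqNorm {f η : ℝ → E n} (hf : Measurable f) (hη : Measurable η)
    (h1 : sqNorm f < ⊤) (h2 : sqNorm η < ⊤) :
    Integrable (fun x => inner ℝ (f x) (η x)) (volume.restrict circ) :=
  ⟨(by fun_prop : Measurable _).aestronglyMeasurable,
    ENNReal.lt_top_of_sq_le (sq_lintegral_inner_le hf hη) (by finiteness)⟩

lemma sqNorm_sub_le {f g : ℝ → E n} (hf : Measurable f) (hg : Measurable g) :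
    (sqNorm fun x => f x - g x) ≤ 2 * sqNorm f + 2 * sqNorm g := by
  unfold sqNorm
  rw [← lintegral_const_mul _ (by fun_prop), ← lintegral_const_mul _ (by fun_prop),
    ← lintegral_add_left (by fun_prop)]
  refine lintegral_mono fun x => ?_
  simpa [sub_eq_add_neg] using enorm_add_sq_le (f x) (-g x)

variable {u₀ : ℝ → E n} {u v w q : ℝ → ℝ → E n}

lemma measurable_uncurry_sub (hw : Measurable (Function.uncurry w))
    (hq : Measurable (Function.uncurry q)) :
    Measurable (Function.uncurry fun t x => w t x - q t x) := hw.sub hq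

namespace IsEnergySolAux

lemma tendsto_sqNorm_sub (hu : IsEnergySolAux n u₀ u w) (hv : IsEnergySolAux n u₀ v q)
    (hm : Measurable u₀) :
    Tendsto (fun t => sqNorm fun x => u t x - v t x) (𝓝[>] 0) (𝓝 0) := by
  have h1 : Tendsto (fun t => sqNorm fun x => u t x - u₀ x) (𝓝[>] 0) (𝓝 0) := hu.init
  have h2 : Tendsto (fun t => sqNorm fun x => v t x - u₀ x) (𝓝[>] 0) (𝓝 0) := hv.init
  have h3 := (ENNReal.Tendsto.const_mul (a := 2) h1 (Or.inr (by simp))).add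
    (ENNReal.Tendsto.const_mul (a := 2) h2 (Or.inr (by simp)))
  simp only [mul_zero, add_zero] at h3
  refine tendsto_of_tendsto_of_tendsto_of_le_of_le tendsto_const_nhds h3 (fun _ => zero_le)
    fun t => ?_
  have := sqNorm_sub_le (f := fun x => u t x - u₀ x) (g := fun x => v t x - u₀ x)
    ((hu.measurable_slice t).sub hm) ((hv.measurable_slice t).sub hm)
  simpa using this

lemma lintegral_sqNorm_sub_lt_top (hu : IsEnergySolAux n u₀ u w) (hv : IsEnergySolAux n u₀ v q) :
    ∫⁻ t in Set.Ioi 0, sqNorm (fun x => w t x - q t x) < ⊤ := by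
  have h1 := hu.lintegral_sqNorm_lt_top
  have h2 := hv.lintegral_sqNorm_lt_top
  refine (lintegral_mono fun t => sqNorm_sub_le (hu.wMeas.comp measurable_prodMk_left)
    (hv.wMeas.comp measurable_prodMk_left)).trans_lt ?_
  have m1 := measurable_sqNorm hu.wMeas
  have m2 := measurable_sqNorm hv.wMeas
  change ∫⁻ t in Set.Ioi 0, (2 * sqNorm (w t) + 2 * sqNorm (q t)) < ⊤
  rw [lintegral_add_left (by fun_prop), lintegral_const_mul _ m1, lintegral_const_mul _ m2]
  finiteness

lemma ae_inner_sub_eq (hu : IsEnergySolAux n u₀ u w) (hv : IsEnergySolAux n u₀ v q)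
    (hm : Measurable u₀) (z : ℂ) (k : ℤ) (i : Fin n) :
    ∀ᵐ t ∂volume.restrict (Set.Ioi 0), ∫ x in circ, inner ℝ (u t x - v t x) (trigVec z k i x) =
      ∫ x in circ, inner ℝ (timePrimitive (fun t x => w t x - q t x) t x) (trigVec z k i x) := by
  have hη := admissible_trigVec z k i
  set η : ℝ → E n := trigVec z k i with hηdef
  have hαu := hu.locIntegrable_inner hη
  have hαv := hv.locIntegrable_inner hη
  have hβu := hu.locIntegrable_inner_deriv hη
  have hβv := hv.locIntegrable_inner_deriv hη
  have eα : ∀ᵐ t ∂volume.restrict (Set.Ioi 0), (∫ x in circ, inner ℝ (u t x) (η x)) -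
      (∫ x in circ, inner ℝ (v t x) (η x)) = ∫ x in circ, inner ℝ (u t x - v t x) (η x) := by
    filter_upwards [hu.ae_unit, hv.ae_unit] with t h1 h2
    simp only [inner_sub_left]
    rw [integral_sub]
    · exact integrable_inner_of_sqNorm (hu.measurable_slice t) hη.meas
        (by rw [sqNorm_of_unit h1]; finiteness) hη.sq
    · exact integrable_inner_of_sqNorm (hv.measurable_slice t) hη.meas
        (by rw [sqNorm_of_unit h2]; finiteness) hη.sq
  have eβ : ∀ᵐ t ∂volume.restrict (Set.Ioi 0), (∫ x in circ, inner ℝ (w t x) (η x)) -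
      (∫ x in circ, inner ℝ (q t x) (η x)) = ∫ x in circ, inner ℝ (w t x - q t x) (η x) := by
    filter_upwards [ae_lt_top (measurable_sqNorm hu.wMeas) hu.lintegral_sqNorm_lt_top.ne,
      ae_lt_top (measurable_sqNorm hv.wMeas) hv.lintegral_sqNorm_lt_top.ne] with t h1 h2
    simp only [inner_sub_left]
    rw [integral_sub]
    · exact integrable_inner_of_sqNorm (hu.wMeas.comp measurable_prodMk_left) hη.meas h1 hη.sq
    · exact integrable_inner_of_sqNorm (hv.wMeas.comp measurable_prodMk_left) hη.meas h2 hη.sq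
  have hα : LocIntegrable fun t => ∫ x in circ, inner ℝ (u t x - v t x) (η x) := fun T =>
    ((hαu.sub hαv) T).congr
      (ae_restrict_of_ae_restrict_of_subset Set.Ioc_subset_Ioi_self eα)
  have hβ : LocIntegrable fun t => ∫ x in circ, inner ℝ (w t x - q t x) (η x) := fun T =>
    ((hβu.sub hβv) T).congr
      (ae_restrict_of_ae_restrict_of_subset Set.Ioc_subset_Ioi_self eβ)
  have hlim : Tendsto (fun t => ∫ x in circ, inner ℝ (u t x - v t x) (η x)) (𝓝[>] 0) (𝓝 0) := by
    rw [tendsto_zero_iff_enorm_tendsto_zero]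
    refine ENNReal.tendsto_zero_of_sq_le (b := fun t => (sqNorm fun x => u t x - v t x) * sqNorm η)
      (fun t => enorm_integral_sq_le (sq_lintegral_inner_le
        ((hu.measurable_slice t).sub (hv.measurable_slice t)) hη.meas)) ?_
    simpa using ENNReal.Tendsto.mul_const (b := sqNorm η) (hu.tendsto_sqNorm_sub hv hm)
      (Or.inr hη.sq.ne)
  have key := hα.ae_eq_primitive hβ (fun ψ hψ => by
    have hψ' := hψ.deriv
    have s1 : ∫ t in Set.Ioi 0, (∫ x in circ, inner ℝ (u t x - v t x) (η x)) * deriv ψ t =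
        (∫ t in Set.Ioi 0, (∫ x in circ, inner ℝ (u t x) (η x)) * deriv ψ t) -
        ∫ t in Set.Ioi 0, (∫ x in circ, inner ℝ (v t x) (η x)) * deriv ψ t := by
      rw [← integral_sub (hψ'.integrableOn_mul hαu) (hψ'.integrableOn_mul hαv)]
      refine integral_congr_ae ?_
      filter_upwards [eα] with t ht
      rw [← ht, sub_mul]
    have s2 : ∫ t in Set.Ioi 0, (∫ x in circ, inner ℝ (w t x - q t x) (η x)) * ψ t =
        (∫ t in Set.Ioi 0, (∫ x in circ, inner ℝ (w t x) (η x)) * ψ t) -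
        ∫ t in Set.Ioi 0, (∫ x in circ, inner ℝ (q t x) (η x)) * ψ t := by
      rw [← integral_sub (hψ.integrableOn_mul hβu) (hψ.integrableOn_mul hβv)]
      refine integral_congr_ae ?_
      filter_upwards [eβ] with t ht
      rw [← ht, sub_mul]
    rw [s1, s2, hηdef, hu.weakDeriv_inner z k i hψ, hv.weakDeriv_inner z k i hψ]
    ring) hlim
  filter_upwards [key, ae_restrict_mem measurableSet_Ioi] with t ht ht0
  rw [ht, intervalIntegral.integral_of_le (le_of_lt ht0),
    integral_inner_timePrimitive (measurable_uncurry_sub hu.wMeas hv.wMeas)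
      (hu.lintegral_sqNorm_sub_lt_top hv) hη]

/-- The difference of two solutions with the same initial datum is the primitive of the
difference of their time derivatives. -/
lemma ae_sub_eq_timePrimitive (hu : IsEnergySolAux n u₀ u w) (hv : IsEnergySolAux n u₀ v q)
    (hm : Measurable u₀) :
    ∀ᵐ t ∂volume.restrict (Set.Ioi 0), ∀ᵐ x ∂volume.restrict circ,
      u t x - v t x = timePrimitive (fun t x => w t x - q t x) t x := by
  have hd := measurable_uncurry_sub hu.wMeas hv.wMeas
  have hL := hu.lintegral_sqNorm_sub_lt_top hv
  filter_upwards [hu.ae_unit, hv.ae_unit,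
    ae_all_iff.2 fun k => ae_all_iff.2 fun i => hu.ae_inner_sub_eq hv hm 1 k i,
    ae_all_iff.2 fun k => ae_all_iff.2 fun i => hu.ae_inner_sub_eq hv hm Complex.I k i]
    with t h1 h2 h3 h4
  have mu := hu.measurable_slice t
  have mv := hv.measurable_slice t
  have mD : Measurable fun x => u t x - v t x := mu.sub mv
  have mA : Measurable (timePrimitive (fun t x => w t x - q t x) t) :=
    (measurable_timePrimitive hd).comp measurable_prodMk_left
  have sD : sqNorm (fun x => u t x - v t x) < ⊤ :=
    (sqNorm_sub_le mu mv).trans_lt (by rw [sqNorm_of_unit h1, sqNorm_of_unit h2]; finiteness)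
  have sA := sqNorm_timePrimitive_lt_top hd hL t
  have hz : ∀ z k i, ∫ x in circ, inner ℝ (u t x - v t x) (trigVec z k i x) =
      ∫ x in circ, inner ℝ (timePrimitive (fun t x => w t x - q t x) t x) (trigVec z k i x) →
      ∫ x in circ, inner ℝ (u t x - v t x - timePrimitive (fun t x => w t x - q t x) t x)
        (trigVec z k i x) = 0 := by
    intro z k i h
    have hη := admissible_trigVec (n := n) z k i
    simp only [inner_sub_left _ (timePrimitive _ _ _)]
    rw [integral_sub (integrable_inner_of_sqNorm mD hη.meas sD hη.sq)
      (integrable_inner_of_sqNorm mA hη.meas sA hη.sq), h, sub_self]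
  have := ae_eq_zero_of_inner_trigVec (mD.sub mA)
    ((sqNorm_sub_le mD mA).trans_lt (by finiteness))
    (fun k i => hz 1 k i (h3 k i)) (fun k i => hz Complex.I k i (h4 k i))
  filter_upwards [this] with x hx
  exact sub_eq_zero.1 hx

lemma ae_sliceCoeff_le (hu : IsEnergySolAux n u₀ u w) :
    ∃ K : ℝ≥0∞, K < ⊤ ∧ ∀ᵐ t ∂volume.restrict (Set.Ioi 0),
      sliceCoeff (u t) ≤ K * (1 + hSob 1 (u t)) := by
  obtain ⟨M, hM, hae⟩ := hu.ae_gagEnergy_le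
  refine ⟨16 * M * (ENNReal.ofReal (2 * π) ^ 3 + ENNReal.ofReal (2 * π) * M), by finiteness, ?_⟩
  filter_upwards [hae, hu.ae_unit] with t h1 h2
  have h3 := incrEnergy_le_hSob (hu.measurable_slice t) (hu.periodic t)
    (by rw [sqNorm_of_unit h2]; finiteness)
  unfold sliceCoeff
  calc _ ≤ 16 * M * (ENNReal.ofReal (2 * π) ^ 3 * hSob 1 (u t) + ENNReal.ofReal (2 * π) * M) := by
        gcongr
    _ ≤ 16 * M * ((ENNReal.ofReal (2 * π) ^ 3 + ENNReal.ofReal (2 * π) * M) *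
          (1 + hSob 1 (u t))) := by
        gcongr
        rw [add_mul]
        refine add_le_add ?_ ?_
        · gcongr
          exact le_add_self
        · exact le_mul_of_one_le_right zero_le le_self_add
    _ = _ := by ring

/-- Uniqueness on almost every time slice. -/
lemma ae_sqNorm_sub_eq_zero (hu : IsEnergySolAux n u₀ u w) (hv : IsEnergySolAux n u₀ v q)
    (hm : Measurable u₀)
    (huH1 : ∀ᵐ t ∂(volume.restrict (Set.Ioi (0 : ℝ))), hSob 1 (u t) < ⊤)
    (hvH1 : ∀ᵐ t ∂(volume.restrict (Set.Ioi (0 : ℝ))), hSob 1 (v t) < ⊤)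
    (huH1int : ∀ T : ℝ, 0 < T → (∫⁻ t in Set.Ioc (0 : ℝ) T, hSob 1 (u t)) < ⊤)
    (hvH1int : ∀ T : ℝ, 0 < T → (∫⁻ t in Set.Ioc (0 : ℝ) T, hSob 1 (v t)) < ⊤) :
    ∀ᵐ t ∂volume.restrict (Set.Ioi 0), (sqNorm fun x => u t x - v t x) = 0 := by
  obtain ⟨K, hK, hKu⟩ := hu.ae_sliceCoeff_le
  obtain ⟨K', hK', hKv⟩ := hv.ae_sliceCoeff_le
  have hd := measurable_uncurry_sub hu.wMeas hv.wMeas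
  have hL := hu.lintegral_sqNorm_sub_lt_top hv
  have mu := measurable_hSob 1 hu.meas
  have mv := measurable_hSob 1 hv.meas
  have su := hu.ae_sliceData huH1
  have sv := hv.ae_sliceData hvH1
  have hDA := hu.ae_sub_eq_timePrimitive hv hm
  refine ae_eq_zero_of_le_lintegral
    (G := fun t => 2 * (K * (1 + hSob 1 (u t)) + K' * (1 + hSob 1 (v t)) + ENNReal.ofReal (2 * π)))
    (C := 2 * ENNReal.ofReal (2 * π) + 2 * ENNReal.ofReal (2 * π))
    (by fun_prop) (fun T => ?_) (by finiteness) ?_ ?_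
  · rcases le_or_gt T 0 with hT | hT
    · simp [Set.Ioc_eq_empty (not_lt.2 hT)]
    have i1 := huH1int T hT
    have i2 := hvH1int T hT
    have i3 := lintegral_Ioc_const_lt_top (c := 1) (by simp) T
    have i4 := lintegral_Ioc_const_lt_top (c := ENNReal.ofReal (2 * π)) ENNReal.ofReal_lt_top T
    rw [lintegral_const_mul _ (by fun_prop), lintegral_add_left (by fun_prop),
      lintegral_add_left (by fun_prop), lintegral_const_mul _ (by fun_prop),
      lintegral_const_mul _ (by fun_prop), lintegral_add_left (by fun_prop),
      lintegral_add_left (by fun_prop)]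
    finiteness
  · filter_upwards [hu.ae_unit, hv.ae_unit] with t h1 h2
    rw [← sqNorm_of_unit h1]
    nth_rewrite 2 [sqNorm_of_unit h1]
    rw [← sqNorm_of_unit h2]
    exact sqNorm_sub_le (hu.measurable_slice t) (hv.measurable_slice t)
  · filter_upwards [hDA, ae_restrict_mem measurableSet_Ioi] with t ht ht0
    have e : (sqNorm fun x => u t x - v t x) =
        sqNorm (timePrimitive (fun t x => w t x - q t x) t) := by
      unfold sqNorm
      refine lintegral_congr_ae ?_
      filter_upwards [ht] with x hx
      rw [hx]
    rw [e]
    refine (sqNorm_timePrimitive_le hd hL (le_of_lt ht0)).trans ?_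
    rw [← lintegral_const_mul' _ _ (by simp)]
    refine lintegral_mono_ae (ae_restrict_of_ae_restrict_of_subset Set.Ioc_subset_Ioi_self ?_)
    filter_upwards [hDA, su, sv, hu.ae_flowResidual su, hv.ae_flowResidual sv,
      hu.ae_hHalf_lt_top, hv.ae_hHalf_lt_top, hKu, hKv] with s h1 h2 h3 h4 h5 h6 h7 h8 h9
    rw [mul_assoc]
    gcongr
    have e2 : ∫ x in circ, inner ℝ (timePrimitive (fun t x => w t x - q t x) s x)
        (w s x - q s x) = ∫ x in circ, inner ℝ (w s x - q s x) (u s x - v s x) := by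
      refine integral_congr_ae ?_
      filter_upwards [h1] with x hx
      rw [← hx, real_inner_comm]
    rw [e2]
    refine (slice_inequality h2 h3 h4 h5 h6 h7).trans ?_
    gcongr

end IsEnergySolAux

end

/-- Uniqueness of energy-class solutions under the additional
regularity `u(t,·), v(t,·) ∈ H¹(S¹)` with locally square-integrable `H¹`-norm in time,
and with the energy decay property. -/
theorem uniqueness_higher_regularity (n : ℕ) (hn : 2 ≤ n) (u₀ : ℝ → E n)
    (hu₀m : Measurable u₀) (hu₀p : Function.Periodic u₀ (2 * π))
    (hu₀s : ∀ x, ‖u₀ x‖ = 1) (hu₀e : hHalf u₀ < ⊤)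
    (u v : ℝ → ℝ → E n)
    (hu : IsEnergySol n u₀ u) (hv : IsEnergySol n u₀ v)
    (huH1 : ∀ᵐ t ∂(volume.restrict (Set.Ioi (0 : ℝ))), hSob 1 (u t) < ⊤)
    (hvH1 : ∀ᵐ t ∂(volume.restrict (Set.Ioi (0 : ℝ))), hSob 1 (v t) < ⊤)
    (huH1int : ∀ T : ℝ, 0 < T → (∫⁻ t in Set.Ioc (0 : ℝ) T, hSob 1 (u t)) < ⊤)
    (hvH1int : ∀ T : ℝ, 0 < T → (∫⁻ t in Set.Ioc (0 : ℝ) T, hSob 1 (v t)) < ⊤)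
    (hud : EnergyDecay u₀ u) (hvd : EnergyDecay u₀ v) :
    ∀ᵐ p ∂STmeasure, u p.1 p.2 = v p.1 p.2 := by
  obtain ⟨w, hu⟩ := hu
  obtain ⟨q, hv⟩ := hv
  unfold STmeasure
  refine (Measure.ae_prod_iff_ae_ae (show MeasurableSet {p : ℝ × ℝ | u p.1 p.2 = v p.1 p.2} from
    measurableSet_eq_fun hu.meas hv.meas)).2 ?_
  filter_upwards [hu.ae_sqNorm_sub_eq_zero hv hu₀m huH1 hvH1 huH1int hvH1int] with t ht
  have mD : Measurable fun x => u t x - v t x := (hu.measurable_slice t).sub (hv.measurable_slice t)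
  unfold sqNorm at ht
  rw [lintegral_eq_zero_iff (by fun_prop)] at ht
  filter_upwards [ht] with x hx
  simpa [sub_eq_zero] using hx

end
end

section
/- For every measurable square-integrable u : S¹ → ℝ, the identity ∫_{S¹}∫_{S¹} |u(x)−u(y)|²/|x−y|² dy dx = 4π² · Σ_{k∈ℤ} |k| |û(k)|² holds as an equality in [0,∞]. In particular, the Gagliardo-type double integral ∫_{S¹}|d_{1/2}u|²(x) dx is comparable (equal up to a fixed positive constant) to the squared homogeneous seminorm ‖u‖²_{Ḣ^{1/2}} = Σ_{k∈ℤ}|k||û(k)|². -/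
open MeasureTheory Real Filter
open scoped BigOperators ENNReal Real Topology

noncomputable section

lemma Function.Periodic.setLIntegral_Ioc_eq {f : ℝ → ℝ≥0∞} {T : ℝ} (hT : 0 < T)
    (hf : Function.Periodic f T) (a b : ℝ) :
    ∫⁻ x in Set.Ioc a (a + T), f x = ∫⁻ x in Set.Ioc b (b + T), f x := by
  have := Fact.mk hT
  have h := fun t => AddCircle.lintegral_preimage T t hf.lift
  simp only [Function.Periodic.lift_coe] at h
  rw [h, h]

lemma setLIntegral_circ_sub_left {f : ℝ → ℝ≥0∞} (hf : Function.Periodic f (2 * π)) (c : ℝ) :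
    ∫⁻ x in circ, f (c - x) = ∫⁻ x in circ, f x := by
  have hpre : (fun x => c - x) ⁻¹' Set.Ico (c - π) (c - π + 2 * π) = circ := by
    ext x
    simp only [circ, Set.mem_preimage, Set.mem_Ico, Set.mem_Ioc]
    constructor <;> rintro ⟨h₁, h₂⟩ <;> constructor <;> linarith
  have h := (Measure.measurePreserving_sub_left (volume : Measure ℝ) c).setLIntegral_comp_preimage_emb
    (MeasurableEquiv.subLeft c).measurableEmbedding f (Set.Ico (c - π) (c - π + 2 * π))
  rw [hpre] at h
  rw [h, setLIntegral_congr Ico_ae_eq_Ioc, hf.setLIntegral_Ioc_eq two_pi_pos _ (-π)]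
  congr 3
  ring

lemma setLIntegral_circ_sub_right {f : ℝ → ℝ≥0∞} (hf : Function.Periodic f (2 * π)) (c : ℝ) :
    ∫⁻ x in circ, f (x - c) = ∫⁻ x in circ, f x := by
  have hg : Function.Periodic (fun x => f (-x)) (2 * π) := fun x => by
    simpa [sub_eq_add_neg, add_comm] using hf.sub_eq (-x)
  have h₁ := setLIntegral_circ_sub_left hg c
  have h₂ := setLIntegral_circ_sub_left hf 0
  simp only [neg_sub, zero_sub] at h₁ h₂
  rw [h₁, h₂]

lemma fcR_eq_fourierCoeffOn (f : ℝ → ℝ) (k : ℤ) :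
    fcR f k = fourierCoeffOn (neg_lt_self pi_pos) (fun x => (f x : ℂ)) k := by
  rw [fourierCoeffOn_eq_integral, fcR, fc, intervalIntegral.integral_of_le (by linarith [pi_pos]),
    Complex.real_smul]
  congr 2
  · ring
  · ext x
    simp only [fourier_coe_apply, smul_eq_mul]
    rw [mul_comm]
    congr 2
    have : (π : ℂ) ≠ 0 := by exact_mod_cast pi_ne_zero
    push_cast
    field_simp
    ring

lemma lintegral_sq_eq_tsum_fcR {f : ℝ → ℝ} (hf : MemLp f 2 (volume.restrict circ)) :
    ∫⁻ x in circ, ENNReal.ofReal (f x ^ 2)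
      = ENNReal.ofReal (2 * π) * ∑' k : ℤ, (‖fcR f k‖₊ : ℝ≥0∞) ^ 2 := by
  have hs := hasSum_sq_fourierCoeffOn (neg_lt_self pi_pos) (f := fun x => (f x : ℂ)) hf.ofReal
  simp only [← fcR_eq_fourierCoeffOn] at hs
  have hterm : ∀ k : ℤ, (‖fcR f k‖₊ : ℝ≥0∞) ^ 2 = ENNReal.ofReal (‖fcR f k‖ ^ 2) := fun k => by
    rw [ENNReal.ofReal_pow (norm_nonneg _), ofReal_norm, enorm_eq_nnnorm]
  simp_rw [hterm]
  rw [← ENNReal.ofReal_tsum_of_nonneg (fun _ => sq_nonneg _) hs.summable, hs.tsum_eq,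
    ← ENNReal.ofReal_mul two_pi_pos.le,
    ← ofReal_integral_eq_lintegral_ofReal hf.integrable_sq (ae_of_all _ fun _ => sq_nonneg _),
    intervalIntegral.integral_of_le (by linarith [pi_pos])]
  simp only [Complex.norm_real, norm_eq_abs, sq_abs, smul_eq_mul, circ]
  congr 1
  have := pi_ne_zero
  field_simp
  ring

lemma setIntegral_circ_sub_right {f : ℝ → ℂ} (hf : Function.Periodic f (2 * π)) (c : ℝ) :
    ∫ x in circ, f (x - c) = ∫ x in circ, f x := by
  have hle : -π ≤ π := by linarith [pi_pos]
  rw [circ, ← intervalIntegral.integral_of_le hle, ← intervalIntegral.integral_of_le hle,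
    intervalIntegral.integral_comp_sub_right]
  have := hf.intervalIntegral_add_eq (-π - c) (-π)
  convert this using 2 <;> ring

lemma fc_comp_sub_right {f : ℝ → ℂ} (hf : Function.Periodic f (2 * π)) (c : ℝ) (k : ℤ) :
    fc (fun x => f (x - c)) k = Complex.exp (-(Complex.I * k * c)) * fc f k := by
  have hg : Function.Periodic
      (fun x : ℝ => f x * Complex.exp (-(Complex.I * (k : ℂ) * (x : ℂ)))) (2 * π) := fun x => by
    have : -(Complex.I * (k : ℂ) * ((x + 2 * π : ℝ) : ℂ))
        = -(Complex.I * k * x) + (-k : ℤ) * (2 * π * Complex.I) := by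
      push_cast; ring
    simp only [hf x, this, Complex.exp_add, Complex.exp_int_mul_two_pi_mul_I, mul_one]
  rw [fc, fc, ← setIntegral_circ_sub_right hg c, mul_left_comm,
    ← integral_const_mul (Complex.exp (-(Complex.I * k * c)))]
  congr 1
  refine integral_congr_ae (ae_of_all _ fun x => ?_)
  have : Complex.exp (-(Complex.I * k * x)) = Complex.exp (-(Complex.I * k * c))
      * Complex.exp (-(Complex.I * k * ((x - c : ℝ) : ℂ))) := by
    rw [← Complex.exp_add]; congr 1; push_cast; ring
  simp only [this]
  ring

lemma normSq_one_sub_exp (t : ℝ) :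
    ‖1 - Complex.exp (-(Complex.I * t))‖ ^ 2 = 4 * Real.sin (t / 2) ^ 2 := by
  have h : -(Complex.I * t) = ((-t : ℝ) : ℂ) * Complex.I := by push_cast; ring
  have hc : Real.cos t = 1 - 2 * Real.sin (t / 2) ^ 2 := by
    rw [← mul_div_cancel₀ t two_ne_zero, Real.cos_two_mul, Real.cos_sq']
    ring_nf
  rw [h, ← Complex.normSq_eq_norm_sq, Complex.normSq_apply]
  simp only [Complex.sub_re, Complex.sub_im, Complex.exp_ofReal_mul_I_re,
    Complex.exp_ofReal_mul_I_im, Complex.one_re, Complex.one_im, Real.cos_neg, Real.sin_neg]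
  nlinarith [Real.sin_sq_add_cos_sq t]

lemma memLp_two_circ_iff {u : ℝ → ℝ} (hm : Measurable u) :
    MemLp u 2 (volume.restrict circ) ↔ ∫⁻ x in circ, (‖u x‖₊ : ℝ≥0∞) ^ 2 < ⊤ := by
  rw [MemLp, and_iff_right hm.aestronglyMeasurable,
    eLpNorm_lt_top_iff_lintegral_rpow_enorm_lt_top two_ne_zero ENNReal.ofNat_ne_top]
  simp [enorm_eq_nnnorm]

lemma memLp_circ_comp_sub_right {u : ℝ → ℝ} (hm : Measurable u)
    (hp : Function.Periodic u (2 * π)) (hu : MemLp u 2 (volume.restrict circ)) (h : ℝ) :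
    MemLp (fun x => u (x - h)) 2 (volume.restrict circ) := by
  rw [memLp_two_circ_iff (by fun_prop)]
  rw [memLp_two_circ_iff hm] at hu
  rwa [setLIntegral_circ_sub_right (f := fun x => (‖u x‖₊ : ℝ≥0∞) ^ 2) (fun x => by simp only [hp x])]

lemma fcR_sub {u v : ℝ → ℝ} (hu : Integrable u (volume.restrict circ))
    (hv : Integrable v (volume.restrict circ)) (k : ℤ) :
    fcR (fun x => u x - v x) k = fcR u k - fcR v k := by
  have hint : ∀ w : ℝ → ℝ, Integrable w (volume.restrict circ) →
      Integrable (fun x => (w x : ℂ) * Complex.exp (-(Complex.I * (k : ℂ) * (x : ℂ))))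
        (volume.restrict circ) := fun w hw => by
    refine hw.ofReal.mul_bdd (c := 1) (by fun_prop) (ae_of_all _ fun x => ?_)
    rw [Complex.norm_exp]
    simp
  simp only [fcR, fc, Complex.ofReal_sub, sub_mul]
  rw [integral_sub (hint u hu) (hint v hv), mul_sub]

/-- Parseval's identity for the difference of a periodic function and its translate. -/
lemma lintegral_sq_sub_translate {u : ℝ → ℝ} (hm : Measurable u)
    (hp : Function.Periodic u (2 * π)) (hu : MemLp u 2 (volume.restrict circ)) (h : ℝ) :
    ∫⁻ x in circ, ENNReal.ofReal ((u x - u (x - h)) ^ 2)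
      = ENNReal.ofReal (2 * π) * ∑' k : ℤ,
        ENNReal.ofReal (4 * Real.sin (k * h / 2) ^ 2) * (‖fcR u k‖₊ : ℝ≥0∞) ^ 2 := by
  have hv := memLp_circ_comp_sub_right hm hp hu h
  have hfin : IsFiniteMeasure (volume.restrict circ) := by unfold circ; infer_instance
  rw [lintegral_sq_eq_tsum_fcR (f := fun x => u x - u (x - h)) (hu.sub hv)]
  congr 2
  ext k
  have htr : fcR (fun x => u (x - h)) k = Complex.exp (-(Complex.I * k * h)) * fcR u k :=
    fc_comp_sub_right (f := fun x => (u x : ℂ)) (fun x => by simp only [hp x]) h k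
  have hk : fcR (fun x => u x - u (x - h)) k
      = (1 - Complex.exp (-(Complex.I * ((k * h : ℝ) : ℂ)))) * fcR u k := by
    rw [fcR_sub (hu.integrable one_le_two) (hv.integrable one_le_two), htr]
    push_cast
    ring_nf
  rw [hk, nnnorm_mul, ENNReal.coe_mul, mul_pow, ← normSq_one_sub_exp,
    ENNReal.ofReal_pow (norm_nonneg _), ofReal_norm, enorm_eq_nnnorm]

lemma sin_sq_natCast_mul_half (n : ℕ) (t : ℝ) :
    Real.sin (n * t / 2) ^ 2 = Real.sin (t / 2) ^ 2 *
      ∑ i ∈ Finset.range n, ∑ j ∈ Finset.range n, Real.cos (((i - j : ℤ) : ℝ) * t) := by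
  have hz : ∀ m : ℕ, Complex.exp (-(Complex.I * ((m * t : ℝ) : ℂ)))
      = Complex.exp (-(Complex.I * t)) ^ m := fun m => by
    rw [← Complex.exp_nat_mul]; congr 1; push_cast; ring
  have hsum : ‖∑ i ∈ Finset.range n, Complex.exp (-(Complex.I * t)) ^ i‖ ^ 2
      = ∑ i ∈ Finset.range n, ∑ j ∈ Finset.range n, Real.cos (((i - j : ℤ) : ℝ) * t) := by
    have hexp : ∀ m : ℕ, Complex.exp (-(Complex.I * t)) ^ m
        = Complex.exp (((-(m * t) : ℝ) : ℂ) * Complex.I) := fun m => by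
      rw [← hz]; congr 1; push_cast; ring
    simp only [hexp]
    rw [← Complex.normSq_eq_norm_sq, Complex.normSq_apply]
    simp only [Complex.re_sum, Complex.im_sum, Complex.exp_ofReal_mul_I_re,
      Complex.exp_ofReal_mul_I_im, Finset.sum_mul_sum, ← Finset.sum_add_distrib,
      ← Real.cos_sub]
    refine Finset.sum_congr rfl fun i _ => Finset.sum_congr rfl fun j _ => ?_
    rw [← Real.cos_neg]
    congr 1
    push_cast
    ring
  have h := congrArg (fun z => ‖z‖ ^ 2) (mul_neg_geom_sum (Complex.exp (-(Complex.I * t))) n)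
  simp only [norm_mul, mul_pow, hsum] at h
  rw [← hz, normSq_one_sub_exp, normSq_one_sub_exp] at h
  linarith

lemma integral_circ_cos_int_mul (m : ℤ) :
    ∫ t in circ, Real.cos (m * t) = if m = 0 then 2 * π else 0 := by
  rw [circ, ← intervalIntegral.integral_of_le (by linarith [pi_pos])]
  split_ifs with hm
  · simp [hm]; ring
  · rw [intervalIntegral.integral_comp_mul_left _ (by exact_mod_cast hm), integral_cos]
    simp

/-- The integral of the Fejér kernel. -/
lemma lintegral_sin_sq_div_sin_sq (k : ℤ) :
    ∫⁻ t in circ, ENNReal.ofReal (Real.sin (k * t / 2) ^ 2 / Real.sin (t / 2) ^ 2)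
      = ENNReal.ofReal (2 * π) * k.natAbs := by
  have hk : ∀ t : ℝ, Real.sin (k * t / 2) ^ 2 = Real.sin (k.natAbs * t / 2) ^ 2 := fun t => by
    obtain h | h := Int.natAbs_eq k
    · have : (k : ℝ) = k.natAbs := by rw [← Int.cast_natCast, ← h]
      rw [this]
    · have : (k : ℝ) = -k.natAbs := by
        rw [← Int.cast_natCast, ← Int.cast_neg, ← h]
      rw [this, neg_mul, neg_div, Real.sin_neg, neg_sq]
  have hker : ∀ᵐ t ∂volume.restrict circ,
      Real.sin (k * t / 2) ^ 2 / Real.sin (t / 2) ^ 2 = ∑ i ∈ Finset.range k.natAbs,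
        ∑ j ∈ Finset.range k.natAbs, Real.cos (((i - j : ℤ) : ℝ) * t) := by
    filter_upwards [ae_restrict_mem (measurableSet_Ioc : MeasurableSet circ),
      ae_restrict_of_ae (Measure.ae_ne volume (0 : ℝ))] with t ht ht0
    have hs : Real.sin (t / 2) ≠ 0 := by
      rw [Ne, Real.sin_eq_zero_iff_of_lt_of_lt (by linarith [ht.1, pi_pos])
        (by linarith [ht.2, pi_pos])]
      simpa using ht0
    rw [hk, sin_sq_natCast_mul_half, mul_div_cancel_left₀ _ (pow_ne_zero 2 hs)]
  have hint : ∀ m : ℤ, Integrable (fun t : ℝ => Real.cos (m * t)) (volume.restrict circ) :=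
    fun m => (Continuous.integrableOn_Ioc (by fun_prop))
  rw [lintegral_congr_ae (hker.mono fun t ht => congrArg ENNReal.ofReal ht),
    ← ofReal_integral_eq_lintegral_ofReal
      (integrable_finsetSum _ fun i _ => integrable_finsetSum _ fun j _ => hint _)
      (hker.mono fun t ht => (by positivity :
        0 ≤ Real.sin (k * t / 2) ^ 2 / Real.sin (t / 2) ^ 2).trans_eq ht),
    integral_finsetSum _ fun i _ => integrable_finsetSum _ fun j _ => hint _]
  simp_rw [integral_finsetSum _ fun j _ => hint _, integral_circ_cos_int_mul]
  rw [← ENNReal.ofReal_natCast, ← ENNReal.ofReal_mul two_pi_pos.le]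
  congr 1
  rw [Finset.sum_congr rfl (g := fun _ => 2 * π) fun i hi => by
    simpa [sub_eq_zero] using Finset.mem_range.1 hi]
  simp [mul_comm]

lemma lintegral_circ_gagliardo_inner {u : ℝ → ℝ} (hp : Function.Periodic u (2 * π)) (x : ℝ) :
    ∫⁻ y in circ, ENNReal.ofReal ((u x - u y) ^ 2 / cd x y ^ 2)
      = ∫⁻ h in circ, ENNReal.ofReal ((u x - u (x - h)) ^ 2 / (4 * Real.sin (h / 2) ^ 2)) := by
  rw [← setLIntegral_circ_sub_left (f := fun h =>
    ENNReal.ofReal ((u x - u (x - h)) ^ 2 / (4 * Real.sin (h / 2) ^ 2))) (fun h => ?_) x]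
  · simp only [sub_sub_cancel, cd, mul_pow, sq_abs]
    norm_num
  · have h₁ : u (x - (h + 2 * π)) = u (x - h) := by rw [← sub_sub, hp.sub_eq]
    have h₂ : (h + 2 * π) / 2 = h / 2 + π := by ring
    simp only [h₁, h₂, Real.sin_add_pi, neg_sq]

/-- The Gagliardo double integral equals `4π² Σ_k |k||û(k)|²`,
as an identity in `[0,∞]`. -/
theorem gagliardo_eq_fourier (u : ℝ → ℝ) (hm : Measurable u)
    (hp : Function.Periodic u (2 * π))
    (hL2 : (∫⁻ x in circ, (‖u x‖₊ : ℝ≥0∞) ^ 2) < ⊤) :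
    (∫⁻ x in circ, ∫⁻ y in circ, ENNReal.ofReal ((u x - u y) ^ 2 / cd x y ^ 2))
      = ENNReal.ofReal (4 * π ^ 2) * hHalfR u := by
  have hu := (memLp_two_circ_iff hm).2 hL2
  simp_rw [lintegral_circ_gagliardo_inner hp]
  rw [lintegral_lintegral_swap (by fun_prop)]
  have hinner : ∀ h : ℝ,
      ∫⁻ x in circ, ENNReal.ofReal ((u x - u (x - h)) ^ 2 / (4 * Real.sin (h / 2) ^ 2))
        = ENNReal.ofReal (2 * π) * ∑' k : ℤ, ENNReal.ofReal
          (Real.sin (k * h / 2) ^ 2 / Real.sin (h / 2) ^ 2) * (‖fcR u k‖₊ : ℝ≥0∞) ^ 2 := by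
    intro h
    simp_rw [div_eq_mul_inv, ENNReal.ofReal_mul (sq_nonneg _)]
    rw [lintegral_mul_const _ (by fun_prop), lintegral_sq_sub_translate hm hp hu, mul_assoc,
      ← ENNReal.tsum_mul_right]
    congr 2
    ext k
    rw [mul_right_comm, ← ENNReal.ofReal_mul (by positivity), ← ENNReal.ofReal_mul (sq_nonneg _),
      ← div_eq_mul_inv, mul_div_mul_left _ _ four_ne_zero]
    simp only [div_eq_mul_inv]
  simp_rw [hinner]
  rw [lintegral_const_mul _ (by fun_prop), lintegral_tsum (fun k => by fun_prop)]
  have hmeas : ∀ k : ℤ, Measurable fun h : ℝ =>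
      ENNReal.ofReal (Real.sin (k * h / 2) ^ 2 / Real.sin (h / 2) ^ 2) := fun k => by fun_prop
  have hterm : ∀ k : ℤ, ∫⁻ h in circ, ENNReal.ofReal
      (Real.sin (k * h / 2) ^ 2 / Real.sin (h / 2) ^ 2) * (‖fcR u k‖₊ : ℝ≥0∞) ^ 2
        = ENNReal.ofReal (2 * π) * (k.natAbs * (‖fcR u k‖₊ : ℝ≥0∞) ^ 2) := fun k => by
    rw [lintegral_mul_const _ (hmeas k), lintegral_sin_sq_div_sin_sq, mul_assoc]
  simp_rw [hterm]
  rw [ENNReal.tsum_mul_left, ← mul_assoc, ← ENNReal.ofReal_mul two_pi_pos.le, hHalfR]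
  congr 2
  ring
end
end
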